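/- Let P = (p_0:p_1:p_2) be a point with m_P(C) = 2 and let m ≥ 1. Then P is an A_{2m−1} singularity (i.e., the completion of O_{C,P} is isomorphic as a K-algebra to K[[u,v]]/(v² − u^{2m})) if and only if: (i) G_P = L_1·L_2 for two non-proportional linear forms L_1, L_2 ∈ K[s,t], and (ii) m is the largest integer t ≥ 1 such that the local ring at P of the homogeneous ideal J_t ⊆ K[w_0,w_1,w_2] generated by all homogeneous h with (L_1 L_2)^t dividing h(f_0,f_1,f_2) is isomorphic as a K-algebra to K[u]/(u^t) (i.e., the image under f of the union of the t-th order neighborhoods of the two preimages of P is a curvilinear scheme of length t). -/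

import Mathlib

open MvPolynomial

noncomputable section

/-- The coefficient `a_i` of `s^(n-i) t^i` in a binary form `f` of degree `n`. -/
def bcoeff {K : Type*} [Field K] (n : ℕ) (f : MvPolynomial (Fin 2) K) (i : Fin (n + 1)) : K :=
  MvPolynomial.coeff (Finsupp.single 0 (n - (i : ℕ)) + Finsupp.single 1 (i : ℕ)) f

/-- The binary form of degree `k` with coefficient vector `x`. -/
def formOf {K : Type*} [Field K] (k : ℕ) (x : Fin (k + 1) → K) : MvPolynomial (Fin 2) K :=
  ∑ i : Fin (k + 1),
    MvPolynomial.C (x i) * MvPolynomial.X 0 ^ (k - (i : ℕ)) * MvPolynomial.X 1 ^ (i : ℕ)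

/-- The matrix `M_k` associated to the parameterization `f`: the first `n-k+1` rows contain
the variables `x_0, …, x_k` in staircase position, the last three rows are the coefficient
vectors of `f_0, f_1, f_2`. -/
def Mmat {K : Type*} [Field K] (n k : ℕ) (f : Fin 3 → MvPolynomial (Fin 2) K) :
    Matrix (Fin (n - k + 4)) (Fin (n + 1)) (MvPolynomial (Fin (k + 1)) K) :=
  fun j c =>
    if hj : (j : ℕ) ≤ n - k then
      if h : (j : ℕ) ≤ (c : ℕ) ∧ (c : ℕ) ≤ (j : ℕ) + k then
        MvPolynomial.X ⟨(c : ℕ) - (j : ℕ), by omega⟩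
      else 0
    else
      MvPolynomial.C (bcoeff n (f ⟨(j : ℕ) - (n - k + 1), by have := j.isLt; omega⟩) c)

/-- The set of `(n-k+3) × (n-k+3)` minors of the matrix `M_k`; it generates the ideal
`I_{X_k}`. -/
def minorsSet {K : Type*} [Field K] (n k : ℕ) (f : Fin 3 → MvPolynomial (Fin 2) K) :
    Set (MvPolynomial (Fin (k + 1)) K) :=
  { g | ∃ (r : Fin (n - k + 3) → Fin (n - k + 4)) (c : Fin (n - k + 3) → Fin (n + 1)),
      Function.Injective r ∧ Function.Injective c ∧
      g = ((Mmat n k f).submatrix r c).det }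

/-- The projective zero locus `X_k(K) ⊆ ℙ^k(K)` of the ideal of minors of `M_k`. -/
def XkSet {K : Type*} [Field K] (n k : ℕ) (f : Fin 3 → MvPolynomial (Fin 2) K) :
    Set (Projectivization K (Fin (k + 1) → K)) :=
  { P | ∀ g ∈ minorsSet n k f, MvPolynomial.eval P.rep g = 0 }

/-- Evaluation of the parameterization at a vector `v ∈ K²`. -/
def evalVec {K : Type*} [Field K] (f : Fin 3 → MvPolynomial (Fin 2) K) (v : Fin 2 → K) :
    Fin 3 → K :=
  fun u => MvPolynomial.eval v (f u)

/-- The induced map `f : ℙ¹(K) → ℙ²(K)` (with a junk value where undefined). -/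
def projMap {K : Type*} [Field K] (f : Fin 3 → MvPolynomial (Fin 2) K)
    (P : Projectivization K (Fin 2 → K)) : Projectivization K (Fin 3 → K) :=
  haveI := Classical.propDecidable (evalVec f P.rep ≠ 0)
  if h : evalVec f P.rep ≠ 0 then Projectivization.mk K _ h
  else Projectivization.mk K (fun _ => 1) (fun hc => one_ne_zero (congrFun hc 0))

/-- `f = (f_0, f_1, f_2)` is a proper parameterization of degree `n`: the `f_u` are
homogeneous of degree `n`, have no common zero outside the origin, and the induced map
`ℙ¹(K) → ℙ²(K)` is injective outside some finite set. -/
structure IsProperParam {K : Type*} [Field K] (n : ℕ)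
    (f : Fin 3 → MvPolynomial (Fin 2) K) : Prop where
  homog : ∀ u, (f u).IsHomogeneous n
  no_common_zero : ∀ v : Fin 2 → K, v ≠ 0 → evalVec f v ≠ 0
  gen_injective : ∃ S : Set (Projectivization K (Fin 2 → K)), S.Finite ∧
    Set.InjOn (projMap f) Sᶜ

/-- The homogeneous vanishing ideal of the point `p ∈ ℙ²(K)`. -/
def pointIdeal {K : Type*} [Field K] (p : Fin 3 → K) : Ideal (MvPolynomial (Fin 3) K) :=
  Ideal.span { L | L.IsHomogeneous 1 ∧ MvPolynomial.eval p L = 0 }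

/-- The multiplicity of the curve `{F = 0}` at the point `p`:
the largest `m` with `F ∈ I(p)^m`. -/
def multAt {K : Type*} [Field K] (F : MvPolynomial (Fin 3) K) (p : Fin 3 → K) : ℕ :=
  sSup { m | F ∈ pointIdeal p ^ m }

/-- The cross difference `p_i f_j - p_j f_i`. -/
def crossDiff {K : Type*} [Field K] (f : Fin 3 → MvPolynomial (Fin 2) K) (p : Fin 3 → K)
    (i j : Fin 3) : MvPolynomial (Fin 2) K :=
  MvPolynomial.C (p i) * f j - MvPolynomial.C (p j) * f i

/-- `G` is a greatest common divisor of the three cross differences `p_i f_j - p_j f_i`,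
`0 ≤ i < j ≤ 2`. -/
def IsGcdOfCross {K : Type*} [Field K] (f : Fin 3 → MvPolynomial (Fin 2) K) (p : Fin 3 → K)
    (G : MvPolynomial (Fin 2) K) : Prop :=
  (∀ i j : Fin 3, i < j → G ∣ crossDiff f p i j) ∧
  (∀ D : MvPolynomial (Fin 2) K, (∀ i j : Fin 3, i < j → D ∣ crossDiff f p i j) → D ∣ G)

/-- The linear binary form with root `v = (v 0 : v 1)`. -/
def linFormOf {K : Type*} [Field K] (v : Fin 2 → K) : MvPolynomial (Fin 2) K :=
  MvPolynomial.C (v 1) * MvPolynomial.X 0 - MvPolynomial.C (v 0) * MvPolynomial.X 1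

/-- The multiplicity of `v` as a root of the binary form `h`. -/
def ordAt {K : Type*} [Field K] (v : Fin 2 → K) (h : MvPolynomial (Fin 2) K) : ℕ :=
  sSup { e | linFormOf v ^ e ∣ h }

/-- The point `x ∈ ℙ²` lies on the conic `4 x₀ x₂ - x₁² = 0`. -/
def onConic {K : Type*} [Field K] (x : Fin 3 → K) : Prop :=
  4 * x 0 * x 2 - x 1 ^ 2 = 0

/-- The embedding of chart indices: the two coordinates other than `c`. -/
def chartEmb (c : Fin 3) (i : Fin 2) : Fin 3 :=
  if (i : ℕ) < (c : ℕ) then ⟨(i : ℕ), by have := i.isLt; omega⟩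
  else ⟨(i : ℕ) + 1, by have := i.isLt; omega⟩

/-- Dehomogenization substitution for the affine chart `{x_c ≠ 0}` of `ℙ²`:
the variable `x_c` is sent to `1`, the other two variables to the affine coordinates. -/
def dehomMap {K : Type*} [Field K] (c : Fin 3) (j : Fin 3) : MvPolynomial (Fin 2) K :=
  if j = c then 1
  else if h2 : (j : ℕ) < (c : ℕ) then MvPolynomial.X ⟨(j : ℕ), by have := c.isLt; omega⟩
  else MvPolynomial.X ⟨(j : ℕ) - 1, by have := j.isLt; omega⟩

/-- The affine coordinates, in the chart `{x_c ≠ 0}`, of the projective point with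
homogeneous coordinates `q`. -/
def affOf {K : Type*} [Field K] (q : Fin 3 → K) (c : Fin 3) : Fin 2 → K :=
  fun i => q (chartEmb c i) / q c

/-- The dehomogenization of a homogeneous ideal of `K[x_0,x_1,x_2]` in the chart
`{x_c ≠ 0}`. -/
def dehomIdeal {K : Type*} [Field K] (c : Fin 3) (I : Ideal (MvPolynomial (Fin 3) K)) :
    Ideal (MvPolynomial (Fin 2) K) :=
  I.map (MvPolynomial.aeval (dehomMap c) : MvPolynomial (Fin 3) K →ₐ[K] MvPolynomial (Fin 2) K)

instance kerEvalMaximal {K : Type*} [Field K] (a : Fin 2 → K) :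
    (RingHom.ker (MvPolynomial.eval a : MvPolynomial (Fin 2) K →+* K)).IsMaximal :=
  RingHom.ker_isMaximal_of_surjective _ (fun r => ⟨MvPolynomial.C r, by simp⟩)

/-- The local ring at the point `a ∈ 𝔸²` of the subscheme of the affine plane defined by the
ideal `I`: the localization, at (the image of) the maximal ideal of `a`, of the quotient of
the affine coordinate ring `K[x,y]` by `I`. -/
def LocalRingAt {K : Type*} [Field K] (I : Ideal (MvPolynomial (Fin 2) K))
    (a : Fin 2 → K) : Type _ :=
  Localization
    (((RingHom.ker (MvPolynomial.eval a : MvPolynomial (Fin 2) K →+* K)).primeCompl).map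
      (Ideal.Quotient.mk I))

noncomputable instance {K : Type*} [Field K] (I : Ideal (MvPolynomial (Fin 2) K))
    (a : Fin 2 → K) : CommRing (LocalRingAt I a) :=
  inferInstanceAs (CommRing (Localization _))

noncomputable instance {K : Type*} [Field K] (I : Ideal (MvPolynomial (Fin 2) K))
    (a : Fin 2 → K) : Algebra K (LocalRingAt I a) :=
  inferInstanceAs (Algebra K (Localization _))

noncomputable instance {K : Type*} [Field K] (I : Ideal (MvPolynomial (Fin 2) K))
    (a : Fin 2 → K) : Algebra (MvPolynomial (Fin 2) K) (LocalRingAt I a) :=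
  inferInstanceAs (Algebra (MvPolynomial (Fin 2) K) (Localization _))

/-- The length at the point `a` of the subscheme of `𝔸²` defined by `I`: the `K`-dimension
of the local ring of the subscheme at `a`. -/
noncomputable def lengthAt {K : Type*} [Field K] (I : Ideal (MvPolynomial (Fin 2) K))
    (a : Fin 2 → K) : ℕ :=
  Module.finrank K (LocalRingAt I a)

/-- The delta invariant `dim_K (Ō/O)` of the local ring `O` at `a` of the plane curve defined
by `I`, computed in a field of fractions `L` of `O`. -/
noncomputable def deltaAt {K : Type*} [Field K] (I : Ideal (MvPolynomial (Fin 2) K))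
    (a : Fin 2 → K) (L : Type*) [Field L] [Algebra (LocalRingAt I a) L]
    [IsFractionRing (LocalRingAt I a) L] [Algebra K L]
    [IsScalarTower K (LocalRingAt I a) L] : ℕ :=
  Module.finrank K
    ((integralClosure (LocalRingAt I a) L) ⧸
      LinearMap.range ((Algebra.linearMap (LocalRingAt I a)
        (integralClosure (LocalRingAt I a) L)).restrictScalars K))

/-- The completion of the local ring at `a` of the plane subscheme defined by `I`, with
respect to its maximal ideal. -/
def LocalCompletion {K : Type*} [Field K] (I : Ideal (MvPolynomial (Fin 2) K))
    (a : Fin 2 → K) : Type _ :=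
  AdicCompletion
    ((RingHom.ker (MvPolynomial.eval a : MvPolynomial (Fin 2) K →+* K)).map
      (algebraMap (MvPolynomial (Fin 2) K) (LocalRingAt I a)))
    (LocalRingAt I a)

noncomputable instance {K : Type*} [Field K] (I : Ideal (MvPolynomial (Fin 2) K))
    (a : Fin 2 → K) : CommRing (LocalCompletion I a) :=
  inferInstanceAs (CommRing (AdicCompletion _ _))

noncomputable instance {K : Type*} [Field K] (I : Ideal (MvPolynomial (Fin 2) K))
    (a : Fin 2 → K) : Algebra (LocalRingAt I a) (LocalCompletion I a) :=
  inferInstanceAs (Algebra _ (AdicCompletion _ _))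

/-- `p` is an `A_s` singularity of the projective plane curve `{F = 0}`: in every affine chart
containing `p`, the completion of the local ring of the curve at `p` is isomorphic, as a
`K`-algebra, to `K[[u,v]]/(v² - u^(s+1))`. -/
def IsAsSing {K : Type*} [Field K] (F : MvPolynomial (Fin 3) K) (p : Fin 3 → K)
    (s : ℕ) : Prop :=
  ∀ c : Fin 3, p c ≠ 0 →
    ∃ e : LocalCompletion (Ideal.span {MvPolynomial.aeval (dehomMap c) F}) (affOf p c) ≃+*
        (MvPowerSeries (Fin 2) K ⧸ Ideal.span
          {(MvPowerSeries.X 1 : MvPowerSeries (Fin 2) K) ^ 2 - MvPowerSeries.X 0 ^ (s + 1)}),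
      ∀ r : K,
        e (algebraMap (LocalRingAt (Ideal.span {MvPolynomial.aeval (dehomMap c) F}) (affOf p c))
            (LocalCompletion (Ideal.span {MvPolynomial.aeval (dehomMap c) F}) (affOf p c))
            (algebraMap K _ r))
          = algebraMap K _ r

/-- The homogeneous ideal of `K[w_0,w_1,w_2]` generated by all homogeneous `h` such that `g`
divides `h(f_0,f_1,f_2)`. -/
def JIdeal {K : Type*} [Field K] (f : Fin 3 → MvPolynomial (Fin 2) K)
    (g : MvPolynomial (Fin 2) K) : Ideal (MvPolynomial (Fin 3) K) :=
  Ideal.span { h | (∃ d : ℕ, h.IsHomogeneous d) ∧ g ∣ MvPolynomial.aeval f h }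

/-- The scheme defined by the homogeneous ideal `J` is, locally at `p`, curvilinear of length
`t`: in every chart containing `p`, the local ring of `J` at `p` is isomorphic as a
`K`-algebra to `K[u]/(u^t)`. -/
def CurvilinearOfLength {K : Type*} [Field K] (J : Ideal (MvPolynomial (Fin 3) K))
    (p : Fin 3 → K) (t : ℕ) : Prop :=
  ∀ c : Fin 3, p c ≠ 0 →
    Nonempty ((LocalRingAt (dehomIdeal c J) (affOf p c)) ≃ₐ[K]
      (Polynomial K ⧸ Ideal.span {(Polynomial.X : Polynomial K) ^ t}))

namespace ASing

section LocalRing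
variable {K : Type*} [Field K]

/-- The maximal ideal of a point of the affine plane. -/
abbrev mI (a : Fin 2 → K) : Ideal (MvPolynomial (Fin 2) K) :=
  RingHom.ker (MvPolynomial.eval a : MvPolynomial (Fin 2) K →+* K)

lemma mem_mI (a : Fin 2 → K) (g : MvPolynomial (Fin 2) K) : g ∈ mI a ↔ eval a g = 0 := Iff.rfl

/-- structure map -/
def toLoc (I : Ideal (MvPolynomial (Fin 2) K)) (a : Fin 2 → K) :
    MvPolynomial (Fin 2) K →+* LocalRingAt I a :=
  algebraMap (MvPolynomial (Fin 2) K) (LocalRingAt I a)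

lemma toLoc_eq (I : Ideal (MvPolynomial (Fin 2) K)) (a : Fin 2 → K)
    (g : MvPolynomial (Fin 2) K) :
    toLoc I a g = algebraMap (MvPolynomial (Fin 2) K ⧸ I)
      (Localization (((mI a).primeCompl).map (Ideal.Quotient.mk I))) (Ideal.Quotient.mk I g) := rfl

lemma algebraMap_eq_toLoc (I : Ideal (MvPolynomial (Fin 2) K)) (a : Fin 2 → K) (r : K) :
    algebraMap K (LocalRingAt I a) r = toLoc I a (C r) := rfl

lemma toLoc_unit (I : Ideal (MvPolynomial (Fin 2) K)) (a : Fin 2 → K)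
    (s : MvPolynomial (Fin 2) K) (hs : eval a s ≠ 0) : IsUnit (toLoc I a s) := by
  have := IsLocalization.map_units
    (Localization (((mI a).primeCompl).map (Ideal.Quotient.mk I)))
    (⟨Ideal.Quotient.mk I s, Submonoid.mem_map_of_mem _ (S := (mI a).primeCompl) hs⟩ :
      (((mI a).primeCompl).map (Ideal.Quotient.mk I)))
  exact this

lemma toLoc_surj (I : Ideal (MvPolynomial (Fin 2) K)) (a : Fin 2 → K) (o : LocalRingAt I a) :
    ∃ g s : MvPolynomial (Fin 2) K, eval a s ≠ 0 ∧ o * toLoc I a s = toLoc I a g := by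
  obtain ⟨⟨x, ⟨_, s, hs, rfl⟩⟩, h⟩ := IsLocalization.surj
    (((mI a).primeCompl).map (Ideal.Quotient.mk I)) (S := Localization _) o
  obtain ⟨g, rfl⟩ := Ideal.Quotient.mk_surjective x
  exact ⟨g, s, hs, h⟩

lemma toLoc_of_mem (I : Ideal (MvPolynomial (Fin 2) K)) (a : Fin 2 → K)
    (g : MvPolynomial (Fin 2) K) (hg : g ∈ I) : toLoc I a g = 0 := by
  rw [toLoc_eq, Ideal.Quotient.eq_zero_iff_mem.2 hg, map_zero]
  rfl

lemma exists_lift (I : Ideal (MvPolynomial (Fin 2) K)) (a : Fin 2 → K)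
    {B : Type*} [CommRing B] (φ : MvPolynomial (Fin 2) K →+* B) (hI : ∀ g ∈ I, φ g = 0)
    (hu : ∀ s, eval a s ≠ 0 → IsUnit (φ s)) :
    ∃ Φ : LocalRingAt I a →+* B, ∀ g, Φ (toLoc I a g) = φ g := by
  refine ⟨IsLocalization.lift (M := (((mI a).primeCompl).map (Ideal.Quotient.mk I)))
    (S := Localization _) (g := Ideal.Quotient.lift I φ hI) ?_, ?_⟩
  · rintro ⟨_, s, hs, rfl⟩
    simpa using hu s hs
  · intro g
    rw [toLoc_eq]
    exact (IsLocalization.lift_eq (M := (((mI a).primeCompl).map (Ideal.Quotient.mk I)))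
      (S := Localization (((mI a).primeCompl).map (Ideal.Quotient.mk I))) _ _).trans (by simp)

/-- maximal ideal of the local ring -/
abbrev mL (I : Ideal (MvPolynomial (Fin 2) K)) (a : Fin 2 → K) : Ideal (LocalRingAt I a) :=
  (mI a).map (algebraMap (MvPolynomial (Fin 2) K) (LocalRingAt I a))

lemma mL_pow (I : Ideal (MvPolynomial (Fin 2) K)) (a : Fin 2 → K) (k : ℕ) :
    mL I a ^ k = (mI a ^ k).map (toLoc I a) := by
  rw [Ideal.map_pow]; rfl

lemma unit_mod (a : Fin 2 → K) (J : Ideal (MvPolynomial (Fin 2) K)) (k : ℕ) (hJ : mI a ^ k ≤ J)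
    (s : MvPolynomial (Fin 2) K) (hs : eval a s ≠ 0) :
    ∃ u, s * u - 1 ∈ J := by
  have hu : IsUnit (Ideal.Quotient.mk J s) := by
    have h1 : s = C (eval a s) + (s - C (eval a s)) := by ring
    have h2 : IsNilpotent (Ideal.Quotient.mk J (s - C (eval a s))) := by
      refine ⟨k, ?_⟩
      rw [← map_pow, Ideal.Quotient.eq_zero_iff_mem]
      exact hJ (Ideal.pow_mem_pow (by simp [RingHom.mem_ker]) k)
    rw [h1, map_add]
    refine IsNilpotent.isUnit_add_left_of_commute h2 ?_ (Commute.all _ _)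
    exact ((isUnit_iff_ne_zero.2 hs).map C).map _
  obtain ⟨v, hv⟩ := hu.exists_right_inv
  obtain ⟨u, rfl⟩ := Ideal.Quotient.mk_surjective v
  refine ⟨u, ?_⟩
  rw [← Ideal.Quotient.eq_zero_iff_mem]
  simp [hv]

lemma toLoc_dense (I : Ideal (MvPolynomial (Fin 2) K)) (a : Fin 2 → K) (k : ℕ)
    (o : LocalRingAt I a) : ∃ g, o - toLoc I a g ∈ mL I a ^ k := by
  obtain ⟨g, s, hs, h⟩ := toLoc_surj I a o
  obtain ⟨u, hu⟩ := unit_mod a (mI a ^ k) k le_rfl s hs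
  refine ⟨g * u, ?_⟩
  rw [mL_pow, map_mul, ← h]
  have := Ideal.mul_mem_left _ (-o) (Ideal.mem_map_of_mem (toLoc I a) hu)
  convert this using 1
  simp; ring

lemma toLoc_mem (I : Ideal (MvPolynomial (Fin 2) K)) (a : Fin 2 → K) (k : ℕ)
    (g : MvPolynomial (Fin 2) K) : toLoc I a g ∈ mL I a ^ k ↔ g ∈ I ⊔ mI a ^ k := by
  constructor
  · intro h
    obtain ⟨Φ, hΦ⟩ := exists_lift I a (Ideal.Quotient.mk (I ⊔ mI a ^ k))
      (fun g hg => Ideal.Quotient.eq_zero_iff_mem.2 (Ideal.mem_sup_left hg)) (by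
        intro s hs
        obtain ⟨u, hu⟩ := unit_mod a (I ⊔ mI a ^ k) k le_sup_right s hs
        refine IsUnit.of_mul_eq_one (Ideal.Quotient.mk _ u) ?_
        rw [← Ideal.Quotient.eq_zero_iff_mem] at hu
        rw [← map_mul]
        simpa [sub_eq_zero] using hu)
    rw [← Ideal.Quotient.eq_zero_iff_mem, ← hΦ]
    have : mL I a ^ k ≤ RingHom.ker Φ := by
      rw [mL_pow, Ideal.map_le_iff_le_comap]
      intro x hx
      rw [Ideal.mem_comap, RingHom.mem_ker, hΦ, Ideal.Quotient.eq_zero_iff_mem]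
      exact Ideal.mem_sup_right hx
    exact this h
  · intro h
    obtain ⟨x, hx, y, hy, rfl⟩ := Submodule.mem_sup.1 h
    rw [map_add, toLoc_of_mem I a x hx, zero_add, mL_pow]
    exact Ideal.mem_map_of_mem _ hy

/-- an ideal containing a power of the maximal ideal -/
lemma loc_equiv (I : Ideal (MvPolynomial (Fin 2) K)) (a : Fin 2 → K) (t : ℕ)
    (h : mI a ^ t ≤ I) :
    Nonempty ((MvPolynomial (Fin 2) K ⧸ I) ≃ₐ[K] LocalRingAt I a) := by
  have h0 : ∀ g, toLoc I a g = 0 ↔ g ∈ I := by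
    intro g
    constructor
    · intro hg
      have := (toLoc_mem I a t g).1 (by rw [hg]; exact zero_mem _)
      rwa [sup_eq_left.2 h] at this
    · exact toLoc_of_mem I a g
  let φ : MvPolynomial (Fin 2) K →ₐ[K] LocalRingAt I a :=
    { toLoc I a with commutes' := fun r => rfl }
  have hφ : ∀ g, φ g = toLoc I a g := fun g => rfl
  refine ⟨AlgEquiv.ofBijective (Ideal.Quotient.liftₐ I φ fun g hg => (h0 g).2 hg) ⟨?_, ?_⟩⟩
  · rw [injective_iff_map_eq_zero]
    intro x
    obtain ⟨g, rfl⟩ := Ideal.Quotient.mk_surjective x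
    intro hx
    rw [Ideal.Quotient.eq_zero_iff_mem, ← h0]
    exact hx
  · intro o
    obtain ⟨g, hg⟩ := toLoc_dense I a t o
    refine ⟨Ideal.Quotient.mk I g, ?_⟩
    have hz : mL I a ^ t = ⊥ := by
      rw [mL_pow, eq_bot_iff, Ideal.map_le_iff_le_comap]
      intro x hx
      exact (h0 x).2 (h hx)
    rw [hz, Ideal.mem_bot, sub_eq_zero] at hg
    exact hg.symm
end LocalRing
end ASing

namespace ASing

section Completion
variable {K : Type*} [Field K]

/-- The map from the polynomial ring to the completed local ring. -/
def toComp (I : Ideal (MvPolynomial (Fin 2) K)) (a : Fin 2 → K) :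
    MvPolynomial (Fin 2) K →+* LocalCompletion I a :=
  (algebraMap (LocalRingAt I a) (LocalCompletion I a)).comp (toLoc I a)

lemma toComp_apply (I : Ideal (MvPolynomial (Fin 2) K)) (a : Fin 2 → K)
    (g : MvPolynomial (Fin 2) K) :
    toComp I a g = algebraMap (LocalRingAt I a) (LocalCompletion I a) (toLoc I a g) := rfl

/-- evaluation map of the completion -/
def evC (I : Ideal (MvPolynomial (Fin 2) K)) (a : Fin 2 → K) (k : ℕ) :
    LocalCompletion I a →+* (LocalRingAt I a ⧸ (mL I a) ^ k) :=
  (AdicCompletion.evalₐ (mL I a) k).toRingHom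

lemma evC_algebraMap (I : Ideal (MvPolynomial (Fin 2) K)) (a : Fin 2 → K) (k : ℕ)
    (o : LocalRingAt I a) :
    evC I a k (algebraMap (LocalRingAt I a) (LocalCompletion I a) o) =
      Ideal.Quotient.mk _ o :=
  AdicCompletion.evalₐ_of (mL I a) k o

lemma evC_ext (I : Ideal (MvPolynomial (Fin 2) K)) (a : Fin 2 → K)
    {x y : LocalCompletion I a} (h : ∀ k, evC I a k x = evC I a k y) : x = y :=
  AdicCompletion.ext_evalₐ (I := mL I a) h

lemma evC_factor (I : Ideal (MvPolynomial (Fin 2) K)) (a : Fin 2 → K) {k l : ℕ} (h : k ≤ l)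
    (x : LocalCompletion I a) :
    Ideal.Quotient.factorPow (mL I a) h (evC I a l x) = evC I a k x := by
  obtain ⟨r, rfl⟩ := AdicCompletion.mk_surjective (mL I a) (LocalRingAt I a) x
  have h1 : evC I a l (AdicCompletion.mk (mL I a) (LocalRingAt I a) r) = Ideal.Quotient.mk _ (r l) :=
    AdicCompletion.evalₐ_mk (mL I a) l r
  have h2 : evC I a k (AdicCompletion.mk (mL I a) (LocalRingAt I a) r) = Ideal.Quotient.mk _ (r k) :=
    AdicCompletion.evalₐ_mk (mL I a) k r
  rw [h1, h2]
  exact AdicCompletion.Ideal.mk_eq_mk (mL I a) h r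

lemma evC_exists (I : Ideal (MvPolynomial (Fin 2) K)) (a : Fin 2 → K) (k : ℕ)
    (x : LocalCompletion I a) : ∃ g, evC I a k x = Ideal.Quotient.mk _ (toLoc I a g) := by
  obtain ⟨o, ho⟩ := Ideal.Quotient.mk_surjective (evC I a k x)
  obtain ⟨g, hg⟩ := toLoc_dense I a k o
  exact ⟨g, by rw [← ho, Ideal.Quotient.eq]; exact hg⟩

lemma mL_fg (I : Ideal (MvPolynomial (Fin 2) K)) (a : Fin 2 → K) : (mL I a).FG :=
  Ideal.FG.map (IsNoetherian.noetherian _) _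

lemma evalA_ker {R : Type*} [CommRing R] (I : Ideal R) (hfg : I.FG) (k : ℕ)
    (x : AdicCompletion I R) (hx : AdicCompletion.evalₐ I k x = 0) :
    x ∈ (I ^ k).map (algebraMap R (AdicCompletion I R)) := by
  have h1 : x ∈ (AdicCompletion.eval I R k).ker := by
    rw [LinearMap.mem_ker, ← AdicCompletion.factor_evalₐ_eq_eval I x
      (le_of_eq (by simp)), hx, map_zero]
  rw [← AdicCompletion.pow_smul_top_eq_ker_eval hfg] at h1
  refine Submodule.smul_induction_on h1 ?_ ?_
  · intro r hr n _
    rw [Algebra.smul_def r n]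
    exact Ideal.mul_mem_right _ _ (Ideal.mem_map_of_mem _ hr)
  · intro x y hx hy
    exact add_mem hx hy

lemma evC_ker (I : Ideal (MvPolynomial (Fin 2) K)) (a : Fin 2 → K) (k : ℕ)
    (x : LocalCompletion I a) (hx : evC I a k x = 0) :
    x ∈ ((mI a) ^ k).map (toComp I a) := by
  have h3 : ((mI a) ^ k).map (toComp I a) =
      ((mL I a) ^ k).map (algebraMap (LocalRingAt I a) (LocalCompletion I a)) := by
    rw [mL_pow, Ideal.map_map]; rfl
  rw [h3]
  exact evalA_ker (mL I a) (mL_fg I a) k x hx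

/-- density of the polynomial ring in the completion -/
lemma toComp_dense (I : Ideal (MvPolynomial (Fin 2) K)) (a : Fin 2 → K) {B : Type*} [CommRing B]
    (Ψ : LocalCompletion I a →+* B) (J : Ideal B) (hJ : ∀ g ∈ mI a, Ψ (toComp I a g) ∈ J)
    (x : LocalCompletion I a) (k : ℕ) : ∃ g, Ψ x - Ψ (toComp I a g) ∈ J ^ k := by
  obtain ⟨g, hg⟩ := evC_exists I a k x
  refine ⟨g, ?_⟩
  have h1 := evC_ker I a k (x - toComp I a g) (by
    rw [map_sub, hg, toComp_apply, evC_algebraMap, sub_self])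
  have h2 : ((mI a) ^ k).map (toComp I a) ≤ (J ^ k).comap Ψ := by
    rw [Ideal.map_le_iff_le_comap, Ideal.comap_comap]
    refine le_trans (Ideal.pow_right_mono ?_ k) (Ideal.le_comap_pow _ k)
    exact hJ
  have := h2 h1
  rwa [Ideal.mem_comap, map_sub] at this

/-- universal property of the completion -/
lemma toComp_lift (I : Ideal (MvPolynomial (Fin 2) K)) (a : Fin 2 → K) {B : Type*} [CommRing B]
    (J : Ideal B) [IsAdicComplete J B] (φ : MvPolynomial (Fin 2) K →+* B)
    (hI : ∀ g ∈ I, φ g = 0) (hJ : ∀ g ∈ mI a, φ g ∈ J) (hu : ∀ s, eval a s ≠ 0 → IsUnit (φ s)) :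
    ∃ Φ : LocalCompletion I a →+* B, ∀ g, Φ (toComp I a g) = φ g := by
  obtain ⟨Φ, hΦ⟩ := exists_lift I a φ hI hu
  have hle : ∀ k, (mL I a) ^ k ≤ (J ^ k).comap Φ := by
    intro k
    rw [mL_pow, Ideal.map_le_iff_le_comap, Ideal.comap_comap]
    refine le_trans (Ideal.pow_right_mono ?_ k) (Ideal.le_comap_pow _ k)
    intro g hg
    rw [Ideal.mem_comap, RingHom.comp_apply, hΦ]
    exact hJ g hg
  let fk : (k : ℕ) → LocalCompletion I a →+* B ⧸ J ^ k := fun k =>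
    (Ideal.quotientMap (J ^ k) Φ (hle k)).comp (evC I a k)
  have hfk : ∀ {k l : ℕ} (h : k ≤ l), (Ideal.Quotient.factorPow J h).comp (fk l) = fk k := by
    intro k l h
    ext x
    simp only [fk, RingHom.comp_apply]
    rw [← evC_factor I a h x]
    obtain ⟨o, ho⟩ := Ideal.Quotient.mk_surjective (evC I a l x)
    rw [← ho]
    rfl
  refine ⟨IsAdicComplete.liftRingHom J fk hfk, ?_⟩
  intro g
  rw [← sub_eq_zero]
  refine IsHausdorff.haus (I := J) inferInstance _ ?_
  intro k
  have h1 := IsAdicComplete.mk_liftRingHom J fk hfk k (toComp I a g)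
  have h2 : fk k (toComp I a g) = Ideal.Quotient.mk _ (φ g) := by
    simp only [fk, RingHom.comp_apply]
    rw [toComp_apply, evC_algebraMap, Ideal.quotientMap_mk, hΦ]
  rw [h2, Ideal.Quotient.eq] at h1
  rw [SModEq.zero]
  simpa using h1

/-- recognition of the completion -/
lemma toComp_equiv (I : Ideal (MvPolynomial (Fin 2) K)) (a : Fin 2 → K) {B : Type*} [CommRing B]
    (J : ℕ → Ideal B) (θ : MvPolynomial (Fin 2) K →+* B)
    (hanti : ∀ k, J (k + 1) ≤ J k)
    (hmem : ∀ k g, θ g ∈ J k ↔ g ∈ I ⊔ mI a ^ k)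
    (hdense : ∀ k b, ∃ g, b - θ g ∈ J k)
    (hsep : ∀ b, (∀ k, b ∈ J k) → b = 0)
    (hcomp : ∀ b : ℕ → B, (∀ k, b (k + 1) - b k ∈ J k) → ∃ c, ∀ k, c - b k ∈ J k) :
    ∃ e : LocalCompletion I a ≃+* B, ∀ g, e (toComp I a g) = θ g := by
  have hcm : ∀ k, I ⊔ mI a ^ k = (J k).comap θ := by
    intro k; ext g; rw [Ideal.mem_comap, hmem]
  have hcl : ∀ k, I ⊔ mI a ^ k = (mL I a ^ k).comap (toLoc I a) := by
    intro k; ext g; rw [Ideal.mem_comap, toLoc_mem]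
  let α : (k : ℕ) → (MvPolynomial (Fin 2) K ⧸ (I ⊔ mI a ^ k)) →+* B ⧸ J k := fun k =>
    Ideal.quotientMap (J k) θ (hcm k).le
  let β : (k : ℕ) → (MvPolynomial (Fin 2) K ⧸ (I ⊔ mI a ^ k)) →+* _ ⧸ (mL I a ^ k) := fun k =>
    Ideal.quotientMap _ (toLoc I a) (hcl k).le
  have hα : ∀ k, Function.Bijective (α k) := by
    intro k
    constructor
    · exact Ideal.quotientMap_injective' (hcm k).ge
    · intro b
      obtain ⟨b, rfl⟩ := Ideal.Quotient.mk_surjective b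
      obtain ⟨g, hg⟩ := hdense k b
      refine ⟨Ideal.Quotient.mk _ g, ?_⟩
      simp only [α, Ideal.quotientMap_mk]
      rw [eq_comm, Ideal.Quotient.eq]
      exact hg
  let fk : (k : ℕ) → B →+* (LocalRingAt I a ⧸ (mL I a) ^ k) := fun k =>
    (β k).comp (((RingEquiv.ofBijective (α k) (hα k)).symm : _ →+* _).comp (Ideal.Quotient.mk (J k)))
  have hfk0 : ∀ k b g, b - θ g ∈ J k → fk k b = Ideal.Quotient.mk _ (toLoc I a g) := by
    intro k b g hg
    have h1 : (Ideal.Quotient.mk (J k)) b = RingEquiv.ofBijective (α k) (hα k)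
        (Ideal.Quotient.mk _ g) := by
      rw [RingEquiv.ofBijective_apply]
      simp only [α, Ideal.quotientMap_mk]
      rw [Ideal.Quotient.eq]
      exact hg
    simp only [fk, RingHom.comp_apply]
    rw [h1]
    simp only [RingHom.coe_coe, RingEquiv.symm_apply_apply]
    simp only [β, Ideal.quotientMap_mk]
  have hant : Antitone J := antitone_nat_of_succ_le hanti
  have hfk : ∀ {k l : ℕ} (h : k ≤ l),
      (Ideal.Quotient.factorPow (mL I a) h).comp (fk l) = fk k := by
    intro k l h
    ext b
    obtain ⟨g, hg⟩ := hdense l b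
    rw [RingHom.comp_apply, hfk0 l b g hg, hfk0 k b g (hant h hg)]
    rfl
  let E : B →+* LocalCompletion I a := AdicCompletion.liftRingHom (mL I a) fk hfk
  have hE : ∀ k b, evC I a k (E b) = fk k b := fun k b =>
    AdicCompletion.evalₐ_liftRingHom (mL I a) fk hfk k b
  have hEθ : ∀ g, E (θ g) = toComp I a g := by
    intro g
    refine evC_ext I a fun k => ?_
    rw [hE, hfk0 k (θ g) g (by simp), toComp_apply, evC_algebraMap]
  have hEb : Function.Bijective E := by
    constructor
    · rw [injective_iff_map_eq_zero]
      intro b hb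
      refine hsep b fun k => ?_
      obtain ⟨g, hg⟩ := hdense k b
      have h1 := hE k b
      rw [hb, map_zero, hfk0 k b g hg, eq_comm, Ideal.Quotient.eq_zero_iff_mem, toLoc_mem,
        ← hmem] at h1
      have := add_mem hg h1
      simpa using this
    · intro x
      choose g hg using fun k => evC_exists I a k x
      obtain ⟨c, hc⟩ := hcomp (fun k => θ (g k)) (by
        intro k
        rw [← map_sub, hmem, ← toLoc_mem, map_sub, ← Ideal.Quotient.eq, ← hg k,
          ← evC_factor I a (Nat.le_succ k) x, hg (k + 1)]
        rfl)
      refine ⟨c, evC_ext I a fun k => ?_⟩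
      rw [hE, hfk0 k c (g k) (hc k), hg]
  refine ⟨(RingEquiv.ofBijective E hEb).symm, fun g => ?_⟩
  rw [RingEquiv.symm_apply_eq, RingEquiv.ofBijective_apply, hEθ]
end Completion
end ASing

namespace ASing

section Model
variable {K : Type*} [Field K]

/-- The ring of pairs of power series with contact of order `m`. -/
def Rm (K : Type*) [Field K] (m : ℕ) : Subalgebra K (PowerSeries K × PowerSeries K) where
  carrier := {x | (PowerSeries.X : PowerSeries K) ^ m ∣ x.1 - x.2}
  mul_mem' := by
    rintro a b ⟨c, hc⟩ ⟨d, hd⟩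
    refine ⟨c * b.1 + a.2 * d, ?_⟩
    simp only [Prod.fst_mul, Prod.snd_mul]
    linear_combination b.1 * hc + a.2 * hd
  add_mem' := by
    rintro a b ⟨c, hc⟩ ⟨d, hd⟩
    refine ⟨c + d, ?_⟩
    simp only [Prod.fst_add, Prod.snd_add]
    linear_combination hc + hd
  algebraMap_mem' := by
    intro r
    exact ⟨0, by simp⟩

lemma mem_Rm (m : ℕ) (x : PowerSeries K × PowerSeries K) :
    x ∈ Rm K m ↔ (PowerSeries.X : PowerSeries K) ^ m ∣ x.1 - x.2 := Iff.rfl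

/-- division coefficients -/
def gam (M : ℕ) (p : ℕ → ℕ → K) : ℕ → ℕ → K
  | e, j => p e (j + 2) + if _h : 0 < M ∧ M ≤ e then gam M p (e - M) (j + 2) else 0
termination_by e => e

/-- a bivariate power series from its coefficients -/
def mk2 (p : ℕ → ℕ → K) : MvPowerSeries (Fin 2) K := fun e => p (e 0) (e 1)

lemma coeff_mk2 (p : ℕ → ℕ → K) (e : Fin 2 →₀ ℕ) :
    MvPowerSeries.coeff e (mk2 p) = p (e 0) (e 1) := rfl

lemma coeff_X_pow_mul_mk2 (p : ℕ → ℕ → K) (s : Fin 2) (k : ℕ) (e : Fin 2 →₀ ℕ) :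
    MvPowerSeries.coeff e (MvPowerSeries.X s ^ k * mk2 p) =
      if k ≤ e s then p ((e - Finsupp.single s k) 0) ((e - Finsupp.single s k) 1) else 0 := by
  rw [MvPowerSeries.X_pow_eq, MvPowerSeries.coeff_monomial_mul, coeff_mk2]
  simp [Finsupp.single_le_iff]

lemma division2 (M : ℕ) (hM : 0 < M) (p : MvPowerSeries (Fin 2) K) :
    ∃ (γ : MvPowerSeries (Fin 2) K) (A B : PowerSeries K),
      p = (MvPowerSeries.X 1 ^ 2 - MvPowerSeries.X 0 ^ M) * γ +
        (PowerSeries.subst (MvPowerSeries.X 0 : MvPowerSeries (Fin 2) K) A +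
          MvPowerSeries.X 1 * PowerSeries.subst (MvPowerSeries.X 0 : MvPowerSeries (Fin 2) K) B) := by
  let q : ℕ → ℕ → K := fun e j => p.coeff (Finsupp.single 0 e + Finsupp.single 1 j)
  have hq : ∀ e : Fin 2 →₀ ℕ, p.coeff e = q (e 0) (e 1) := by
    intro e
    have he : e = Finsupp.single 0 (e 0) + Finsupp.single 1 (e 1) := by
      ext i
      fin_cases i <;> simp
    simp only [q]
    rw [← he]
  have hsub : ∀ (A : PowerSeries K),
      PowerSeries.subst (MvPowerSeries.X 0 : MvPowerSeries (Fin 2) K) A =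
        mk2 (fun e j => if j = 0 then PowerSeries.coeff e A else 0) := by
    intro A
    ext e
    rw [PowerSeries.coeff_subst_single, coeff_mk2]
    have : e = Finsupp.single 0 (e 0) ↔ e 1 = 0 := by
      constructor
      · intro h; rw [h]; simp
      · intro h; ext i; fin_cases i <;> simp [h]
    simp [this]
  refine ⟨mk2 (gam M q), PowerSeries.mk fun e => q e 0 + if M ≤ e then gam M q (e - M) 0 else 0,
    PowerSeries.mk fun e => q e 1 + if M ≤ e then gam M q (e - M) 1 else 0, ?_⟩
  ext e
  rw [hsub, hsub, sub_mul, hq]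
  have h1 := coeff_X_pow_mul_mk2 (fun e j => if j = 0 then PowerSeries.coeff e
    (PowerSeries.mk fun e => q e 1 + if M ≤ e then gam M q (e - M) 1 else 0) else 0) 1 1 e
  rw [pow_one] at h1
  rw [map_add, map_add, map_sub, h1, coeff_mk2, coeff_X_pow_mul_mk2, coeff_X_pow_mul_mk2]
  simp only [Finsupp.coe_tsub, Pi.sub_apply, PowerSeries.coeff_mk]
  have e01 : (Finsupp.single (0 : Fin 2) M) 1 = 0 := by simp
  have e10 : ∀ k, (Finsupp.single (1 : Fin 2) k) 0 = 0 := by simp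
  simp only [e01, e10, Finsupp.single_eq_same, Nat.sub_zero]
  generalize e 0 = x
  generalize e 1 = j
  rcases j with _ | _ | j
  · simp
  · simp
  · have : gam M q x j = q x (j + 2) + if M ≤ x then gam M q (x - M) (j + 2) else 0 := by
      rw [gam]
      simp [hM]
    have h2 : j + 1 + 1 - 2 = j := by omega
    simp only [show 2 ≤ j + 1 + 1 by omega, if_true, h2, this]
    simp

lemma Q_equiv [CharZero K] (m : ℕ) (hm : 1 ≤ m) :
    Nonempty ((MvPowerSeries (Fin 2) K ⧸ Ideal.span
          {(MvPowerSeries.X 1 : MvPowerSeries (Fin 2) K) ^ 2 - MvPowerSeries.X 0 ^ (2 * m)})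
      ≃ₐ[K] Rm K m) := by
  have hX : ∀ ε : K, MvPowerSeries.HasSubst (S := K) (τ := Unit)
      (![PowerSeries.X, PowerSeries.C ε * PowerSeries.X ^ m] : Fin 2 → PowerSeries K) := by
    intro ε
    refine MvPowerSeries.hasSubst_of_constantCoeff_zero ?_
    intro s
    have : ∀ p : PowerSeries K, MvPowerSeries.constantCoeff p = PowerSeries.constantCoeff p :=
      fun p => rfl
    fin_cases s
    · simp [this]
    · simp [this]; omega
  let Φ : K → (MvPowerSeries (Fin 2) K →ₐ[K] PowerSeries K) := fun ε =>
    MvPowerSeries.substAlgHom (hX ε)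
  have hΦ0 : ∀ ε, Φ ε (MvPowerSeries.X 0) = PowerSeries.X := fun ε => by
    simp only [Φ]
    rw [MvPowerSeries.substAlgHom_X]; rfl
  have hΦ1 : ∀ ε, Φ ε (MvPowerSeries.X 1) = PowerSeries.C ε * PowerSeries.X ^ m := fun ε => by
    simp only [Φ]
    rw [MvPowerSeries.substAlgHom_X]; rfl
  have hΦs : ∀ ε (A : PowerSeries K),
      Φ ε (PowerSeries.subst (MvPowerSeries.X 0 : MvPowerSeries (Fin 2) K) A) = A := by
    intro ε A
    simp only [Φ]
    rw [MvPowerSeries.substAlgHom_apply, PowerSeries.subst_def,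
      MvPowerSeries.subst_comp_subst_apply (PowerSeries.HasSubst.X 0).const (hX ε)]
    rw [MvPowerSeries.subst_X (hX ε)]
    exact PowerSeries.X_subst A
  have key : ∀ p, ∃ (A B : PowerSeries K), (p - (PowerSeries.subst (MvPowerSeries.X 0 : MvPowerSeries (Fin 2) K) A +
          MvPowerSeries.X 1 * PowerSeries.subst (MvPowerSeries.X 0 : MvPowerSeries (Fin 2) K) B)
           ∈ Ideal.span {(MvPowerSeries.X 1 : MvPowerSeries (Fin 2) K) ^ 2 - MvPowerSeries.X 0 ^ (2 * m)})
      ∧ Φ 1 p = A + PowerSeries.X ^ m * B ∧ Φ (-1) p = A - PowerSeries.X ^ m * B := by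
    intro p
    obtain ⟨γ, A, B, h⟩ := division2 (2 * m) (by omega) p
    refine ⟨A, B, ?_, ?_, ?_⟩
    · rw [Ideal.mem_span_singleton]
      exact ⟨γ, by rw [sub_eq_iff_eq_add]; exact h⟩
    · rw [h]
      simp only [map_add, map_mul, map_sub, map_pow, hΦ0, hΦ1, hΦs]
      simp; left; ring
    · rw [h]
      simp only [map_add, map_mul, map_sub, map_pow, hΦ0, hΦ1, hΦs]
      simp; ring
  have hC2 : (2 : PowerSeries K) = PowerSeries.C 2 := (map_ofNat PowerSeries.C 2).symm
  have two : (2 : PowerSeries K) ≠ 0 := by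
    rw [hC2, Ne, map_eq_zero_iff _ PowerSeries.C_injective]
    exact two_ne_zero
  let Θ0 : MvPowerSeries (Fin 2) K →ₐ[K] Rm K m := ((Φ 1).prod (Φ (-1))).codRestrict (Rm K m) (by
    intro p
    obtain ⟨A, B, _, h1, h2⟩ := key p
    rw [mem_Rm]
    exact ⟨2 * B, by simp only [AlgHom.prod_apply, h1, h2]; ring⟩)
  have hΘ1 : ∀ p, (Θ0 p).1.1 = Φ 1 p := fun p => rfl
  have hΘ2 : ∀ p, (Θ0 p).1.2 = Φ (-1) p := fun p => rfl
  have hker : ∀ p ∈ Ideal.span {(MvPowerSeries.X 1 : MvPowerSeries (Fin 2) K) ^ 2 - MvPowerSeries.X 0 ^ (2 * m)},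
      Θ0 p = 0 := by
    intro p hp
    rw [Ideal.mem_span_singleton] at hp
    obtain ⟨c, rfl⟩ := hp
    rw [map_mul]
    suffices Θ0 (MvPowerSeries.X 1 ^ 2 - MvPowerSeries.X 0 ^ (2 * m)) = 0 by rw [this, zero_mul]
    refine Subtype.ext (Prod.ext ?_ ?_)
    · rw [hΘ1]; simp only [map_sub, map_pow, hΦ0, hΦ1]; simp; ring
    · rw [hΘ2]; simp only [map_sub, map_pow, hΦ0, hΦ1]; simp; ring
  refine ⟨AlgEquiv.ofBijective (Ideal.Quotient.liftₐ _ Θ0 hker) ⟨?_, ?_⟩⟩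
  · rw [injective_iff_map_eq_zero]
    intro x
    obtain ⟨p, rfl⟩ := Ideal.Quotient.mk_surjective x
    intro hx
    have hx : Θ0 p = 0 := hx
    have h1 : Φ 1 p = 0 := by rw [← hΘ1, hx]; rfl
    have h2 : Φ (-1) p = 0 := by rw [← hΘ2, hx]; rfl
    obtain ⟨A, B, h, h3, h4⟩ := key p
    rw [h1] at h3; rw [h2] at h4
    have hA : A = 0 := by
      have : 2 * A = 0 := by linear_combination - h3 - h4
      simpa [two] using this
    have hB : B = 0 := by
      have : 2 * PowerSeries.X ^ m * B = 0 := by linear_combination - h3 + h4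
      simpa [two, PowerSeries.X_ne_zero] using this
    rw [Ideal.Quotient.eq_zero_iff_mem]
    have h0 : PowerSeries.subst (MvPowerSeries.X 0 : MvPowerSeries (Fin 2) K) (0 : PowerSeries K) = 0 := by
      rw [← PowerSeries.coe_substAlgHom (PowerSeries.HasSubst.X 0), map_zero]
    rw [hA, hB, h0] at h
    simpa using h
  · rintro ⟨⟨α, β⟩, c, hc⟩
    simp only at hc
    let i2 : PowerSeries K := PowerSeries.C (2⁻¹ : K)
    have hi2 : i2 * 2 = 1 := by
      simp only [i2]
      rw [hC2, ← map_mul, inv_mul_cancel₀ two_ne_zero, map_one]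
    refine ⟨Ideal.Quotient.mk _ (PowerSeries.subst (MvPowerSeries.X 0 : MvPowerSeries (Fin 2) K) (i2 * (α + β)) +
          MvPowerSeries.X 1 * PowerSeries.subst (MvPowerSeries.X 0 : MvPowerSeries (Fin 2) K) (i2 * c)), ?_⟩
    refine Subtype.ext (Prod.ext ?_ ?_)
    · refine (hΘ1 _).trans ?_
      simp only [map_add, map_mul, hΦ1, hΦs]
      simp only [map_one, one_mul]
      linear_combination (-i2) * hc + α * hi2
    · refine (hΘ2 _).trans ?_
      simp only [map_add, map_mul, hΦ1, hΦs]
      simp only [map_neg, map_one]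
      linear_combination (i2) * hc + β * hi2
end Model
end ASing

namespace ASing

section LocalBackward
variable {K : Type*} [Field K]

/-- the parameter -/
abbrev zz (K : Type*) [Field K] : PowerSeries K := PowerSeries.X

/-- a parametrized branch centered at `a` -/
def Cent (a : Fin 2 → K) (ψ : MvPolynomial (Fin 2) K →ₐ[K] PowerSeries K) : Prop :=
  ∀ g, PowerSeries.constantCoeff (ψ g) = eval a g

/-- immersed branch -/
def Imm (a : Fin 2 → K) (ψ : MvPolynomial (Fin 2) K →ₐ[K] PowerSeries K) : Prop :=
  ∃ g ∈ mI a, PowerSeries.coeff 1 (ψ g) ≠ 0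

/-- contact condition -/
def Contact (ψ₁ ψ₂ : MvPolynomial (Fin 2) K →ₐ[K] PowerSeries K) (t : ℕ) : Prop :=
  ∀ g, zz K ^ t ∣ ψ₁ g ↔ zz K ^ t ∣ ψ₂ g

lemma Cent.dvd_iff {a : Fin 2 → K} {ψ : MvPolynomial (Fin 2) K →ₐ[K] PowerSeries K}
    (h : Cent a ψ) (g) : zz K ∣ ψ g ↔ g ∈ mI a := by
  rw [PowerSeries.X_dvd_iff, h, mem_mI]

lemma Cent.isUnit {a : Fin 2 → K} {ψ : MvPolynomial (Fin 2) K →ₐ[K] PowerSeries K}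
    (h : Cent a ψ) (g) (hg : eval a g ≠ 0) : IsUnit (ψ g) := by
  rw [PowerSeries.isUnit_iff_constantCoeff, h]
  exact isUnit_iff_ne_zero.2 hg

lemma Cent.pow_dvd {a : Fin 2 → K} {ψ : MvPolynomial (Fin 2) K →ₐ[K] PowerSeries K}
    (h : Cent a ψ) (k : ℕ) (g) (hg : g ∈ mI a ^ k) : zz K ^ k ∣ ψ g := by
  have : mI a ^ k ≤ (Ideal.span {zz K ^ k}).comap ψ := by
    rw [← Ideal.span_singleton_pow]
    refine le_trans (Ideal.pow_right_mono ?_ k) (Ideal.le_comap_pow _ k)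
    intro g hg
    rw [Ideal.mem_comap, Ideal.mem_span_singleton, h.dvd_iff]
    exact hg
  have := this hg
  rwa [Ideal.mem_comap, Ideal.mem_span_singleton] at this

lemma aeval_zz (P : Polynomial K) : Polynomial.aeval (zz K) P = (P : PowerSeries K) := by
  induction P using Polynomial.induction_on' with
  | add p q hp hq => simp [hp, hq]
  | monomial n c => simp [← Polynomial.C_mul_X_pow_eq_monomial]

lemma exists_trunc (A : PowerSeries K) (k : ℕ) : ∃ (P : Polynomial K) (A' : PowerSeries K),
    A = (P : PowerSeries K) + zz K ^ k * A' :=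
  ⟨_, _, (PowerSeries.eq_X_pow_mul_shift_add_trunc k A).trans (add_comm _ _)⟩

lemma contact_diff {ψ₁ ψ₂ : MvPolynomial (Fin 2) K →ₐ[K] PowerSeries K} {x}
    (h₁ : ψ₁ x = zz K) (h₂ : ψ₂ x = zz K) (t : ℕ) :
    Contact ψ₁ ψ₂ t ↔ ∀ g, zz K ^ t ∣ ψ₁ g - ψ₂ g := by
  constructor
  · intro h g
    obtain ⟨P, A', hP⟩ := exists_trunc (ψ₁ g) t
    have e1 : ψ₁ (Polynomial.aeval x P) = P := by
      rw [← Polynomial.aeval_algHom_apply, h₁, aeval_zz]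
    have e2 : ψ₂ (Polynomial.aeval x P) = P := by
      rw [← Polynomial.aeval_algHom_apply, h₂, aeval_zz]
    obtain ⟨B, hB⟩ := (h (g - Polynomial.aeval x P)).1 ⟨A', by rw [map_sub, e1, hP]; ring⟩
    rw [map_sub, e2] at hB
    exact ⟨A' - B, by linear_combination hP - hB⟩
  · intro h g
    rw [← dvd_iff_dvd_of_dvd_sub (h g)]

/-- filtration on the model ring -/
def Jk (K : Type*) [Field K] (m : ℕ) (k : ℕ) : Ideal (Rm K m) where
  carrier := {r | zz K ^ k ∣ r.1.1 ∧ zz K ^ k ∣ r.1.2 ∧ zz K ^ (m + k - 1) ∣ r.1.1 - r.1.2}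
  zero_mem' := by simp
  add_mem' := by
    rintro a b ⟨h1, h2, h3⟩ ⟨g1, g2, g3⟩
    refine ⟨dvd_add h1 g1, dvd_add h2 g2, ?_⟩
    convert dvd_add h3 g3 using 1
    simp only [Subalgebra.coe_add, Prod.fst_add, Prod.snd_add]
    ring
  smul_mem' := by
    rintro c a ⟨h1, h2, h3⟩
    refine ⟨Dvd.dvd.mul_left h1 _, Dvd.dvd.mul_left h2 _, ?_⟩
    have e : (c • a).1.1 - (c • a).1.2 = c.1.1 * (a.1.1 - a.1.2) + (c.1.1 - c.1.2) * a.1.2 := by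
      simp only [smul_eq_mul, Subalgebra.coe_mul, Prod.fst_mul, Prod.snd_mul]
      ring
    rw [e]
    refine dvd_add (Dvd.dvd.mul_left h3 _) ?_
    refine dvd_trans (pow_dvd_pow _ (by omega : m + k - 1 ≤ m + k)) ?_
    rw [pow_add]
    exact mul_dvd_mul c.2 h2

lemma mem_Jk (m k : ℕ) (r : Rm K m) : r ∈ Jk K m k ↔
    zz K ^ k ∣ r.1.1 ∧ zz K ^ k ∣ r.1.2 ∧ zz K ^ (m + k - 1) ∣ r.1.1 - r.1.2 := Iff.rfl

lemma Jk_anti (m : ℕ) : Antitone (Jk K m) := by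
  intro k l h r hr
  rw [mem_Jk] at *
  exact ⟨dvd_trans (pow_dvd_pow _ h) hr.1, dvd_trans (pow_dvd_pow _ h) hr.2.1,
    dvd_trans (pow_dvd_pow _ (by omega)) hr.2.2⟩

lemma Jk_one_pow (m : ℕ) (hm : 1 ≤ m) (k : ℕ) : (Jk K m 1) ^ k ≤ Jk K m k := by
  induction k with
  | zero =>
    intro r _
    rw [mem_Jk]
    exact ⟨by simp, by simp, dvd_trans (pow_dvd_pow _ (by omega)) r.2⟩
  | succ k ih =>
    rw [pow_succ]
    refine le_trans (Ideal.mul_mono_left ih) ?_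
    rw [Ideal.mul_le]
    rintro r ⟨h1, h2, h3⟩ s ⟨g1, g2, g3⟩
    refine ⟨?_, ?_, ?_⟩
    · rw [pow_succ]; exact mul_dvd_mul h1 (by simpa using g1)
    · rw [pow_succ]; exact mul_dvd_mul h2 (by simpa using g2)
    · have e : (r * s).1.1 - (r * s).1.2 = (r.1.1 - r.1.2) * s.1.1 + r.1.2 * (s.1.1 - s.1.2) := by
        simp only [Subalgebra.coe_mul, Prod.fst_mul, Prod.snd_mul]
        ring
      rw [e]
      refine dvd_add ?_ ?_
      · rw [show m + (k + 1) - 1 = (m + k - 1) + 1 by omega, pow_add]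
        exact mul_dvd_mul h3 g1
      · rw [show m + (k + 1) - 1 = k + (m + 1 - 1) by omega, pow_add]
        exact mul_dvd_mul h2 g3

lemma eq_zero_of_dvd (c : PowerSeries K) (h : ∀ k, zz K ^ k ∣ c) : c = 0 := by
  ext n
  exact (PowerSeries.X_pow_dvd_iff.1 (h (n + 1))) n (by omega)

lemma ps_limit (b : ℕ → PowerSeries K) (h : ∀ k, zz K ^ k ∣ b (k + 1) - b k) :
    ∃ c, ∀ k, zz K ^ k ∣ c - b k := by
  have h2 : ∀ k l, k ≤ l → zz K ^ k ∣ b l - b k := by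
    intro k l hkl
    induction l, hkl using Nat.le_induction with
    | base => simp
    | succ l hl ih =>
      have := dvd_add (dvd_trans (pow_dvd_pow _ hl) (h l)) ih
      convert this using 1
      ring
  refine ⟨PowerSeries.mk fun n => PowerSeries.coeff n (b (n + 1)), fun k => ?_⟩
  rw [PowerSeries.X_pow_dvd_iff]
  intro n hn
  rw [map_sub, PowerSeries.coeff_mk, ← map_sub, ← neg_sub, map_neg, neg_eq_zero]
  exact PowerSeries.X_pow_dvd_iff.1 (h2 (n + 1) k hn) n (by omega)

lemma Jk_sep (m : ℕ) (b : Rm K m) (h : ∀ k, b ∈ Jk K m k) : b = 0 :=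
  Subtype.ext (Prod.ext (eq_zero_of_dvd _ fun k => (h k).1) (eq_zero_of_dvd _ fun k => (h k).2.1))

lemma Jk_complete (m : ℕ) (b : ℕ → Rm K m) (h : ∀ k, b (k + 1) - b k ∈ Jk K m k) :
    ∃ c, ∀ k, c - b k ∈ Jk K m k := by
  obtain ⟨c1, h1⟩ := ps_limit (fun k => (b k).1.1) fun k => (h k).1
  obtain ⟨c2, h2⟩ := ps_limit (fun k => (b k).1.2) fun k => (h k).2.1
  have hN : ∀ N, zz K ^ N ∣ (c1 - c2) - ((b N).1.1 - (b N).1.2) := by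
    intro N
    have := dvd_sub (h1 N) (h2 N)
    convert this using 1
    ring
  have hc : (c1, c2) ∈ Rm K m := by
    rw [mem_Rm]
    have := dvd_add (hN m) (b m).2
    simpa using this
  refine ⟨⟨(c1, c2), hc⟩, fun k => ?_⟩
  have hkl : ∀ l, k ≤ l → b l - b k ∈ Jk K m k := by
    intro l hkl
    induction l, hkl using Nat.le_induction with
    | base => simp
    | succ l hl ih =>
      have := add_mem (Jk_anti m hl (h l)) ih
      simpa using this
  have hd : (⟨(c1, c2), hc⟩ : Rm K m) - b (m + k) ∈ Jk K m k := by
    rw [mem_Jk]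
    refine ⟨dvd_trans (pow_dvd_pow _ (by omega)) (h1 (m + k)),
      dvd_trans (pow_dvd_pow _ (by omega)) (h2 (m + k)), ?_⟩
    have := dvd_trans (pow_dvd_pow (zz K) (by omega : m + k - 1 ≤ m + k)) (hN (m + k))
    convert this using 1
    simp only [Subalgebra.coe_sub, Prod.fst_sub, Prod.snd_sub]
    ring
  have := add_mem hd (hkl (m + k) (by omega))
  simpa using this

end LocalBackward
end ASing

namespace ASing

section LocalBackward2
variable {K : Type*} [Field K]

lemma contact_not_y {ψ₁ ψ₂ : MvPolynomial (Fin 2) K →ₐ[K] PowerSeries K} {x y}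
    (h₁ : ψ₁ x = zz K) (h₂ : ψ₂ x = zz K) (hadj : Algebra.adjoin K {x, y} = ⊤) (t : ℕ)
    (hc : ¬ Contact ψ₁ ψ₂ t) : ¬ zz K ^ t ∣ ψ₁ y - ψ₂ y := by
  intro hy
  apply hc
  rw [contact_diff h₁ h₂]
  have : (⊤ : Subalgebra K (MvPolynomial (Fin 2) K)) ≤ (Rm K t).comap (ψ₁.prod ψ₂) := by
    rw [← hadj, Algebra.adjoin_le_iff]
    rintro g (rfl | rfl)
    · simp [mem_Rm, h₁, h₂]
    · simpa [mem_Rm] using hy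
  intro g
  exact this (Algebra.mem_top (x := g))

lemma mem_span_pair_sq {R : Type*} [CommRing R] {x y F : R} (h : F ∈ Ideal.span {x, y} ^ 2) :
    ∃ s₁ s₂ u, F = x ^ 2 * s₁ + x * y * s₂ + y ^ 2 * u := by
  rw [pow_two] at h
  refine Submodule.mul_induction_on h ?_ ?_
  · intro a ha b hb
    obtain ⟨a1, a2, rfl⟩ := Ideal.mem_span_pair.1 ha
    obtain ⟨b1, b2, rfl⟩ := Ideal.mem_span_pair.1 hb
    exact ⟨a1 * b1, a1 * b2 + a2 * b1, a2 * b2, by ring⟩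
  · rintro a b ⟨s, t, u, rfl⟩ ⟨s', t', u', rfl⟩
    exact ⟨s + s', t + t', u + u', by ring⟩

lemma F_shape {a : Fin 2 → K} {ψ₁ ψ₂ : MvPolynomial (Fin 2) K →ₐ[K] PowerSeries K} {x y F}
    (c₁ : Cent a ψ₁) (c₂ : Cent a ψ₂)
    (h₁ : ψ₁ x = zz K) (h₂ : ψ₂ x = zz K) (hspan : mI a = Ideal.span {x, y}) (m : ℕ)
    (hd : ∀ g, zz K ^ m ∣ ψ₁ g - ψ₂ g) (hy : ¬ zz K ^ (m + 1) ∣ ψ₁ y - ψ₂ y)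
    (hF₁ : ψ₁ F = 0) (hF₂ : ψ₂ F = 0) (hF2 : F ∈ mI a ^ 2) (hF3 : F ∉ mI a ^ 3) :
    ∃ s u, F = x * s + y ^ 2 * u ∧ eval a u ≠ 0 := by
  have hF2' := hF2
  rw [hspan] at hF2'
  obtain ⟨s₁, s₂, u, rfl⟩ := mem_span_pair_sq hF2'
  refine ⟨x * s₁ + y * s₂, u, by ring, fun hu => hF3 ?_⟩
  have hym : y ∈ mI a := by rw [hspan]; exact Ideal.subset_span (by simp)
  have hxm : x ∈ mI a := by rw [hspan]; exact Ideal.subset_span (by simp)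
  obtain ⟨α, hα⟩ := (c₁.dvd_iff y).2 hym
  obtain ⟨β, hβ⟩ := (c₂.dvd_iff y).2 hym
  obtain ⟨μ, hμ⟩ := (c₁.dvd_iff u).2 hu
  obtain ⟨ν, hν⟩ := (c₂.dvd_iff u).2 hu
  obtain ⟨w, hw⟩ := hd y
  obtain ⟨w1, hw1⟩ := hd s₁
  obtain ⟨w2, hw2⟩ := hd s₂
  obtain ⟨w3, hw3⟩ := hd u
  simp only [map_add, map_mul, map_pow, h₁, h₂] at hF₁ hF₂
  have hz : zz K ≠ 0 := PowerSeries.X_ne_zero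
  have e1 : zz K ^ (m + 1) * (w * ψ₁ s₂ + zz K * (w1 + β * w2 + w * (α + β) * μ
     + β ^ 2 * w3)) = 0 := by
    rw [hβ, hν] at hF₂
    rw [hα, hμ] at hF₁
    rw [hα, hβ] at hw
    rw [hμ, hν] at hw3
    rw [pow_succ]
    linear_combination hF₁ - hF₂ - zz K ^ 2 * hw1 - zz K ^ 2 * β * hw2
      - zz K ^ 2 * (α + β) * μ * hw - zz K * (ψ₁ s₂) * hw - zz K ^ 2 * β ^ 2 * hw3
  have e2 := (mul_eq_zero.1 e1).resolve_left (pow_ne_zero _ hz)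
  have hs2 : s₂ ∈ mI a := by
    rw [← c₁.dvd_iff]
    have h3 : zz K ∣ w * ψ₁ s₂ := ⟨-(w1 + β * w2 + w * (α + β) * μ
     + β ^ 2 * w3), by linear_combination e2⟩
    refine (PowerSeries.X_prime.dvd_or_dvd h3).resolve_left ?_
    rintro ⟨w', rfl⟩
    exact hy ⟨w', by rw [hw]; ring⟩
  obtain ⟨σ, hσ⟩ := (c₁.dvd_iff s₂).2 hs2
  have hs1 : s₁ ∈ mI a := by
    rw [← c₁.dvd_iff]
    rw [hα, hμ, hσ] at hF₁
    have : zz K ^ 2 * (ψ₁ s₁ + zz K * (α * σ + α ^ 2 * μ)) = 0 := by linear_combination hF₁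
    have := (mul_eq_zero.1 this).resolve_left (pow_ne_zero _ hz)
    exact ⟨-(α * σ + α ^ 2 * μ), by linear_combination this⟩
  have hu : u ∈ mI a := hu
  have p3 : ∀ a' b' c', a' ∈ mI a → b' ∈ mI a → c' ∈ mI a → a' * b' * c' ∈ mI a ^ 3 := by
    intro a' b' c' ha hb hc
    rw [pow_succ, pow_two]
    exact Ideal.mul_mem_mul (Ideal.mul_mem_mul ha hb) hc
  refine add_mem (add_mem ?_ ?_) ?_
  · rw [pow_two]; exact p3 _ _ _ hxm hxm hs1
  · exact p3 _ _ _ hxm hym hs2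
  · rw [pow_two]; exact p3 _ _ _ hym hym hu

lemma normal_form {a : Fin 2 → K} {x y F s u : MvPolynomial (Fin 2) K}
    (hspan : mI a = Ideal.span {x, y}) (hF : F = x * s + y ^ 2 * u) (hu : eval a u ≠ 0)
    (k : ℕ) (g : MvPolynomial (Fin 2) K) :
    ∃ A B : Polynomial K, g - (Polynomial.aeval x A + Polynomial.aeval x B * y) ∈
      Ideal.span {F} ⊔ mI a ^ k := by
  have hym : y ∈ mI a := by rw [hspan]; exact Ideal.subset_span (by simp)
  have hxm : x ∈ mI a := by rw [hspan]; exact Ideal.subset_span (by simp)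
  obtain ⟨v, hv⟩ := unit_mod a (mI a ^ k) k le_rfl u hu
  have hy2 : y ^ 2 + x * s * v ∈ Ideal.span {F} ⊔ mI a ^ k := by
    have h1 : F * v ∈ Ideal.span {F} ⊔ mI a ^ k :=
      Ideal.mem_sup_left (Ideal.mem_span_singleton.2 ⟨v, rfl⟩)
    have h2 : -y ^ 2 * (u * v - 1) ∈ Ideal.span {F} ⊔ mI a ^ k :=
      Ideal.mem_sup_right (Ideal.mul_mem_left _ _ hv)
    have := add_mem h1 h2
    convert this using 1
    rw [hF]; ring
  have step : ∀ g, ∃ (α β : K) (g' : MvPolynomial (Fin 2) K),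
      g - (C α + C β * y + x * g') ∈ Ideal.span {F} ⊔ mI a ^ k := by
    intro g
    have h1 : g - C (eval a g) ∈ mI a := by simp
    rw [hspan] at h1
    obtain ⟨p, q, hpq⟩ := Ideal.mem_span_pair.1 h1
    have h2 : q - C (eval a q) ∈ mI a := by simp
    rw [hspan] at h2
    obtain ⟨p', q', hpq'⟩ := Ideal.mem_span_pair.1 h2
    refine ⟨eval a g, eval a q, p + p' * y - q' * s * v, ?_⟩
    have := Ideal.mul_mem_left _ q' hy2
    convert this using 1
    linear_combination -hpq - y * hpq'
  have iter : ∀ j, ∃ (A B : Polynomial K) (g' : MvPolynomial (Fin 2) K),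
      g - (Polynomial.aeval x A + Polynomial.aeval x B * y + x ^ j * g') ∈
        Ideal.span {F} ⊔ mI a ^ k := by
    intro j
    induction j with
    | zero => exact ⟨0, 0, g, by simp⟩
    | succ j ih =>
      obtain ⟨A, B, g', h⟩ := ih
      obtain ⟨α, β, g'', h'⟩ := step g'
      refine ⟨A + Polynomial.C α * Polynomial.X ^ j, B + Polynomial.C β * Polynomial.X ^ j, g'', ?_⟩
      have := add_mem h (Ideal.mul_mem_left _ (x ^ j) h')
      convert this using 1
      simp only [map_add, map_mul, map_pow, Polynomial.aeval_C, Polynomial.aeval_X,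
        MvPolynomial.algebraMap_eq]
      ring
  obtain ⟨A, B, g', h⟩ := iter k
  refine ⟨A, B, ?_⟩
  have := add_mem h (Ideal.mem_sup_right (Ideal.mul_mem_right g' _ (Ideal.pow_mem_pow hxm k)))
  convert this using 1
  ring

theorem local_backward_norm {a : Fin 2 → K} {ψ₁ ψ₂ : MvPolynomial (Fin 2) K →ₐ[K] PowerSeries K}
    {x y F} (c₁ : Cent a ψ₁) (c₂ : Cent a ψ₂)
    (h₁ : ψ₁ x = zz K) (h₂ : ψ₂ x = zz K) (hspan : mI a = Ideal.span {x, y})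
    (hadj : Algebra.adjoin K {x, y} = ⊤) (m : ℕ) (hm : 1 ≤ m)
    (hcm : Contact ψ₁ ψ₂ m) (hcm1 : ¬ Contact ψ₁ ψ₂ (m + 1))
    (hF₁ : ψ₁ F = 0) (hF₂ : ψ₂ F = 0) (hF2 : F ∈ mI a ^ 2) (hF3 : F ∉ mI a ^ 3) :
    ∃ e : LocalCompletion (Ideal.span {F}) a ≃+* Rm K m,
      ∀ r : K, e (toComp (Ideal.span {F}) a (C r)) = algebraMap K _ r := by
  have hd := (contact_diff h₁ h₂ m).1 hcm
  have hy := contact_not_y h₁ h₂ hadj (m + 1) hcm1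
  obtain ⟨s, u, hFs, hu⟩ := F_shape c₁ c₂ h₁ h₂ hspan m hd hy hF₁ hF₂ hF2 hF3
  have hym : y ∈ mI a := by rw [hspan]; exact Ideal.subset_span (by simp)
  have hxm : x ∈ mI a := by rw [hspan]; exact Ideal.subset_span (by simp)
  have hz : zz K ≠ 0 := PowerSeries.X_ne_zero
  obtain ⟨w, hw⟩ := hd y
  have hwu : IsUnit w := by
    rw [PowerSeries.isUnit_iff_constantCoeff, isUnit_iff_ne_zero]
    intro h0
    rw [← PowerSeries.X_dvd_iff] at h0
    obtain ⟨w', rfl⟩ := h0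
    exact hy ⟨w', by rw [hw]; ring⟩
  have haev1 : ∀ P : Polynomial K, ψ₁ (Polynomial.aeval x P) = (P : PowerSeries K) := fun P => by
    rw [← Polynomial.aeval_algHom_apply, h₁, aeval_zz]
  have haev2 : ∀ P : Polynomial K, ψ₂ (Polynomial.aeval x P) = (P : PowerSeries K) := fun P => by
    rw [← Polynomial.aeval_algHom_apply, h₂, aeval_zz]
  let θ : MvPolynomial (Fin 2) K →ₐ[K] Rm K m := (ψ₁.prod ψ₂).codRestrict (Rm K m) hd
  have hθ1 : ∀ g, (θ g).1.1 = ψ₁ g := fun g => rfl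
  have hθ2 : ∀ g, (θ g).1.2 = ψ₂ g := fun g => rfl
  have hsub : ∀ k, Ideal.span {F} ⊔ mI a ^ k ≤ (Jk K m k).comap (θ : _ →+* Rm K m) := by
    intro k
    refine sup_le ?_ ?_
    · rw [Ideal.span_singleton_le_iff_mem, Ideal.mem_comap]
      have : θ F = 0 := Subtype.ext (Prod.ext hF₁ hF₂)
      change θ F ∈ _
      rw [this]
      exact zero_mem _
    · refine le_trans (le_trans (Ideal.pow_right_mono ?_ k) (Ideal.le_comap_pow _ k))
        (Ideal.comap_mono (Jk_one_pow m hm k))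
      intro g hg
      rw [Ideal.mem_comap, mem_Jk]
      refine ⟨?_, ?_, ?_⟩
      · rw [pow_one]; exact (c₁.dvd_iff g).2 hg
      · rw [pow_one]; exact (c₂.dvd_iff g).2 hg
      · exact hd g
  have hA1 : ∀ k g, θ g ∈ Jk K m k ↔ g ∈ Ideal.span {F} ⊔ mI a ^ k := by
    intro k g
    refine ⟨fun hg => ?_, fun hg => hsub k hg⟩
    rcases k with _ | k
    · simp
    obtain ⟨A, B, hAB⟩ := normal_form hspan hFs hu (k + 1) g
    have h0 : θ (Polynomial.aeval x A + Polynomial.aeval x B * y) ∈ Jk K m (k + 1) := by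
      have := sub_mem hg (hsub _ hAB)
      simpa using this
    rw [mem_Jk, hθ1, hθ2] at h0
    simp only [map_add, map_mul, haev1, haev2] at h0
    obtain ⟨q1, q2, q3⟩ := h0
    have hB : zz K ^ k ∣ (B : PowerSeries K) := by
      obtain ⟨c, hc⟩ := q3
      obtain ⟨w', hw'⟩ := hwu.exists_right_inv
      have : zz K ^ m * (B * w - zz K ^ k * c) = 0 := by
        rw [show m + (k + 1) - 1 = m + k by omega, pow_add] at hc
        linear_combination hc - (B : PowerSeries K) * hw
      have := (mul_eq_zero.1 this).resolve_left (pow_ne_zero _ hz)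
      exact ⟨c * w', by linear_combination w' * this - B * hw'⟩
    have hA : zz K ^ (k + 1) ∣ (A : PowerSeries K) := by
      have : zz K ^ (k + 1) ∣ (B : PowerSeries K) * ψ₁ y := by
        rw [pow_succ]; exact mul_dvd_mul hB ((c₁.dvd_iff y).2 hym)
      exact (dvd_add_left this).1 q1
    have pol : ∀ (k : ℕ) (P : Polynomial K), zz K ^ k ∣ (P : PowerSeries K) →
        Polynomial.aeval x P ∈ mI a ^ k := by
      intro k P hP
      have : Polynomial.X ^ k ∣ P := by
        rw [Polynomial.X_pow_dvd_iff]
        intro d hd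
        have := PowerSeries.X_pow_dvd_iff.1 hP d hd
        rwa [Polynomial.coeff_coe] at this
      obtain ⟨P', rfl⟩ := this
      rw [map_mul, map_pow, Polynomial.aeval_X]
      exact Ideal.mul_mem_right _ _ (Ideal.pow_mem_pow hxm k)
    have h1 : Polynomial.aeval x A + Polynomial.aeval x B * y ∈ mI a ^ (k + 1) := by
      refine add_mem (pol _ _ hA) ?_
      rw [pow_succ]
      exact Ideal.mul_mem_mul (pol _ _ hB) hym
    have := add_mem hAB (Ideal.mem_sup_right h1)
    simpa using this
  have hB1 : ∀ k b, ∃ g, b - θ g ∈ Jk K m k := by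
    rintro k ⟨⟨r1, r2⟩, c, hc⟩
    simp only at hc
    obtain ⟨w', hw'⟩ := hwu.exists_right_inv
    obtain ⟨B, B', hB⟩ := exists_trunc (c * w') k
    obtain ⟨A, A', hA⟩ := exists_trunc (r1 - c * w' * ψ₁ y) k
    refine ⟨Polynomial.aeval x A + Polynomial.aeval x B * y, ?_⟩
    have g1 : ψ₁ (Polynomial.aeval x A + Polynomial.aeval x B * y) = A + B * ψ₁ y := by
      simp only [map_add, map_mul, haev1]
    have g2 : ψ₂ (Polynomial.aeval x A + Polynomial.aeval x B * y) = A + B * ψ₂ y := by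
      simp only [map_add, map_mul, haev2]
    have f1 : r1 - (A + B * ψ₁ y) = zz K ^ k * (A' + B' * ψ₁ y) := by
      linear_combination hA + ψ₁ y * hB
    have f2 : r2 - (A + B * ψ₂ y) = zz K ^ k * (A' + B' * ψ₂ y) := by
      linear_combination hA + ψ₂ y * hB - hc + c * w' * hw + c * zz K ^ m * hw'
    rw [mem_Jk]
    change zz K ^ k ∣ r1 - ψ₁ _ ∧ zz K ^ k ∣ r2 - ψ₂ _ ∧ _ ∣ (r1 - ψ₁ _) - (r2 - ψ₂ _)
    rw [g1, g2, f1, f2]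
    refine ⟨⟨_, rfl⟩, ⟨_, rfl⟩, ?_⟩
    refine dvd_trans (pow_dvd_pow _ (by omega : m + k - 1 ≤ m + k)) ⟨B' * w, ?_⟩
    rw [pow_add]
    linear_combination zz K ^ k * B' * hw
  obtain ⟨e, he⟩ := toComp_equiv (Ideal.span {F}) a (Jk K m) (θ : _ →+* Rm K m)
    (fun k => Jk_anti m (Nat.le_succ k)) hA1 hB1 (Jk_sep m) (Jk_complete m)
  refine ⟨e, fun r => ?_⟩
  rw [he]
  exact θ.commutes r

end LocalBackward2
end ASing

namespace ASing

section Reparam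
variable {K : Type*} [Field K]

/-- substitution of a power series without constant term -/
def subT (τ : PowerSeries K) (h : PowerSeries.constantCoeff τ = 0) :
    PowerSeries K →ₐ[K] PowerSeries K :=
  PowerSeries.substAlgHom (PowerSeries.HasSubst.of_constantCoeff_zero' h)

lemma subT_X (τ : PowerSeries K) (h : PowerSeries.constantCoeff τ = 0) :
    subT τ h (zz K) = τ := PowerSeries.substAlgHom_X _

lemma algHom_local (χ : PowerSeries K →ₐ[K] PowerSeries K) (c : PowerSeries K) :
    PowerSeries.constantCoeff (χ c) = PowerSeries.constantCoeff c := by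
  by_contra hne
  have hC : ∀ r : K, χ (PowerSeries.C r) = PowerSeries.C r := fun r => χ.commutes r
  have hu : IsUnit (c - PowerSeries.C (PowerSeries.constantCoeff (χ c))) := by
    rw [PowerSeries.isUnit_iff_constantCoeff, isUnit_iff_ne_zero]
    simp only [map_sub, PowerSeries.constantCoeff_C]
    exact fun h => hne (sub_eq_zero.1 h).symm
  have := hu.map χ
  rw [PowerSeries.isUnit_iff_constantCoeff, isUnit_iff_ne_zero, map_sub, hC] at this
  simp at this

lemma algHom_dvd (χ : PowerSeries K →ₐ[K] PowerSeries K) (c : PowerSeries K) (t : ℕ)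
    (h : zz K ^ t ∣ c) : zz K ^ t ∣ χ c := by
  obtain ⟨d, rfl⟩ := h
  rw [map_mul, map_pow]
  refine Dvd.dvd.mul_right (pow_dvd_pow_of_dvd ?_ t) _
  rw [PowerSeries.X_dvd_iff, algHom_local]
  simp

lemma coeff_one_ne_zero_iff {c : PowerSeries K} (h : zz K ∣ c) :
    PowerSeries.coeff 1 c ≠ 0 ↔ ¬ zz K ^ 2 ∣ c := by
  rw [not_iff_not, PowerSeries.X_pow_dvd_iff]
  rw [PowerSeries.X_dvd_iff] at h
  constructor
  · intro h1 j hj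
    interval_cases j
    · simpa using h
    · exact h1
  · intro h1
    exact h1 1 (by norm_num)

lemma order_one {c : PowerSeries K} (h : zz K ∣ c) (h2 : ¬ zz K ^ 2 ∣ c) :
    ∃ u, IsUnit u ∧ c = zz K * u := by
  obtain ⟨u, rfl⟩ := h
  refine ⟨u, ?_, rfl⟩
  rw [PowerSeries.isUnit_iff_constantCoeff, isUnit_iff_ne_zero]
  intro h0
  rw [← PowerSeries.X_dvd_iff] at h0
  obtain ⟨v, rfl⟩ := h0
  exact h2 ⟨v, by ring⟩

lemma subT_dvd_iff (τ : PowerSeries K) (h : PowerSeries.constantCoeff τ = 0)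
    (h1 : ¬ zz K ^ 2 ∣ τ) (c : PowerSeries K) (t : ℕ) :
    zz K ^ t ∣ subT τ h c ↔ zz K ^ t ∣ c := by
  refine ⟨fun hd => ?_, algHom_dvd _ _ _⟩
  have hu : IsUnit (PowerSeries.coeff 1 τ) :=
    isUnit_iff_ne_zero.2 ((coeff_one_ne_zero_iff (PowerSeries.X_dvd_iff.2 h)).2 h1)
  have h2 := algHom_dvd (subT _ (PowerSeries.constantCoeff_substInvOfIsUnit τ hu)) _ _ hd
  convert h2 using 1
  simp only [subT, PowerSeries.coe_substAlgHom]
  rw [PowerSeries.subst_comp_subst_apply (PowerSeries.HasSubst.of_constantCoeff_zero' h)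
    (PowerSeries.HasSubst.substInvOfIsUnit τ hu), PowerSeries.subst_substInvOfIsUnit_right τ h]
  exact (PowerSeries.X_subst c).symm

lemma reparam {a : Fin 2 → K} {ψ : MvPolynomial (Fin 2) K →ₐ[K] PowerSeries K} (hc : Cent a ψ)
    {x : MvPolynomial (Fin 2) K} (hx : x ∈ mI a) (h2 : ¬ zz K ^ 2 ∣ ψ x) :
    ∃ ψ' : MvPolynomial (Fin 2) K →ₐ[K] PowerSeries K, Cent a ψ' ∧ ψ' x = zz K ∧
      (∀ t g, zz K ^ t ∣ ψ' g ↔ zz K ^ t ∣ ψ g) ∧ ∀ g, ψ g = 0 → ψ' g = 0 := by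
  have h0 : zz K ∣ ψ x := (hc.dvd_iff x).2 hx
  have hu : IsUnit (PowerSeries.coeff 1 (ψ x)) :=
    isUnit_iff_ne_zero.2 ((coeff_one_ne_zero_iff h0).2 h2)
  have hs := PowerSeries.constantCoeff_substInvOfIsUnit (ψ x) hu
  refine ⟨(subT _ hs).comp ψ, ?_, ?_, ?_, ?_⟩
  · intro g
    rw [AlgHom.comp_apply, algHom_local, hc]
  · rw [AlgHom.comp_apply, subT, PowerSeries.coe_substAlgHom]
    exact PowerSeries.subst_substInvOfIsUnit_right (ψ x) (PowerSeries.X_dvd_iff.1 h0) hu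
  · intro t g
    rw [AlgHom.comp_apply, subT_dvd_iff]
    rw [← coeff_one_ne_zero_iff (PowerSeries.X_dvd_iff.2 hs),
      PowerSeries.coeff_one_substInvOfIsUnit]
    exact Units.ne_zero _
  · intro g hg
    rw [AlgHom.comp_apply, hg, map_zero]

lemma mI_eq_span {a : Fin 2 → K} {x y : MvPolynomial (Fin 2) K} (hx : x ∈ mI a) (hy : y ∈ mI a)
    (h : ∀ i, (X i - C (a i) : MvPolynomial (Fin 2) K) ∈ Ideal.span {x, y}) :
    mI a = Ideal.span {x, y} := by
  refine le_antisymm ?_ ?_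
  · have key : ∀ g : MvPolynomial (Fin 2) K, g - C (eval a g) ∈ Ideal.span {x, y} := by
      intro g
      induction g using MvPolynomial.induction_on with
      | C c => simp
      | add p q hp hq =>
        have := add_mem hp hq
        convert this using 1
        simp; ring
      | mul_X p i hp =>
        have := add_mem (Ideal.mul_mem_right (X i) _ hp) (Ideal.mul_mem_left _ (C (eval a p)) (h i))
        convert this using 1
        simp; ring
    intro g hg
    have := key g
    rwa [(mem_mI a g).1 hg, map_zero, sub_zero] at this
  · rw [Ideal.span_le]
    rintro g (rfl | rfl)
    · exact hx
    · exact hy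

lemma adjoin_eq_top {a : Fin 2 → K} {x y : MvPolynomial (Fin 2) K}
    (h : ∀ i, (X i - C (a i) : MvPolynomial (Fin 2) K) ∈ Algebra.adjoin K {x, y}) :
    Algebra.adjoin K {x, y} = ⊤ := by
  rw [eq_top_iff, ← MvPolynomial.adjoin_range_X, Algebra.adjoin_le_iff]
  rintro _ ⟨i, rfl⟩
  have := add_mem (h i) (Subalgebra.algebraMap_mem (Algebra.adjoin K {x, y}) (a i))
  simpa [MvPolynomial.algebraMap_eq] using this

lemma exists_coord {a : Fin 2 → K} {ψ₁ ψ₂ : MvPolynomial (Fin 2) K →ₐ[K] PowerSeries K}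
    (c₁ : Cent a ψ₁) (c₂ : Cent a ψ₂) (i₁ : Imm a ψ₁) (i₂ : Imm a ψ₂) :
    ∃ x y, mI a = Ideal.span {x, y} ∧ Algebra.adjoin K {x, y} = ⊤ ∧ x ∈ mI a ∧
      ¬ zz K ^ 2 ∣ ψ₁ x ∧ ¬ zz K ^ 2 ∣ ψ₂ x := by
  let x : Fin 2 → MvPolynomial (Fin 2) K := fun i => X i - C (a i)
  have hx : ∀ i, x i ∈ mI a := fun i => by simp [x, RingHom.mem_ker]
  have h01 : mI a = Ideal.span {x 0, x 1} := mI_eq_span (hx 0) (hx 1) (by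
    intro i
    fin_cases i
    · exact Ideal.subset_span (by simp [x])
    · exact Ideal.subset_span (by simp [x]))
  have h10 : mI a = Ideal.span {x 1, x 0} := by rw [h01, Set.pair_comm]
  have a01 : Algebra.adjoin K {x 0, x 1} = ⊤ := adjoin_eq_top (a := a) (by
    intro i
    fin_cases i
    · exact Algebra.subset_adjoin (by simp [x])
    · exact Algebra.subset_adjoin (by simp [x]))
  have a10 : Algebra.adjoin K {x 1, x 0} = ⊤ := by rw [← a01, Set.pair_comm]
  have hs : mI a = Ideal.span {x 0 + x 1, x 1} := mI_eq_span (add_mem (hx 0) (hx 1)) (hx 1) (by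
    have e1 : x 1 ∈ Ideal.span {x 0 + x 1, x 1} := Ideal.subset_span (by simp)
    have e2 : x 0 + x 1 ∈ Ideal.span {x 0 + x 1, x 1} := Ideal.subset_span (by simp)
    intro i
    fin_cases i
    · simpa [x] using sub_mem e2 e1
    · exact e1)
  have as : Algebra.adjoin K {x 0 + x 1, x 1} = ⊤ := adjoin_eq_top (a := a) (by
    have e1 : x 1 ∈ Algebra.adjoin K {x 0 + x 1, x 1} := Algebra.subset_adjoin (by simp)
    have e2 : x 0 + x 1 ∈ Algebra.adjoin K {x 0 + x 1, x 1} := Algebra.subset_adjoin (by simp)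
    intro i
    fin_cases i
    · simpa [x] using sub_mem e2 e1
    · exact e1)
  have key : ∀ ψ : MvPolynomial (Fin 2) K →ₐ[K] PowerSeries K, Cent a ψ → Imm a ψ →
      ¬ zz K ^ 2 ∣ ψ (x 0) ∨ ¬ zz K ^ 2 ∣ ψ (x 1) := by
    rintro ψ hc ⟨g, hg, hg1⟩
    by_contra! hcon
    rw [coeff_one_ne_zero_iff ((hc.dvd_iff g).2 hg)] at hg1
    apply hg1
    rw [h01] at hg
    obtain ⟨p, q, rfl⟩ := Ideal.mem_span_pair.1 hg
    rw [map_add, map_mul, map_mul]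
    exact dvd_add (Dvd.dvd.mul_left hcon.1 _) (Dvd.dvd.mul_left hcon.2 _)
  have k1 := key ψ₁ c₁ i₁
  have k2 := key ψ₂ c₂ i₂
  by_cases p1 : zz K ^ 2 ∣ ψ₁ (x 0)
  · have p2 := k1.resolve_left (not_not.2 p1)
    by_cases p3 : zz K ^ 2 ∣ ψ₂ (x 1)
    · have p4 := k2.resolve_right (not_not.2 p3)
      refine ⟨_, _, hs, as, add_mem (hx 0) (hx 1), ?_, ?_⟩
      · rwa [map_add, dvd_add_right p1]
      · rwa [map_add, dvd_add_left p3]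
    · exact ⟨_, _, h10, a10, hx 1, p2, p3⟩
  · by_cases p3 : zz K ^ 2 ∣ ψ₂ (x 0)
    · have p4 := k2.resolve_left (not_not.2 p3)
      by_cases p5 : zz K ^ 2 ∣ ψ₁ (x 1)
      · refine ⟨_, _, hs, as, add_mem (hx 0) (hx 1), ?_, ?_⟩
        · rwa [map_add, dvd_add_left p5]
        · rwa [map_add, dvd_add_right p3]
      · exact ⟨_, _, h10, a10, hx 1, p5, p4⟩
    · exact ⟨_, _, h01, a01, hx 0, p1, p3⟩

lemma Contact.mono {a : Fin 2 → K} {ψ₁ ψ₂ : MvPolynomial (Fin 2) K →ₐ[K] PowerSeries K}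
    (c₁ : Cent a ψ₁) (c₂ : Cent a ψ₂) (i₁ : Imm a ψ₁) (i₂ : Imm a ψ₂) {s t : ℕ} (hst : s ≤ t)
    (h : Contact ψ₁ ψ₂ t) : Contact ψ₁ ψ₂ s := by
  obtain ⟨x, _, _, _, hx, h1, h2⟩ := exists_coord c₁ c₂ i₁ i₂
  obtain ⟨u, hu, hu'⟩ := order_one ((c₁.dvd_iff x).2 hx) h1
  obtain ⟨v, hv, hv'⟩ := order_one ((c₂.dvd_iff x).2 hx) h2
  obtain ⟨r, rfl⟩ := Nat.exists_eq_add_of_le hst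
  have hz : zz K ≠ 0 := PowerSeries.X_ne_zero
  have e : ∀ (w c : PowerSeries K), IsUnit w →
      (zz K ^ (s + r) ∣ (zz K * w) ^ r * c ↔ zz K ^ s ∣ c) := by
    intro w c hw
    rw [add_comm, pow_add, mul_pow, mul_assoc, mul_dvd_mul_iff_left (pow_ne_zero _ hz),
      (hw.pow r).dvd_mul_left]
  intro g
  have := h (x ^ r * g)
  rw [map_mul, map_mul, map_pow, map_pow, hu', hv', e u _ hu, e v _ hv] at this
  exact this

theorem local_backward {a : Fin 2 → K} {ψ₁ ψ₂ : MvPolynomial (Fin 2) K →ₐ[K] PowerSeries K}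
    {F} (c₁ : Cent a ψ₁) (c₂ : Cent a ψ₂) (i₁ : Imm a ψ₁) (i₂ : Imm a ψ₂) (m : ℕ) (hm : 1 ≤ m)
    (hcm : Contact ψ₁ ψ₂ m) (hcm1 : ¬ Contact ψ₁ ψ₂ (m + 1))
    (hF₁ : ψ₁ F = 0) (hF₂ : ψ₂ F = 0) (hF2 : F ∈ mI a ^ 2) (hF3 : F ∉ mI a ^ 3) :
    ∃ e : LocalCompletion (Ideal.span {F}) a ≃+* Rm K m,
      ∀ r : K, e (toComp (Ideal.span {F}) a (C r)) = algebraMap K _ r := by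
  obtain ⟨x, y, hs, ha, hx, h1, h2⟩ := exists_coord c₁ c₂ i₁ i₂
  obtain ⟨ψ₁', c₁', e₁, d₁, z₁⟩ := reparam c₁ hx h1
  obtain ⟨ψ₂', c₂', e₂, d₂, z₂⟩ := reparam c₂ hx h2
  have hC : ∀ t, Contact ψ₁' ψ₂' t ↔ Contact ψ₁ ψ₂ t := by
    intro t
    simp only [Contact, d₁, d₂]
  exact local_backward_norm c₁' c₂' e₁ e₂ hs ha m hm ((hC m).2 hcm)
    (fun h => hcm1 ((hC _).1 h)) (z₁ _ hF₁) (z₂ _ hF₂) hF2 hF3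

end Reparam
end ASing

namespace ASing

section Extract
variable {K : Type*} [Field K]

lemma toComp_not_unit (I : Ideal (MvPolynomial (Fin 2) K)) (a : Fin 2 → K)
    [Nontrivial (LocalCompletion I a)] (g) (hg : g ∈ mI a) : ¬ IsUnit (toComp I a g) := by
  intro hu
  have h1 : IsUnit (evC I a 1 (toComp I a g)) := hu.map _
  have h0 : evC I a 1 (toComp I a g) = 0 := by
    rw [toComp_apply, evC_algebraMap, Ideal.Quotient.eq_zero_iff_mem, pow_one]
    exact Ideal.mem_map_of_mem _ hg
  rw [h0, isUnit_zero_iff] at h1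
  have h2 : mL I a = ⊤ := by
    rw [Ideal.eq_top_iff_one]
    have : (Ideal.Quotient.mk (mL I a ^ 1)) 1 = 0 := by rw [map_one]; exact h1.symm
    rwa [Ideal.Quotient.eq_zero_iff_mem, pow_one] at this
  apply zero_ne_one (α := LocalCompletion I a)
  refine evC_ext I a fun k => ?_
  have : Subsingleton (LocalRingAt I a ⧸ mL I a ^ k) := by
    rw [Ideal.Quotient.subsingleton_iff, h2, Ideal.top_pow]
  exact Subsingleton.elim _ _

lemma Rm_unit (m : ℕ) (hm : 1 ≤ m) (x : Rm K m) (hx : PowerSeries.constantCoeff x.1.1 ≠ 0) :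
    IsUnit x := by
  have hd : zz K ^ m ∣ x.1.1 - x.1.2 := x.2
  have h2 : PowerSeries.constantCoeff x.1.2 ≠ 0 := by
    have : zz K ∣ x.1.1 - x.1.2 := dvd_trans (dvd_pow_self _ (by omega)) hd
    rw [PowerSeries.X_dvd_iff, map_sub, sub_eq_zero] at this
    rwa [← this]
  have u1 : IsUnit x.1.1 := by
    rw [PowerSeries.isUnit_iff_constantCoeff]; exact isUnit_iff_ne_zero.2 hx
  have u2 : IsUnit x.1.2 := by
    rw [PowerSeries.isUnit_iff_constantCoeff]; exact isUnit_iff_ne_zero.2 h2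
  obtain ⟨y1, hy1⟩ := u1.exists_right_inv
  obtain ⟨y2, hy2⟩ := u2.exists_right_inv
  have hy : (y1, y2) ∈ Rm K m := by
    rw [mem_Rm]
    obtain ⟨d, hd⟩ := hd
    refine ⟨- y1 * y2 * d, ?_⟩
    simp only
    linear_combination (- y1 * y2) * hd - y1 * hy2 + y2 * hy1
  refine IsUnit.of_mul_eq_one ⟨_, hy⟩ ?_
  apply Subtype.ext
  exact Prod.ext hy1 hy2

theorem forward_extract (a : Fin 2 → K) (F : MvPolynomial (Fin 2) K) (m : ℕ) (hm : 1 ≤ m)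
    (e : LocalCompletion (Ideal.span {F}) a ≃+* Rm K m)
    (he : ∀ r : K, e (toComp (Ideal.span {F}) a (C r)) = algebraMap K _ r) :
    ∃ ψ₁ ψ₂ : MvPolynomial (Fin 2) K →ₐ[K] PowerSeries K,
      Cent a ψ₁ ∧ Cent a ψ₂ ∧ Imm a ψ₁ ∧ Imm a ψ₂ ∧ ψ₁ F = 0 ∧ ψ₂ F = 0 ∧
      Contact ψ₁ ψ₂ m ∧ ¬ Contact ψ₁ ψ₂ (m + 1) ∧
      ∀ φ : MvPolynomial (Fin 2) K →ₐ[K] PowerSeries K, Cent a φ → φ F = 0 →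
        ∃ χ : PowerSeries K →ₐ[K] PowerSeries K, φ = χ.comp ψ₁ ∨ φ = χ.comp ψ₂ := by
  have hnt : Nontrivial (LocalCompletion (Ideal.span {F}) a) := e.toEquiv.nontrivial
  let θ : MvPolynomial (Fin 2) K →ₐ[K] Rm K m :=
    { (e : _ →+* Rm K m).comp (toComp (Ideal.span {F}) a) with
      commutes' := fun r => he r }
  have hθ : ∀ g, θ g = e (toComp (Ideal.span {F}) a g) := fun g => rfl
  let ψ₁ : MvPolynomial (Fin 2) K →ₐ[K] PowerSeries K :=
    ((AlgHom.fst K _ _).comp (Rm K m).val).comp θ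
  let ψ₂ : MvPolynomial (Fin 2) K →ₐ[K] PowerSeries K :=
    ((AlgHom.snd K _ _).comp (Rm K m).val).comp θ
  have h₁ : ∀ g, ψ₁ g = (θ g).1.1 := fun g => rfl
  have h₂ : ∀ g, ψ₂ g = (θ g).1.2 := fun g => rfl
  have hd : ∀ g, zz K ^ m ∣ ψ₁ g - ψ₂ g := fun g => (θ g).2
  have c₁ : Cent a ψ₁ := by
    intro g
    have h0 : g - C (eval a g) ∈ mI a := by rw [mem_mI]; simp
    have h1 : PowerSeries.constantCoeff (ψ₁ (g - C (eval a g))) = 0 := by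
      by_contra hne
      have hu : IsUnit (θ (g - C (eval a g))) := Rm_unit m hm _ hne
      rw [hθ] at hu
      have hu2 := hu.map e.symm
      rw [e.symm_apply_apply] at hu2
      exact toComp_not_unit _ a _ h0 hu2
    rw [map_sub, map_sub, sub_eq_zero] at h1
    rw [h1, ← MvPolynomial.algebraMap_eq, AlgHom.commutes]
    simp
  have c₂ : Cent a ψ₂ := by
    intro g
    have : zz K ∣ ψ₁ g - ψ₂ g := dvd_trans (dvd_pow_self _ (by omega)) (hd g)
    rw [PowerSeries.X_dvd_iff, map_sub, sub_eq_zero] at this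
    rw [← this, c₁]
  have hF : θ F = 0 := by
    rw [hθ, toComp_apply, toLoc_of_mem _ _ _ (Ideal.mem_span_singleton_self F), map_zero, map_zero]
  have dense : ∀ (r₁ r₂ : PowerSeries K) (_ : zz K ^ m ∣ r₁ - r₂) (k : ℕ),
      ∃ g, zz K ^ k ∣ r₁ - ψ₁ g ∧ zz K ^ k ∣ r₂ - ψ₂ g := by
    intro r₁ r₂ hr k
    have hJ : ∀ g ∈ mI a, (e : _ →+* Rm K m) (toComp (Ideal.span {F}) a g) ∈ Jk K m 1 := by
      intro g hg
      rw [mem_Jk]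
      refine ⟨?_, ?_, ?_⟩
      · rw [pow_one]; exact (c₁.dvd_iff g).2 hg
      · rw [pow_one]; exact (c₂.dvd_iff g).2 hg
      · exact hd g
    obtain ⟨g, hg⟩ := toComp_dense (Ideal.span {F}) a (e : _ →+* Rm K m) (Jk K m 1) hJ
      (e.symm ⟨(r₁, r₂), hr⟩) k
    have := Jk_one_pow m hm k hg
    rw [mem_Jk] at this
    have es : (e : _ →+* Rm K m) (e.symm ⟨(r₁, r₂), hr⟩) = ⟨(r₁, r₂), hr⟩ :=
      e.apply_symm_apply _
    rw [es] at this
    exact ⟨g, this.1, this.2.1⟩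
  obtain ⟨g0, h01, h02⟩ := dense (zz K) (zz K) (by simp) 2
  have himm : ∀ ψ : MvPolynomial (Fin 2) K →ₐ[K] PowerSeries K, Cent a ψ →
      zz K ^ 2 ∣ zz K - ψ g0 → Imm a ψ := by
    intro ψ c h
    have h1 : zz K ∣ ψ g0 := by
      have : zz K ∣ zz K - ψ g0 := dvd_trans (dvd_pow_self _ (by norm_num)) h
      exact (dvd_sub_right dvd_rfl).1 this
    refine ⟨g0, (c.dvd_iff g0).1 h1, ?_⟩
    have h2 := (PowerSeries.X_pow_dvd_iff.1 h) 1 (by norm_num)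
    rw [map_sub, PowerSeries.coeff_one_X, sub_eq_zero] at h2
    rw [← h2]
    exact one_ne_zero
  refine ⟨ψ₁, ψ₂, c₁, c₂, himm _ c₁ h01, himm _ c₂ h02, ?_, ?_, ?_, ?_, ?_⟩
  · rw [h₁, hF]; rfl
  · rw [h₂, hF]; rfl
  · intro g
    rw [← dvd_iff_dvd_of_dvd_sub (hd g)]
  · intro hc
    obtain ⟨g, hg1, hg2⟩ := dense 0 (zz K ^ m) (by simp) (m + 1)
    rw [zero_sub, dvd_neg] at hg1
    have h3 := (hc g).1 hg1
    have h4 : zz K ^ (m + 1) ∣ zz K ^ m := by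
      have := dvd_add hg2 h3
      rwa [sub_add_cancel] at this
    have h5 := (PowerSeries.X_pow_dvd_iff.1 h4) m (by omega)
    rw [PowerSeries.coeff_X_pow_self] at h5
    exact one_ne_zero h5
  · intro φ cφ hφ
    obtain ⟨Φ, hΦ⟩ := toComp_lift (Ideal.span {F}) a (Ideal.span {zz K}) (φ : _ →+* PowerSeries K)
      (by
        intro g hg
        obtain ⟨q, rfl⟩ := Ideal.mem_span_singleton.1 hg
        simp [hφ])
      (by
        intro g hg
        rw [Ideal.mem_span_singleton]
        exact (cφ.dvd_iff g).2 hg)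
      (fun s hs => cφ.isUnit s hs)
    let ρ : Rm K m →ₐ[K] PowerSeries K :=
      { Φ.comp (e.symm : Rm K m →+* _) with
        commutes' := by
          intro r
          have : e.symm (algebraMap K (Rm K m) r) = toComp (Ideal.span {F}) a (C r) := by
            rw [← he r, e.symm_apply_apply]
          show Φ (e.symm (algebraMap K (Rm K m) r)) = _
          rw [this, hΦ]
          exact φ.commutes r }
    have hρ : ∀ g, φ g = ρ (θ g) := by
      intro g
      show _ = Φ (e.symm (e _))
      rw [e.symm_apply_apply, hΦ]
      rfl
    let δ : PowerSeries K →ₐ[K] Rm K m :=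
      ((AlgHom.id K _).prod (AlgHom.id K _)).codRestrict (Rm K m) (by
        intro x; rw [mem_Rm]; simp)
    have hδ : ∀ x, (δ x).1 = (x, x) := fun x => rfl
    let A : Rm K m := ⟨(0, zz K ^ m), by rw [mem_Rm]; simp⟩
    let B : Rm K m := ⟨(zz K ^ m, 0), by rw [mem_Rm]; simp⟩
    have hAB : ρ A * ρ B = 0 := by
      rw [← map_mul]
      have : A * B = 0 := by
        apply Subtype.ext
        exact Prod.ext (zero_mul _) (mul_zero _)
      rw [this, map_zero]
    refine ⟨ρ.comp δ, ?_⟩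
    rcases mul_eq_zero.1 hAB with h0 | h0
    · left
      apply AlgHom.ext
      intro g
      obtain ⟨d, hd'⟩ := hd g
      have : θ g = δ (ψ₁ g) - A * δ d := by
        apply Subtype.ext
        refine Prod.ext ?_ ?_
        · show ψ₁ g = ψ₁ g - 0 * d
          ring
        · show ψ₂ g = ψ₁ g - zz K ^ m * d
          linear_combination -hd'
      rw [hρ, this, map_sub, map_mul, h0, zero_mul, sub_zero]
      rfl
    · right
      apply AlgHom.ext
      intro g
      obtain ⟨d, hd'⟩ := hd g
      have : θ g = δ (ψ₂ g) + B * δ d := by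
        apply Subtype.ext
        refine Prod.ext ?_ ?_
        · show ψ₁ g = ψ₂ g + zz K ^ m * d
          linear_combination hd'
        · show ψ₂ g = ψ₂ g + 0 * d
          ring
      rw [hρ, this, map_add, map_mul, h0, zero_mul, add_zero]
      rfl

end Extract
end ASing

namespace ASing

section Homog
variable {K : Type*} [Field K]

lemma aeval_mul_homog {σ : Type*} {B : Type*} [CommRing B] [Algebra K B]
    {h : MvPolynomial σ K} {d : ℕ} (hh : h.IsHomogeneous d) (b : B) (y : σ → B) :
    aeval (fun j => b * y j) h = b ^ d * aeval y h := by
  rw [aeval_def, eval₂_eq, aeval_def, eval₂_eq, Finset.mul_sum]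
  refine Finset.sum_congr rfl fun s hs => ?_
  have : ∏ i ∈ s.support, (b * y i) ^ s i = b ^ d * ∏ i ∈ s.support, y i ^ s i := by
    simp only [mul_pow]
    rw [Finset.prod_mul_distrib, Finset.prod_pow_eq_pow_sum]
    congr 2
    exact (hh.degree_eq_sum_deg_support hs).symm
  rw [this]; ring

lemma eval_smul_homog {σ : Type*} {h : MvPolynomial σ K} {d : ℕ} (hh : h.IsHomogeneous d) (b : K)
    (y : σ → K) : eval (b • y) h = b ^ d * eval y h := by
  have := aeval_mul_homog hh b y
  simp only [aeval_eq_eval] at this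
  exact this

lemma homog_factor {σ : Type*} {L H₁ : MvPolynomial σ K} {k d : ℕ} (hL : L.IsHomogeneous k)
    (hH : (L * H₁).IsHomogeneous (k + d)) : L * homogeneousComponent d H₁ = L * H₁ := by
  have e : homogeneousComponent (k + d) (L * H₁) = L * homogeneousComponent d H₁ := by
    conv_lhs => rw [← sum_homogeneousComponent H₁, Finset.mul_sum, map_sum]
    have : ∀ i, homogeneousComponent (k + d) (L * homogeneousComponent i H₁) =
        if i = d then L * homogeneousComponent d H₁ else 0 := by
      intro i
      rw [homogeneousComponent_of_mem (hL.mul (homogeneousComponent_isHomogeneous i H₁))]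
      by_cases h : i = d
      · subst h; simp
      · rw [if_neg (by omega), if_neg h]
    simp only [this]
    rw [Finset.sum_ite_eq']
    split_ifs with h
    · rfl
    · rw [homogeneousComponent_eq_zero, mul_zero]
      simpa using h
  rw [← e, homogeneousComponent_eq_self hH]

lemma homog_dvd {σ : Type*} {L H : MvPolynomial σ K} {k d : ℕ} (hL : L.IsHomogeneous k)
    (hH : H.IsHomogeneous d) (hd : L ∣ H) : ∃ e H₁, H = L * H₁ ∧ H₁.IsHomogeneous e := by
  obtain ⟨H₁, rfl⟩ := hd
  by_cases h0 : L * H₁ = 0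
  · exact ⟨0, 0, by rw [h0, mul_zero], isHomogeneous_zero _ _ _⟩
  have hL0 : L ≠ 0 := left_ne_zero_of_mul h0
  have hk : k ≤ d := by
    have h1 := hL.totalDegree hL0
    have h2 := hH.totalDegree h0
    rw [totalDegree_mul_of_isDomain hL0 (right_ne_zero_of_mul h0)] at h2
    omega
  obtain ⟨e, rfl⟩ := Nat.exists_eq_add_of_le hk
  exact ⟨e, homogeneousComponent e H₁, (homog_factor hL hH).symm,
    homogeneousComponent_isHomogeneous _ _⟩

lemma linFormOf_homog (q : Fin 2 → K) : (linFormOf q).IsHomogeneous 1 := by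
  unfold linFormOf
  exact (isHomogeneous_C_mul_X _ _).sub (isHomogeneous_C_mul_X _ _)

lemma eval_linFormOf (q v : Fin 2 → K) : eval v (linFormOf q) = q 1 * v 0 - q 0 * v 1 := by
  simp [linFormOf]

lemma linFormOf_ne_zero {q : Fin 2 → K} (hq : q ≠ 0) : linFormOf q ≠ 0 := by
  intro h
  apply hq
  have h1 := eval_linFormOf q ![1, 0]
  have h2 := eval_linFormOf q ![0, 1]
  rw [h] at h1 h2
  simp at h1 h2
  ext i; fin_cases i
  · exact h2
  · exact h1.symm

lemma linFormOf_dvd {q : Fin 2 → K} (hq : q ≠ 0) {H : MvPolynomial (Fin 2) K} {d : ℕ}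
    (hH : H.IsHomogeneous d) (h0 : eval q H = 0) : linFormOf q ∣ H := by
  obtain ⟨j, hj⟩ : ∃ j, q j ≠ 0 := by
    by_contra hcon
    push Not at hcon
    exact hq (funext hcon)
  let y : Fin 2 → MvPolynomial (Fin 2) K := fun i => (C (q j)⁻¹ * X j) * C (q i)
  have h1 : aeval y H = 0 := by
    rw [aeval_mul_homog hH]
    have : aeval (fun i => C (q i)) H = (C (eval q H) : MvPolynomial (Fin 2) K) := by
      have := (aeval_algebraMap_apply (MvPolynomial (Fin 2) K) q H)
      rw [aeval_eq_eval] at this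
      exact this
    rw [this, h0]; simp
  rw [← Ideal.mem_span_singleton, ← Ideal.Quotient.eq_zero_iff_mem]
  have h2 : ∀ i, Ideal.Quotient.mk (Ideal.span {linFormOf q}) (y i) =
      Ideal.Quotient.mk (Ideal.span {linFormOf q}) (X i) := by
    intro i
    rw [Ideal.Quotient.eq, Ideal.mem_span_singleton]
    have hC : (C (q j)⁻¹ : MvPolynomial (Fin 2) K) * C (q j) = 1 := by
      rw [← C_mul, inv_mul_cancel₀ hj, C_1]
    fin_cases i <;> fin_cases j
    · exact ⟨0, by simp only [y]; simp at hC ⊢; linear_combination (X 0) * hC⟩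
    · exact ⟨-C (q 1)⁻¹, by simp only [y, linFormOf]; simp at hC ⊢; linear_combination (X 0) * hC⟩
    · exact ⟨C (q 0)⁻¹, by simp only [y, linFormOf]; simp at hC ⊢; linear_combination (X 1) * hC⟩
    · exact ⟨0, by simp only [y]; simp at hC ⊢; linear_combination (X 1) * hC⟩
  have h3 : ∀ G : MvPolynomial (Fin 2) K, Ideal.Quotient.mk (Ideal.span {linFormOf q}) (aeval y G) =
      Ideal.Quotient.mk (Ideal.span {linFormOf q}) G := by
    intro G
    induction G using MvPolynomial.induction_on with
    | C a => simp [MvPolynomial.algebraMap_eq]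
    | add p q hp hq => rw [map_add, map_add, hp, hq, map_add]
    | mul_X p i hp => rw [map_mul, map_mul, hp, aeval_X, h2, map_mul]
  rw [← h3, h1, map_zero]

/-- the affine line `q + z r` -/
def ln (q r : Fin 2 → K) : Fin 2 → PowerSeries K :=
  fun i => PowerSeries.C (q i) + zz K * PowerSeries.C (r i)

lemma aeval_const (σ : Fin 2 → PowerSeries K) (G : MvPolynomial (Fin 2) K) :
    PowerSeries.constantCoeff (aeval σ G) =
      eval (fun i => PowerSeries.constantCoeff (σ i)) G := by
  induction G using MvPolynomial.induction_on with
  | C a => simp [PowerSeries.algebraMap_apply]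
  | add p q hp hq => simp [hp, hq]
  | mul_X p i hp => simp [hp]

lemma ln_const (q r : Fin 2 → K) (i) : PowerSeries.constantCoeff (ln q r i) = q i := by
  simp [ln]

lemma aeval_ln_const (q r : Fin 2 → K) (G : MvPolynomial (Fin 2) K) :
    PowerSeries.constantCoeff (aeval (ln q r) G) = eval q G := by
  rw [aeval_const]; simp only [ln_const]

lemma aeval_ln_lin (q r v : Fin 2 → K) : aeval (ln q r) (linFormOf v) =
    PowerSeries.C (v 1 * q 0 - v 0 * q 1) + zz K * PowerSeries.C (v 1 * r 0 - v 0 * r 1) := by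
  have hC : ∀ x : K, algebraMap K (PowerSeries K) x = PowerSeries.C x := fun x => rfl
  simp [linFormOf, ln, hC]
  ring

lemma pow_dvd_iff {q r : Fin 2 → K} (hqr : q 1 * r 0 - q 0 * r 1 ≠ 0) (t : ℕ)
    {H : MvPolynomial (Fin 2) K} {d : ℕ} (hH : H.IsHomogeneous d) :
    linFormOf q ^ t ∣ H ↔ zz K ^ t ∣ aeval (ln q r) H := by
  have hq : q ≠ 0 := by rintro rfl; simp at hqr
  have hl : aeval (ln q r) (linFormOf q) = zz K * PowerSeries.C (q 1 * r 0 - q 0 * r 1) := by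
    rw [aeval_ln_lin]
    have : q 1 * q 0 - q 0 * q 1 = 0 := by ring
    rw [this, map_zero, zero_add]
  constructor
  · rintro ⟨G, rfl⟩
    rw [map_mul, map_pow, hl, mul_pow, mul_assoc]
    exact dvd_mul_right _ _
  · induction t generalizing H d with
    | zero => intro _; simp
    | succ t ih =>
      intro h
      have h0 : eval q H = 0 := by
        rw [← aeval_ln_const q r, ← PowerSeries.X_dvd_iff]
        exact dvd_trans (dvd_pow_self _ (by omega)) h
      obtain ⟨e, H₁, rfl, hH₁⟩ := homog_dvd (linFormOf_homog q) hH (linFormOf_dvd hq hH h0)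
      rw [pow_succ']
      refine mul_dvd_mul_left _ (ih hH₁ ?_)
      rw [map_mul, hl, pow_succ', mul_assoc,
        mul_dvd_mul_iff_left (PowerSeries.X_ne_zero)] at h
      have hu : IsUnit (PowerSeries.C (q 1 * r 0 - q 0 * r 1) : PowerSeries K) :=
        (isUnit_iff_ne_zero.2 hqr).map _
      rwa [hu.dvd_mul_left] at h

lemma mul_pow_dvd {q r : Fin 2 → K} (hqr : q 1 * r 0 - q 0 * r 1 ≠ 0) (t : ℕ)
    {H : MvPolynomial (Fin 2) K} {d : ℕ} (hH : H.IsHomogeneous d)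
    : (linFormOf q * linFormOf r) ^ t ∣ H ↔ linFormOf q ^ t ∣ H ∧ linFormOf r ^ t ∣ H := by
  constructor
  · intro h
    rw [mul_pow] at h
    exact ⟨dvd_trans (dvd_mul_right _ _) h, dvd_trans (dvd_mul_left _ _) h⟩
  · rintro ⟨h1, h2⟩
    obtain ⟨e, H₁, rfl, hH₁⟩ := homog_dvd ((linFormOf_homog q).pow t) hH h1
    rw [mul_pow]
    refine mul_dvd_mul_left _ ?_
    have hrq : r 1 * q 0 - r 0 * q 1 ≠ 0 := by
      intro h; apply hqr; linear_combination -h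
    rw [pow_dvd_iff hrq t hH₁]
    rw [pow_dvd_iff hrq t hH, map_mul, map_pow] at h2
    have hu : IsUnit (aeval (ln r q) (linFormOf q)) := by
      rw [PowerSeries.isUnit_iff_constantCoeff, aeval_ln_const, eval_linFormOf, isUnit_iff_ne_zero]
      exact hqr
    rwa [(hu.pow t).dvd_mul_left] at h2

end Homog

section Chart
variable {K : Type*} [Field K]

lemma dehomMap_self (c : Fin 3) : dehomMap (K := K) c c = 1 := by simp [dehomMap]

lemma dehomMap_emb (c : Fin 3) (i : Fin 2) : dehomMap (K := K) c (chartEmb c i) = X i := by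
  fin_cases c <;> fin_cases i <;> simp [dehomMap, chartEmb]

lemma chart_cases (c j : Fin 3) : j = c ∨ ∃ i, j = chartEmb c i := by
  fin_cases c <;> fin_cases j <;> simp [chartEmb, Fin.exists_fin_two]

lemma dehom_aeval {B : Type*} [CommRing B] [Algebra K B] (c : Fin 3) (w : Fin 3 → B)
    (x : Fin 2 → B) (hw : ∀ i, w (chartEmb c i) = w c * x i) {h : MvPolynomial (Fin 3) K} {d : ℕ}
    (hh : h.IsHomogeneous d) : aeval w h = w c ^ d * aeval x (aeval (dehomMap (K := K) c) h) := by
  have h1 : w = fun j => w c * aeval x (dehomMap (K := K) c j) := by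
    funext j
    rcases chart_cases c j with rfl | ⟨i, rfl⟩
    · rw [dehomMap_self, map_one, mul_one]
    · rw [dehomMap_emb, aeval_X, hw]
  have h2 : aeval x (aeval (dehomMap (K := K) c) h) = aeval (fun j => aeval x (dehomMap (K := K) c j)) h := by
    rw [← AlgHom.comp_apply, comp_aeval]
  rw [h2, ← aeval_mul_homog hh]
  conv_lhs => rw [h1]

lemma exists_homogenize (c : Fin 3) (g : MvPolynomial (Fin 2) K) :
    ∃ (d : ℕ) (h : MvPolynomial (Fin 3) K), h.IsHomogeneous d ∧ aeval (dehomMap c) h = g := by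
  suffices H : ∃ d₀ : ℕ, ∀ d ≥ d₀, ∃ h : MvPolynomial (Fin 3) K, h.IsHomogeneous d ∧
      aeval (dehomMap c) h = g by
    obtain ⟨d, H⟩ := H
    exact ⟨d, H d le_rfl⟩
  induction g using MvPolynomial.induction_on with
  | C a =>
    refine ⟨0, fun d _ => ⟨C a * X c ^ d, isHomogeneous_C_mul_X_pow _ _ _, ?_⟩⟩
    simp [dehomMap_self, MvPolynomial.algebraMap_eq]
  | add p q hp hq =>
    obtain ⟨d₁, H₁⟩ := hp
    obtain ⟨d₂, H₂⟩ := hq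
    refine ⟨max d₁ d₂, fun d hd => ?_⟩
    obtain ⟨h₁, a₁, b₁⟩ := H₁ d (le_trans (le_max_left _ _) hd)
    obtain ⟨h₂, a₂, b₂⟩ := H₂ d (le_trans (le_max_right _ _) hd)
    exact ⟨h₁ + h₂, a₁.add a₂, by rw [map_add, b₁, b₂]⟩
  | mul_X p i hp =>
    obtain ⟨d₁, H₁⟩ := hp
    refine ⟨d₁ + 1, fun d hd => ?_⟩
    obtain ⟨e, rfl⟩ := Nat.exists_eq_add_of_le' (show 1 ≤ d by omega)
    obtain ⟨h₁, a₁, b₁⟩ := H₁ e (by omega)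
    exact ⟨h₁ * X (chartEmb c i), a₁.mul (isHomogeneous_X _ _), by
      rw [map_mul, b₁, aeval_X, dehomMap_emb]⟩

/-- the branch of the curve in the chart `c` given by `σ` -/
def br (f : Fin 3 → MvPolynomial (Fin 2) K) (c : Fin 3) (σ : Fin 2 → PowerSeries K) :
    MvPolynomial (Fin 2) K →ₐ[K] PowerSeries K :=
  aeval (fun i => (aeval σ (f c))⁻¹ * aeval σ (f (chartEmb c i)))

lemma aeval_aeval {B : Type*} [CommRing B] [Algebra K B] (f : Fin 3 → MvPolynomial (Fin 2) K)
    (σ : Fin 2 → B) (h : MvPolynomial (Fin 3) K) : aeval σ (aeval f h) = aeval (fun j => aeval σ (f j)) h := by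
  rw [← AlgHom.comp_apply, comp_aeval]

lemma br_dehom (f : Fin 3 → MvPolynomial (Fin 2) K) (c : Fin 3) (σ : Fin 2 → PowerSeries K)
    (hc : PowerSeries.constantCoeff (aeval σ (f c)) ≠ 0) {h : MvPolynomial (Fin 3) K} {d : ℕ}
    (hh : h.IsHomogeneous d) :
    aeval σ (aeval f h) = (aeval σ (f c)) ^ d * br f c σ (aeval (dehomMap c) h) := by
  rw [aeval_aeval]
  refine dehom_aeval c (fun j => aeval σ (f j)) _ ?_ hh
  intro i
  rw [← mul_assoc, PowerSeries.mul_inv_cancel _ hc, one_mul]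

lemma br_dvd (f : Fin 3 → MvPolynomial (Fin 2) K) (c : Fin 3) (σ : Fin 2 → PowerSeries K)
    (hc : PowerSeries.constantCoeff (aeval σ (f c)) ≠ 0) {h : MvPolynomial (Fin 3) K} {d : ℕ}
    (hh : h.IsHomogeneous d) (u : PowerSeries K) :
    u ∣ br f c σ (aeval (dehomMap c) h) ↔ u ∣ aeval σ (aeval f h) := by
  rw [br_dehom f c σ hc hh]
  have hu : IsUnit (aeval σ (f c)) := by
    rw [PowerSeries.isUnit_iff_constantCoeff]; exact isUnit_iff_ne_zero.2 hc
  rw [(hu.pow d).dvd_mul_left]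

lemma br_cent (f : Fin 3 → MvPolynomial (Fin 2) K) (c : Fin 3) (σ : Fin 2 → PowerSeries K)
    (q : Fin 2 → K) (hσ : ∀ i, PowerSeries.constantCoeff (σ i) = q i) (p : Fin 3 → K)
    (lam : K) (hl : lam ≠ 0) (hfp : evalVec f q = lam • p) (hpc : p c ≠ 0) :
    Cent (affOf p c) (br f c σ) := by
  intro g
  unfold br
  rw [aeval_const]
  congr 2
  funext i
  have h : ∀ j, PowerSeries.constantCoeff (aeval σ (f j)) = lam * p j := by
    intro j
    rw [aeval_const]
    have := congrFun hfp j
    simp only [evalVec, Pi.smul_apply, smul_eq_mul] at this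
    rw [← this]
    simp only [hσ]
  rw [map_mul, PowerSeries.constantCoeff_inv, h, h, affOf]
  field_simp

end Chart
end ASing

namespace ASing

section Curv
variable {K : Type*} [Field K]

/-- the ideal of functions vanishing to order `t` on a branch -/
def brIdeal (ψ : MvPolynomial (Fin 2) K →ₐ[K] PowerSeries K) (t : ℕ) :
    Ideal (MvPolynomial (Fin 2) K) := (Ideal.span {zz K ^ t}).comap ψ

lemma mem_brIdeal (ψ : MvPolynomial (Fin 2) K →ₐ[K] PowerSeries K) (t : ℕ) (g) :
    g ∈ brIdeal ψ t ↔ zz K ^ t ∣ ψ g := by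
  rw [brIdeal, Ideal.mem_comap, Ideal.mem_span_singleton]

lemma quot_equiv {a : Fin 2 → K} {ψ : MvPolynomial (Fin 2) K →ₐ[K] PowerSeries K} (hc : Cent a ψ)
    (hi : Imm a ψ) (t : ℕ) : Nonempty ((MvPolynomial (Fin 2) K ⧸ brIdeal ψ t) ≃ₐ[K]
      (Polynomial K ⧸ Ideal.span {(Polynomial.X : Polynomial K) ^ t})) := by
  obtain ⟨x, hx, h1⟩ := hi
  rw [coeff_one_ne_zero_iff ((hc.dvd_iff x).2 hx)] at h1
  obtain ⟨ψ', c', e', d', -⟩ := reparam hc hx h1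
  let θ : Polynomial K →ₐ[K] (MvPolynomial (Fin 2) K ⧸ brIdeal ψ t) :=
    (Ideal.Quotient.mkₐ K (brIdeal ψ t)).comp (Polynomial.aeval x)
  have hP : ∀ P : Polynomial K, ψ' (Polynomial.aeval x P) = (P : PowerSeries K) := by
    intro P
    rw [← Polynomial.aeval_algHom_apply, e', aeval_zz]
  have hsurj : Function.Surjective θ := by
    intro b
    obtain ⟨g, rfl⟩ := Ideal.Quotient.mk_surjective b
    obtain ⟨P, A', hA⟩ := exists_trunc (ψ' g) t
    refine ⟨P, ?_⟩
    show Ideal.Quotient.mk _ (Polynomial.aeval x P) = _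
    rw [Ideal.Quotient.eq, mem_brIdeal, ← d', map_sub, hP, hA]
    exact ⟨-A', by ring⟩
  have hker : RingHom.ker θ = Ideal.span {(Polynomial.X : Polynomial K) ^ t} := by
    ext P
    rw [RingHom.mem_ker, Ideal.mem_span_singleton]
    show Ideal.Quotient.mk _ (Polynomial.aeval x P) = 0 ↔ _
    rw [Ideal.Quotient.eq_zero_iff_mem, mem_brIdeal, ← d', hP, Polynomial.X_pow_dvd_iff,
      PowerSeries.X_pow_dvd_iff]
    simp
  exact ⟨((Ideal.quotientEquivAlgOfEq K hker.symm).trans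
    (Ideal.quotientKerAlgEquivOfSurjective hsurj)).symm⟩

lemma curv_iff {a : Fin 2 → K} {ψ₁ ψ₂ : MvPolynomial (Fin 2) K →ₐ[K] PowerSeries K}
    (c₁ : Cent a ψ₁) (c₂ : Cent a ψ₂) (i₁ : Imm a ψ₁) (i₂ : Imm a ψ₂) (t : ℕ)
    (I : Ideal (MvPolynomial (Fin 2) K))
    (hI : ∀ g, g ∈ I ↔ zz K ^ t ∣ ψ₁ g ∧ zz K ^ t ∣ ψ₂ g) :
    Nonempty (LocalRingAt I a ≃ₐ[K]
      (Polynomial K ⧸ Ideal.span {(Polynomial.X : Polynomial K) ^ t})) ↔ Contact ψ₁ ψ₂ t := by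
  obtain ⟨e⟩ := loc_equiv I a t (by
    intro g hg
    exact (hI g).2 ⟨c₁.pow_dvd t g hg, c₂.pow_dvd t g hg⟩)
  obtain ⟨e₁⟩ := quot_equiv c₁ i₁ t
  obtain ⟨e₂⟩ := quot_equiv c₂ i₂ t
  constructor
  · rintro ⟨e'⟩
    have hfin : Module.Finite K (Polynomial K ⧸ Ideal.span {(Polynomial.X : Polynomial K) ^ t}) :=
      (Polynomial.monic_X_pow t).finite_quotient
    have key : ∀ I' : Ideal (MvPolynomial (Fin 2) K), I ≤ I' →
        ((MvPolynomial (Fin 2) K ⧸ I') ≃ₐ[K]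
        (Polynomial K ⧸ Ideal.span {(Polynomial.X : Polynomial K) ^ t})) → I' ≤ I := by
      intro I' hle e''
      let E := (e.trans e').trans e''.symm
      have : Module.Finite K (MvPolynomial (Fin 2) K ⧸ I) :=
        Module.Finite.equiv (e.trans e').symm.toLinearEquiv
      have hs : Function.Surjective (Ideal.Quotient.factorₐ K hle) :=
        Ideal.Quotient.factor_surjective hle
      have hs2 : Function.Surjective
          ((E.symm.toLinearMap).comp (Ideal.Quotient.factorₐ K hle).toLinearMap) :=
        E.symm.surjective.comp hs
      have hi2 := LinearMap.injective_iff_surjective.2 hs2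
      intro g hg
      rw [← Ideal.Quotient.eq_zero_iff_mem]
      apply hi2
      rw [map_zero]
      show E.symm (Ideal.Quotient.mk I' g) = 0
      rw [Ideal.Quotient.eq_zero_iff_mem.2 hg, map_zero]
    have k1 := key (brIdeal ψ₁ t) (by
      intro g hg; rw [mem_brIdeal]; exact ((hI g).1 hg).1) e₁
    have k2 := key (brIdeal ψ₂ t) (by
      intro g hg; rw [mem_brIdeal]; exact ((hI g).1 hg).2) e₂
    intro g
    constructor
    · intro h
      exact ((hI g).1 (k1 ((mem_brIdeal _ _ _).2 h))).2
    · intro h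
      exact ((hI g).1 (k2 ((mem_brIdeal _ _ _).2 h))).1
  · intro hcon
    have hI1 : I = brIdeal ψ₁ t := by
      ext g
      rw [hI, mem_brIdeal, ← hcon g, and_self]
    subst hI1
    exact ⟨e.symm.trans e₁⟩

end Curv

section CurvGlobal
variable {K : Type*} [Field K]

/-- Homogeneous contact. -/
def HC (f : Fin 3 → MvPolynomial (Fin 2) K) (q r : Fin 2 → K) (t : ℕ) : Prop :=
  ∀ (d : ℕ) (h : MvPolynomial (Fin 3) K), h.IsHomogeneous d →
    (linFormOf q ^ t ∣ aeval f h ↔ linFormOf r ^ t ∣ aeval f h)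

/-- The data of two distinct preimages. -/
structure TwoPre (n : ℕ) (f : Fin 3 → MvPolynomial (Fin 2) K) (p : Fin 3 → K) (q r : Fin 2 → K) :
    Prop where
  homog : ∀ u, (f u).IsHomogeneous n
  indep : q 1 * r 0 - q 0 * r 1 ≠ 0
  pre₁ : ∃ lam : K, lam ≠ 0 ∧ evalVec f q = lam • p
  pre₂ : ∃ lam : K, lam ≠ 0 ∧ evalVec f r = lam • p

variable {n : ℕ} {f : Fin 3 → MvPolynomial (Fin 2) K} {p : Fin 3 → K} {q r : Fin 2 → K}

lemma TwoPre.symm (h : TwoPre n f p q r) : TwoPre n f p r q :=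
  ⟨h.homog, fun h' => h.indep (by linear_combination -h'), h.pre₂, h.pre₁⟩

lemma TwoPre.cent (h : TwoPre n f p q r) {c : Fin 3} (hpc : p c ≠ 0) :
    Cent (affOf p c) (br f c (ln q r)) := by
  obtain ⟨lam, hl, hp⟩ := h.pre₁
  exact br_cent f c _ q (ln_const q r) p lam hl hp hpc

lemma TwoPre.const (h : TwoPre n f p q r) {c : Fin 3} (hpc : p c ≠ 0) :
    PowerSeries.constantCoeff (aeval (ln q r) (f c)) ≠ 0 := by
  obtain ⟨lam, hl, hp⟩ := h.pre₁
  rw [aeval_ln_const]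
  have := congrFun hp c
  simp only [evalVec, Pi.smul_apply, smul_eq_mul] at this
  rw [this]
  exact mul_ne_zero hl hpc

lemma TwoPre.dvd (h : TwoPre n f p q r) {c : Fin 3} (hpc : p c ≠ 0) (t : ℕ) {d : ℕ}
    {H : MvPolynomial (Fin 3) K} (hH : H.IsHomogeneous d) :
    zz K ^ t ∣ br f c (ln q r) (aeval (dehomMap c) H) ↔ linFormOf q ^ t ∣ aeval f H := by
  rw [br_dvd f c _ (h.const hpc) hH, pow_dvd_iff h.indep t (hH.aeval f h.homog)]

lemma TwoPre.mem_J (h : TwoPre n f p q r) {c : Fin 3} (hpc : p c ≠ 0) (t : ℕ) (g) :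
    g ∈ dehomIdeal c (JIdeal f ((linFormOf q * linFormOf r) ^ t)) ↔
      zz K ^ t ∣ br f c (ln q r) g ∧ zz K ^ t ∣ br f c (ln r q) g := by
  constructor
  · have hle : dehomIdeal c (JIdeal f ((linFormOf q * linFormOf r) ^ t)) ≤
        brIdeal (br f c (ln q r)) t ⊓ brIdeal (br f c (ln r q)) t := by
      unfold dehomIdeal JIdeal
      rw [Ideal.map_span, Ideal.span_le]
      rintro _ ⟨H, ⟨⟨d, hH⟩, hd⟩, rfl⟩
      rw [mul_pow_dvd h.indep t (hH.aeval f h.homog)] at hd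
      refine ⟨?_, ?_⟩
      · refine (mem_brIdeal _ _ _).2 ?_
        exact (h.dvd hpc t hH).2 hd.1
      · refine (mem_brIdeal _ _ _).2 ?_
        exact (h.symm.dvd hpc t hH).2 hd.2
    intro hg
    have := hle hg
    exact ⟨(mem_brIdeal _ _ _).1 this.1, (mem_brIdeal _ _ _).1 this.2⟩
  · rintro ⟨h1, h2⟩
    obtain ⟨d, H, hH, rfl⟩ := exists_homogenize c g
    rw [h.dvd hpc t hH] at h1
    rw [h.symm.dvd hpc t hH] at h2
    refine Ideal.mem_map_of_mem _ (Ideal.subset_span ⟨⟨d, hH⟩, ?_⟩)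
    rw [mul_pow_dvd h.indep t (hH.aeval f h.homog)]
    exact ⟨h1, h2⟩

lemma TwoPre.contact_iff (h : TwoPre n f p q r) {c : Fin 3} (hpc : p c ≠ 0) (t : ℕ) :
    Contact (br f c (ln q r)) (br f c (ln r q)) t ↔ HC f q r t := by
  constructor
  · intro hc d H hH
    rw [← h.dvd hpc t hH, ← h.symm.dvd hpc t hH]
    exact hc _
  · intro hc g
    obtain ⟨d, H, hH, rfl⟩ := exists_homogenize c g
    rw [h.dvd hpc t hH, h.symm.dvd hpc t hH]
    exact hc d H hH

/-- Homogeneous immersedness. -/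
def HImm (f : Fin 3 → MvPolynomial (Fin 2) K) (p : Fin 3 → K) (q : Fin 2 → K) : Prop :=
  ∃ i j : Fin 3, ¬ linFormOf q ^ 2 ∣ crossDiff f p i j

lemma crossDiff_eq (p : Fin 3 → K) (i j : Fin 3) :
    crossDiff f p i j = aeval f (C (p i) * X j - C (p j) * X i) := by
  simp [crossDiff, MvPolynomial.algebraMap_eq]

lemma lin_homog (p : Fin 3 → K) (i j : Fin 3) :
    (C (p i) * X j - C (p j) * X i : MvPolynomial (Fin 3) K).IsHomogeneous 1 :=
  (isHomogeneous_C_mul_X _ _).sub (isHomogeneous_C_mul_X _ _)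

lemma TwoPre.imm_iff (h : TwoPre n f p q r) {c : Fin 3} (hpc : p c ≠ 0) :
    Imm (affOf p c) (br f c (ln q r)) ↔ HImm f p q := by
  have hc := h.cent hpc
  constructor
  · intro hi
    by_contra hcon
    simp only [HImm, not_exists, not_not] at hcon
    obtain ⟨g, hg, hg1⟩ := hi
    rw [coeff_one_ne_zero_iff ((hc.dvd_iff g).2 hg)] at hg1
    apply hg1
    have key : ∀ i : Fin 2, zz K ^ 2 ∣ br f c (ln q r) (X i - C (affOf p c i)) := by
      intro i
      have h1 := hcon c (chartEmb c i)
      rw [crossDiff_eq, ← h.dvd hpc 2 (lin_homog p _ _)] at h1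
      have : (X i - C (affOf p c i) : MvPolynomial (Fin 2) K) =
          C (p c)⁻¹ * aeval (dehomMap c) (C (p c) * X (chartEmb c i) - C (p (chartEmb c i)) * X c) := by
        simp only [map_sub, map_mul, aeval_X, dehomMap_self, dehomMap_emb, aeval_C,
          MvPolynomial.algebraMap_eq, affOf, div_eq_mul_inv]
        have hC : (C (p c)⁻¹ : MvPolynomial (Fin 2) K) * C (p c) = 1 := by
          rw [← C_mul, inv_mul_cancel₀ hpc, C_1]
        linear_combination -(X i) * hC
      rw [this, map_mul]
      exact Dvd.dvd.mul_left h1 _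
    have hall : ∀ g : MvPolynomial (Fin 2) K,
        zz K ^ 2 ∣ br f c (ln q r) (g - C (eval (affOf p c) g)) := by
      intro g
      induction g using MvPolynomial.induction_on with
      | C a => simp
      | add u v hu hv =>
        have : u + v - C (eval (affOf p c) (u + v)) =
          (u - C (eval (affOf p c) u)) + (v - C (eval (affOf p c) v)) := by simp; ring
        rw [this, map_add]
        exact dvd_add hu hv
      | mul_X u i hu =>
        have : u * X i - C (eval (affOf p c) (u * X i)) =
          (u - C (eval (affOf p c) u)) * X i +
            C (eval (affOf p c) u) * (X i - C (affOf p c i)) := by simp; ring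
        rw [this, map_add, map_mul, map_mul]
        exact dvd_add (Dvd.dvd.mul_right hu _) (Dvd.dvd.mul_left (key i) _)
    have := hall g
    rw [mem_mI] at hg
    rwa [hg, C_0, sub_zero] at this
  · rintro ⟨i, j, hij⟩
    rw [crossDiff_eq, ← h.dvd hpc 2 (lin_homog p _ _)] at hij
    have h0 : aeval (dehomMap c) (C (p i) * X j - C (p j) * X i : MvPolynomial (Fin 3) K) ∈
        mI (affOf p c) := by
      rw [← hc.dvd_iff, ← pow_one (zz K), h.dvd hpc 1 (lin_homog p _ _),
        pow_dvd_iff h.indep 1 ((lin_homog p i j).aeval f h.homog), pow_one, PowerSeries.X_dvd_iff,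
        aeval_ln_const]
      obtain ⟨lam, hl, hp⟩ := h.pre₁
      have hp' : ∀ u, eval q (f u) = lam * p u := fun u => congrFun hp u
      rw [← crossDiff_eq]
      simp only [crossDiff, map_sub, map_mul, eval_C, hp']
      ring
    exact ⟨_, h0, (coeff_one_ne_zero_iff ((hc.dvd_iff _).2 h0)).2 hij⟩

lemma TwoPre.curv (h : TwoPre n f p q r) (h₁ : HImm f p q) (h₂ : HImm f p r) (hp : p ≠ 0) (t : ℕ) :
    CurvilinearOfLength (JIdeal f ((linFormOf q * linFormOf r) ^ t)) p t ↔ HC f q r t := by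
  have key : ∀ c, p c ≠ 0 → (Nonempty ((LocalRingAt (dehomIdeal c
      (JIdeal f ((linFormOf q * linFormOf r) ^ t))) (affOf p c)) ≃ₐ[K]
      (Polynomial K ⧸ Ideal.span {(Polynomial.X : Polynomial K) ^ t})) ↔ HC f q r t) := by
    intro c hpc
    rw [curv_iff (h.cent hpc) (h.symm.cent hpc) ((h.imm_iff hpc).2 h₁) ((h.symm.imm_iff hpc).2 h₂)
      t _ (h.mem_J hpc t), h.contact_iff hpc]
  constructor
  · intro H
    obtain ⟨c, hc⟩ : ∃ c, p c ≠ 0 := by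
      by_contra hcon
      push Not at hcon
      exact hp (funext hcon)
    exact (key c hc).1 (H c hc)
  · intro H c hc
    exact (key c hc).2 H

end CurvGlobal
end ASing

namespace ASing

section Mult
variable {K : Type*} [Field K]

lemma dehom_pow_mem (p : Fin 3 → K) {c : Fin 3} (hpc : p c ≠ 0) (k : ℕ) (F : MvPolynomial (Fin 3) K)
    (hF : F ∈ pointIdeal p ^ k) : aeval (dehomMap c) F ∈ mI (affOf p c) ^ k := by
  have h1 : pointIdeal p ≤ (mI (affOf p c)).comap (aeval (dehomMap c)) := by
    unfold pointIdeal
    rw [Ideal.span_le]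
    rintro L ⟨hL, h0⟩
    show aeval (dehomMap c) L ∈ mI (affOf p c)
    rw [mem_mI]
    have := dehom_aeval (K := K) c p (affOf p c) (by
      intro i; unfold affOf; field_simp) hL
    simp only [aeval_eq_eval] at this
    rw [h0] at this
    have h2 := this.symm
    rw [mul_eq_zero] at h2
    exact h2.resolve_left (pow_ne_zero _ hpc)
  exact (le_trans (Ideal.pow_right_mono h1 k) (Ideal.le_comap_pow _ k)) hF

lemma shift_mem (a : Fin 2 → K) (k : ℕ) (g : MvPolynomial (Fin 2) K) (hg : g ∈ mI a ^ k) :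
    aeval (fun i => X i + C (a i)) g ∈ idealOfVars (Fin 2) K ^ k := by
  have h1 : mI a ≤ (idealOfVars (Fin 2) K).comap
      (aeval (fun i => (X i + C (a i) : MvPolynomial (Fin 2) K))) := by
    intro g hg
    rw [mem_mI] at hg
    rw [Ideal.mem_comap, ← pow_one (idealOfVars (Fin 2) K), mem_pow_idealOfVars_iff']
    intro x hx
    have : x = 0 := by
      rw [← Finsupp.degree_eq_zero_iff]; omega
    subst this
    rw [← constantCoeff_eq]
    have : ∀ g : MvPolynomial (Fin 2) K, constantCoeff
        (aeval (fun i => (X i + C (a i) : MvPolynomial (Fin 2) K)) g) = eval a g := by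
      intro g
      induction g using MvPolynomial.induction_on with
      | C a => simp [MvPolynomial.algebraMap_eq]
      | add p q hp hq => rw [map_add, map_add, hp, hq, map_add]
      | mul_X p i hp => rw [map_mul, map_mul, hp, map_mul]; simp
    rw [this, hg]
  exact (le_trans (Ideal.pow_right_mono h1 k) (Ideal.le_comap_pow _ k)) hg

/-- restriction of exponents to the chart -/
def exR (c : Fin 3) (u : Fin 3 →₀ ℕ) : Fin 2 →₀ ℕ :=
  Finsupp.equivFunOnFinite.symm (fun i => u (chartEmb c i))

lemma prod_chart {M : Type*} [CommMonoid M] (c : Fin 3) (g : Fin 3 → M) :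
    ∏ j, g j = g c * ∏ i, g (chartEmb c i) := by
  fin_cases c
  · simp [Fin.prod_univ_three, Fin.prod_univ_two, chartEmb, mul_assoc]
  · simp [Fin.prod_univ_three, Fin.prod_univ_two, chartEmb]
    rw [← mul_assoc, mul_comm (g 0)]
  · simp [Fin.prod_univ_three, Fin.prod_univ_two, chartEmb]
    rw [mul_comm]

lemma sum_chart {M : Type*} [AddCommMonoid M] (c : Fin 3) (g : Fin 3 → M) :
    ∑ j, g j = g c + ∑ i, g (chartEmb c i) := by
  fin_cases c
  · simp [Fin.sum_univ_three, Fin.sum_univ_two, chartEmb, add_assoc]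
  · simp [Fin.sum_univ_three, Fin.sum_univ_two, chartEmb]
    rw [← add_assoc, add_comm (g 0)]
  · simp [Fin.sum_univ_three, Fin.sum_univ_two, chartEmb]
    rw [add_comm]

lemma dehom_monomial (c : Fin 3) (u : Fin 3 →₀ ℕ) (r : K) :
    aeval (dehomMap c) (monomial u r) = monomial (exR c u) r := by
  rw [aeval_monomial, monomial_eq, Finsupp.prod_fintype _ _ (by simp),
    Finsupp.prod_fintype _ _ (by simp), prod_chart c]
  simp [dehomMap_self, dehomMap_emb, exR, MvPolynomial.algebraMap_eq]

lemma degree_three (c : Fin 3) (u : Fin 3 →₀ ℕ) : u.degree = u c + (exR c u).degree := by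
  rw [Finsupp.degree_eq_sum, Finsupp.degree_eq_sum, sum_chart c]
  simp [exR]

lemma exR_inj (c : Fin 3) (u v : Fin 3 →₀ ℕ) (hd : u.degree = v.degree) (h : exR c u = exR c v) :
    u = v := by
  rw [degree_three c u, degree_three c v, h] at hd
  have hc : u c = v c := by omega
  ext j
  rcases chart_cases c j with rfl | ⟨i, rfl⟩
  · exact hc
  · exact DFunLike.congr_fun h i

lemma coeff_dehom (c : Fin 3) {G : MvPolynomial (Fin 3) K} {d : ℕ} (hG : G.IsHomogeneous d)
    (u : Fin 3 →₀ ℕ) (hu : u ∈ G.support) :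
    coeff (exR c u) (aeval (dehomMap c) G) = coeff u G := by
  classical
  conv_lhs => rw [← support_sum_monomial_coeff G, map_sum, coeff_sum]
  rw [Finset.sum_eq_single u]
  · rw [dehom_monomial, coeff_monomial, if_pos rfl]
  · intro v hv hne
    rw [dehom_monomial, coeff_monomial, if_neg]
    intro h
    apply hne
    refine exR_inj c v u ?_ h
    rw [Finsupp.degree_eq_sum, Finsupp.degree_eq_sum]
    have h1 := hG.degree_eq_sum_deg_support hu
    have h2 := hG.degree_eq_sum_deg_support hv
    have h3 : ∀ w : Fin 3 →₀ ℕ, ∑ i ∈ w.support, w i = ∑ i, w i := by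
      intro w
      exact Finset.sum_subset (Finset.subset_univ _) (by simp)
    rw [h3] at h1 h2
    omega
  · intro h; exact absurd hu h

/-- translation with sign -/
def trl (c : Fin 3) (a : Fin 3 → K) : MvPolynomial (Fin 3) K →ₐ[K] MvPolynomial (Fin 3) K :=
  aeval (fun j => X j + C (a j) * X c)

lemma dehom_pow_mem_conv (p : Fin 3 → K) {c : Fin 3} (hpc : p c ≠ 0) (k : ℕ)
    {F : MvPolynomial (Fin 3) K} {d : ℕ} (hF : F.IsHomogeneous d)
    (h : aeval (dehomMap c) F ∈ mI (affOf p c) ^ k) : F ∈ pointIdeal p ^ k := by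
  let b : Fin 3 → K := fun j => if j = c then 0 else p j / p c
  have hbc : b c = 0 := by simp [b]
  have hemb : ∀ i, chartEmb c i ≠ c := by
    intro i; fin_cases c <;> fin_cases i <;> simp [chartEmb]
  have hbe : ∀ i, b (chartEmb c i) = affOf p c i := by
    intro i; simp only [b]; rw [if_neg (hemb i)]; rfl
  let G := trl c b F
  have hG : G.IsHomogeneous d := by
    have := hF.aeval (fun j => (X j + C (b j) * X c : MvPolynomial (Fin 3) K)) (n := 1)
      (fun j => (isHomogeneous_X _ _).add (isHomogeneous_C_mul_X _ _))
    rwa [one_mul] at this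
  have hinv : trl c (fun j => - b j) G = F := by
    have : (trl c (fun j => - b j)).comp (trl c b) = AlgHom.id K _ := by
      apply MvPolynomial.algHom_ext
      intro j
      simp [trl, hbc, MvPolynomial.algebraMap_eq]
    exact DFunLike.congr_fun this F
  have hT : aeval (dehomMap c) G = aeval (fun i => X i + C (affOf p c i)) (aeval (dehomMap (K := K) c) F) := by
    have : (aeval (dehomMap (K := K) c)).comp (trl c b) =
        (aeval (fun i => (X i + C (affOf p c i) : MvPolynomial (Fin 2) K))).comp
          (aeval (dehomMap c)) := by
      apply MvPolynomial.algHom_ext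
      intro j
      rcases chart_cases c j with rfl | ⟨i, rfl⟩
      · simp [trl, dehomMap_self, hbc]
      · simp [trl, dehomMap_self, dehomMap_emb, hbe, MvPolynomial.algebraMap_eq]
    exact DFunLike.congr_fun this F
  have hT2 : aeval (dehomMap c) G ∈ idealOfVars (Fin 2) K ^ k := by
    rw [hT]; exact shift_mem _ k _ h
  rw [mem_pow_idealOfVars_iff] at hT2
  rw [← hinv, ← support_sum_monomial_coeff G, map_sum]
  refine Ideal.sum_mem _ fun u hu => ?_
  have hk : k ≤ (exR c u).degree := by
    apply hT2
    rw [mem_support_iff, coeff_dehom c hG u hu]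
    exact mem_support_iff.1 hu
  unfold trl
  rw [aeval_monomial, Finsupp.prod_fintype _ _ (by simp), prod_chart c]
  refine Ideal.mul_mem_left _ _ (Ideal.mul_mem_left _ _ ?_)
  have hl : ∀ i, (X (chartEmb c i) + C (-b (chartEmb c i)) * X c : MvPolynomial (Fin 3) K) ∈
      pointIdeal p := by
    intro i
    refine Ideal.subset_span ⟨(isHomogeneous_X _ _).add (isHomogeneous_C_mul_X _ _), ?_⟩
    rw [hbe]
    simp [affOf]
    field_simp
    ring
  have hd : (exR c u).degree = u (chartEmb c 0) + u (chartEmb c 1) := by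
    rw [Finsupp.degree_eq_sum, Fin.sum_univ_two]; rfl
  refine Ideal.pow_le_pow_right hk ?_
  rw [hd, pow_add, Fin.prod_univ_two]
  exact Ideal.mul_mem_mul (Ideal.pow_mem_pow (hl 0) _) (Ideal.pow_mem_pow (hl 1) _)

lemma mult_two {p : Fin 3 → K} {F : MvPolynomial (Fin 3) K} {d : ℕ} (hF : F.IsHomogeneous d)
    (h : multAt F p = 2) {c : Fin 3} (hpc : p c ≠ 0) :
    aeval (dehomMap c) F ∈ mI (affOf p c) ^ 2 ∧ aeval (dehomMap c) F ∉ mI (affOf p c) ^ 3 := by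
  unfold multAt at h
  have hb : BddAbove { m | F ∈ pointIdeal p ^ m } := by
    by_contra hb
    rw [Nat.sSup_of_not_bddAbove hb] at h
    omega
  have hne : { m | F ∈ pointIdeal p ^ m }.Nonempty := ⟨0, by simp⟩
  have h2 := Nat.sSup_mem hne hb
  rw [h] at h2
  refine ⟨dehom_pow_mem p hpc 2 F h2, fun h3 => ?_⟩
  have := le_csSup hb (show 3 ∈ { m | F ∈ pointIdeal p ^ m } from dehom_pow_mem_conv p hpc 3 hF h3)
  omega

end Mult
end ASing

namespace ASing

section Back
variable {K : Type*} [Field K]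

lemma exists_linFormOf {L : MvPolynomial (Fin 2) K} (hL : L.IsHomogeneous 1) :
    ∃ q, L = linFormOf q := by
  have h : L ∈ homogeneousSubmodule (Fin 2) K 1 := hL
  rw [homogeneousSubmodule_one_eq_span_X, Submodule.mem_span_range_iff_exists_fun] at h
  obtain ⟨c, hc⟩ := h
  refine ⟨![- c 1, c 0], ?_⟩
  rw [← hc]
  simp [linFormOf, Fin.sum_univ_two, smul_eq_C_mul]

lemma exists_smul_of_det {q r : Fin 2 → K} (hq : q ≠ 0) (h : q 1 * r 0 - q 0 * r 1 = 0) :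
    ∃ d : K, r = d • q := by
  obtain ⟨j, hj⟩ : ∃ j, q j ≠ 0 := by
    by_contra hcon
    push Not at hcon
    exact hq (funext hcon)
  refine ⟨r j / q j, ?_⟩
  funext i
  simp only [Pi.smul_apply, smul_eq_mul]
  fin_cases i <;> fin_cases j <;> simp at hj ⊢ <;> field_simp <;>
    first | linear_combination h | linear_combination -h

lemma linFormOf_smul (q : Fin 2 → K) (d : K) : linFormOf (d • q) = C d * linFormOf q := by
  simp [linFormOf]; ring

lemma cross_all {f : Fin 3 → MvPolynomial (Fin 2) K} {p : Fin 3 → K} {D : MvPolynomial (Fin 2) K}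
    (h : ∀ i j : Fin 3, i < j → D ∣ crossDiff f p i j) (i j : Fin 3) : D ∣ crossDiff f p i j := by
  rcases lt_trichotomy i j with hlt | rfl | hlt
  · exact h i j hlt
  · simp [crossDiff]
  · have := h j i hlt
    rw [← dvd_neg] at this
    convert this using 1
    simp [crossDiff]

lemma pre_of_cross {f : Fin 3 → MvPolynomial (Fin 2) K} {p : Fin 3 → K} (hp : p ≠ 0)
    {q : Fin 2 → K} (hfq : evalVec f q ≠ 0) (h : ∀ i j, eval q (crossDiff f p i j) = 0) :
    ∃ lam : K, lam ≠ 0 ∧ evalVec f q = lam • p := by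
  obtain ⟨c, hc⟩ : ∃ c, p c ≠ 0 := by
    by_contra hcon
    push Not at hcon
    exact hp (funext hcon)
  have e : evalVec f q = (eval q (f c) / p c) • p := by
    funext j
    have := h c j
    simp only [crossDiff, map_sub, map_mul, eval_C] at this
    simp only [evalVec, Pi.smul_apply, smul_eq_mul]
    field_simp
    linear_combination this
  refine ⟨_, ?_, e⟩
  intro h0
  rw [h0, zero_smul] at e
  exact hfq e

lemma irr_side {q r : Fin 2 → K} (hqr : q 1 * r 0 - q 0 * r 1 ≠ 0)
    (h : linFormOf q ^ 2 ∣ linFormOf q * linFormOf r) : False := by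
  have hq : q ≠ 0 := by rintro rfl; simp at hqr
  rw [pow_two, mul_dvd_mul_iff_left (linFormOf_ne_zero hq)] at h
  obtain ⟨G, hG⟩ := h
  have := congrArg (eval q) hG
  rw [map_mul, eval_linFormOf, eval_linFormOf] at this
  apply hqr
  linear_combination -this

theorem backward [CharZero K] (n : ℕ) (f : Fin 3 → MvPolynomial (Fin 2) K)
    (hf : IsProperParam n f)
    (F : MvPolynomial (Fin 3) K) (hFhom : F.IsHomogeneous n)
    (hFf : MvPolynomial.aeval f F = 0)
    (p : Fin 3 → K) (hp : p ≠ 0) (hmult : multAt F p = 2)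
    (m : ℕ) (hm : 1 ≤ m) (L₁ L₂ : MvPolynomial (Fin 2) K)
    (h1 : L₁.IsHomogeneous 1) (h2 : L₂.IsHomogeneous 1) (h10 : L₁ ≠ 0) (h20 : L₂ ≠ 0)
    (hprop : ∀ d : K, L₂ ≠ MvPolynomial.C d * L₁) (hgcd : IsGcdOfCross f p (L₁ * L₂))
    (hcm : CurvilinearOfLength (JIdeal f ((L₁ * L₂) ^ m)) p m)
    (hncm : ∀ t : ℕ, m < t → ¬ CurvilinearOfLength (JIdeal f ((L₁ * L₂) ^ t)) p t) :
    IsAsSing F p (2 * m - 1) := by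
  obtain ⟨q, rfl⟩ := exists_linFormOf h1
  obtain ⟨r, rfl⟩ := exists_linFormOf h2
  have hq : q ≠ 0 := by rintro rfl; simp [linFormOf] at h10
  have hr : r ≠ 0 := by rintro rfl; simp [linFormOf] at h20
  have hqr : q 1 * r 0 - q 0 * r 1 ≠ 0 := by
    intro h
    obtain ⟨d, rfl⟩ := exists_smul_of_det hq h
    exact hprop d (linFormOf_smul q d)
  have hall := cross_all hgcd.1
  have hv : ∀ v : Fin 2 → K, v ≠ 0 → eval v (linFormOf q * linFormOf r) = 0 →
      ∃ lam : K, lam ≠ 0 ∧ evalVec f v = lam • p := by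
    intro v hv h0
    refine pre_of_cross hp (hf.no_common_zero v hv) ?_
    intro i j
    obtain ⟨G, hG⟩ := hall i j
    rw [hG, map_mul, h0, zero_mul]
  have htp : TwoPre n f p q r := by
    refine ⟨hf.homog, hqr, hv q hq ?_, hv r hr ?_⟩
    · rw [map_mul, eval_linFormOf]; ring
    · rw [map_mul, eval_linFormOf, eval_linFormOf]; ring
  have hi1 : HImm f p q := by
    by_contra hcon
    simp only [HImm, not_exists, not_not] at hcon
    exact irr_side hqr (hgcd.2 _ (fun i j _ => hcon i j))
  have hi2 : HImm f p r := by
    by_contra hcon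
    simp only [HImm, not_exists, not_not] at hcon
    have := hgcd.2 _ (fun i j _ => hcon i j)
    rw [mul_comm] at this
    exact irr_side htp.symm.indep this
  intro c hpc
  have hF2 := mult_two hFhom hmult hpc
  have hFz : ∀ q r : Fin 2 → K, TwoPre n f p q r → br f c (ln q r) (aeval (dehomMap c) F) = 0 := by
    intro q r h
    have := (br_dvd f c _ (h.const hpc) hFhom 0).2 (by rw [hFf, map_zero])
    exact zero_dvd_iff.1 this
  obtain ⟨e, he⟩ := local_backward (htp.cent hpc) (htp.symm.cent hpc) ((htp.imm_iff hpc).2 hi1)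
    ((htp.symm.imm_iff hpc).2 hi2) m hm
    ((htp.contact_iff hpc m).2 ((htp.curv hi1 hi2 hp m).1 hcm))
    (fun h => hncm (m + 1) (by omega)
      ((htp.curv hi1 hi2 hp (m + 1)).2 ((htp.contact_iff hpc (m + 1)).1 h)))
    (hFz _ _ htp) (hFz _ _ htp.symm) hF2.1 hF2.2
  have hmm : 2 * m - 1 + 1 = 2 * m := by omega
  rw [hmm]
  obtain ⟨e'⟩ := Q_equiv (K := K) m hm
  refine ⟨e.trans e'.symm.toRingEquiv, ?_⟩
  intro x
  have hx := he x
  rw [toComp_apply, ← algebraMap_eq_toLoc] at hx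
  rw [RingEquiv.trans_apply, hx]
  exact e'.symm.commutes x

end Back
end ASing

namespace Polynomial
open scoped Polynomial
variable {K : Type*} [Field K]

lemma asing_exists_eval_ne [Infinite K] {R : K[X]} (hR : R ≠ 0) : ∃ z, R.eval z ≠ 0 := by
  by_contra h
  push Not at h
  exact hR (Polynomial.funext (by simpa using h))

lemma asing_not_const [Infinite K] (g : Fin 3 → K[X]) (c : Fin 3) (S : Finset K)
    (inj : ∀ z w, z ∉ S → w ∉ S →
      (∀ i j, (g i).eval z * (g j).eval w = (g j).eval z * (g i).eval w) → z = w)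
    (lam : Fin 3 → K) (h : ∀ i, g i = C (lam i) * g c) : False := by
  obtain ⟨z, hz⟩ := Infinite.exists_notMem_finset S
  obtain ⟨w, hw⟩ := Infinite.exists_notMem_finset (S.cons z hz)
  have hw' : w ∉ S ∧ w ≠ z := by simp at hw; tauto
  refine hw'.2 (inj z w hz hw'.1 ?_).symm
  intro i j
  rw [h i, h j]
  simp; ring

lemma asing_spec_contra [IsAlgClosed K] (g : Fin 3 → K[X]) (c : Fin 3) (hgc : g c ≠ 0) (S : Finset K)
    (ncz : ∀ z, ∃ i, (g i).eval z ≠ 0)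
    (inj : ∀ z w, z ∉ S → w ∉ S →
      (∀ i j, (g i).eval z * (g j).eval w = (g j).eval z * (g i).eval w) → z = w)
    (ν : (RatFunc K)[X]) (hdeg : ν.natDegree ≠ 0) (hz : ν.eval RatFunc.X ≠ 0)
    (hν : ∀ i, ν ∣ (C (g c) * (g i).map C - C (g i) * (g c).map C : K[X][X]).map
      (algebraMap K[X] (RatFunc K))) : False := by
  have : Infinite K := IsAlgClosed.instInfinite
  have hν0 : ν ≠ 0 := by rintro rfl; simp at hdeg
  let Q : Fin 3 → K[X][X] := fun i => C (g c) * (g i).map C - C (g i) * (g c).map C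
  have hinj : Function.Injective (algebraMap K[X] (RatFunc K)) := RatFunc.algebraMap_injective K
  have key : ∀ p : (RatFunc K)[X], ∃ (b : K[X]) (E : K[X][X]), b ≠ 0 ∧
      E.map (algebraMap K[X] (RatFunc K)) = C (algebraMap K[X] (RatFunc K) b) * p := by
    intro p
    obtain ⟨b, hbM, hb⟩ := IsLocalization.integerNormalization_spec (nonZeroDivisors K[X]) p
    refine ⟨b, _, nonZeroDivisors.ne_zero hbM, hb.trans ?_⟩
    ext k
    rw [coeff_smul, coeff_C_mul, Algebra.smul_def]
  obtain ⟨b, E, hb, hE⟩ := key ν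
  have hν' : ∀ i, ∃ η, (Q i).map (algebraMap K[X] (RatFunc K)) = ν * η := hν
  choose η hη using hν'
  choose b' H hb' hH using fun i => key (η i)
  have hEQ : ∀ i, C (b * b' i) * Q i = E * H i := by
    intro i
    apply Polynomial.map_injective _ hinj
    rw [Polynomial.map_mul, Polynomial.map_mul, hE, hH, map_C, hη i, map_mul, C_mul]
    ring
  have hbm : C (algebraMap K[X] (RatFunc K) b) ≠ 0 := by
    rw [Ne, C_eq_zero]; exact (map_ne_zero_iff _ hinj).2 hb
  have hEdeg : E.natDegree ≠ 0 := by
    rw [← natDegree_map_eq_of_injective hinj, hE, natDegree_C_mul (by simpa using hbm)]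
    exact hdeg
  have hE0 : E ≠ 0 := by rintro rfl; simp at hEdeg
  have hEz : E.eval X ≠ 0 := by
    intro h
    have : (E.map (algebraMap K[X] (RatFunc K))).eval (algebraMap K[X] (RatFunc K) X) = 0 := by
      rw [eval_map_apply, h, map_zero]
    rw [hE, RatFunc.algebraMap_X, eval_mul, eval_C] at this
    rcases mul_eq_zero.1 this with h1 | h1
    · exact (map_ne_zero_iff _ hinj).2 hb h1
    · exact hz h1
  have hQe : ∀ i (u : K), (Q i).eval (C u) = g c * C ((g i).eval u) - g i * C ((g c).eval u) := by
    intro i u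
    simp [Q, eval_map_apply]
  have hEs : ∀ s : K, E.eval (C s) ≠ 0 := by
    intro s hs
    have hq : ∀ i, g c * C ((g i).eval s) - g i * C ((g c).eval s) = 0 := by
      intro i
      rw [← hQe]
      have := congrArg (eval (C s)) (hEQ i)
      rw [eval_mul, eval_mul, hs, zero_mul, eval_C] at this
      exact (mul_eq_zero.1 this).resolve_left (mul_ne_zero hb (hb' i))
    by_cases h0 : (g c).eval s = 0
    · obtain ⟨i, hi⟩ := ncz s
      have := hq i
      rw [h0, C_0, mul_zero, sub_zero] at this
      rcases mul_eq_zero.1 this with h | h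
      · exact hgc h
      · exact hi (C_eq_zero.1 h)
    · refine asing_not_const g c S inj (fun i => (g i).eval s / (g c).eval s) fun i => ?_
      have h1 : C ((g c).eval s) ≠ 0 := by simpa using h0
      apply mul_left_cancel₀ h1
      rw [← mul_assoc, ← C_mul, mul_div_cancel₀ _ h0]
      linear_combination -(hq i)
  obtain ⟨z, hz0⟩ : ∃ z, (b * (∏ i, b' i) * E.leadingCoeff * E.eval X * g c *
      (∏ s ∈ S, (X - C s)) * ∏ s ∈ S, E.eval (C s)).eval z ≠ 0 := by
    apply asing_exists_eval_ne
    refine mul_ne_zero (mul_ne_zero (mul_ne_zero (mul_ne_zero (mul_ne_zero (mul_ne_zero hb ?_) ?_)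
      hEz) hgc) ?_) ?_
    · exact Finset.prod_ne_zero_iff.2 fun i _ => hb' i
    · exact leadingCoeff_ne_zero.2 hE0
    · exact Finset.prod_ne_zero_iff.2 fun i _ => X_sub_C_ne_zero i
    · exact Finset.prod_ne_zero_iff.2 fun i _ => hEs i
  simp only [eval_mul, eval_prod, mul_ne_zero_iff, Finset.prod_ne_zero_iff] at hz0
  obtain ⟨⟨⟨⟨⟨⟨z1, z2⟩, z3⟩, z4⟩, z5⟩, z6⟩, z7⟩ := hz0
  obtain ⟨w, hw⟩ : ∃ w, (E.map (evalRingHom z)).IsRoot w := by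
    apply IsAlgClosed.exists_root
    rw [degree_map_eq_of_leadingCoeff_ne_zero _ (by simpa using z3)]
    intro h
    exact hEdeg (natDegree_eq_of_degree_eq_some h)
  have hEw : (E.eval (C w)).eval z = 0 := by
    have : (E.map (evalRingHom z)).eval (evalRingHom z (C w)) = 0 := by simpa using hw
    rw [eval_map_apply] at this
    simpa using this
  have hzS : z ∉ S := fun h => z6 z h (by simp)
  have hwS : w ∉ S := fun h => z7 w h hEw
  have hq : ∀ i, (g c).eval z * (g i).eval w - (g i).eval z * (g c).eval w = 0 := by
    intro i
    have := congrArg (fun P => eval z (eval (C w) P)) (hEQ i)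
    simp only [eval_mul, hQe, hEw, eval_C, zero_mul, eval_sub] at this
    exact (mul_eq_zero.1 this).resolve_left (mul_ne_zero z1 (z2 i (Finset.mem_univ _)))
  have hzw : z = w := by
    refine inj z w hzS hwS fun i j => ?_
    apply mul_left_cancel₀ z5
    linear_combination (g i).eval z * hq j - (g j).eval z * hq i
  subst hzw
  apply z4
  rw [← hEw]
  have e : ∀ P : K[X][X], (P.eval X).eval z = (P.eval (C z)).eval z := by
    intro P
    induction P using Polynomial.induction_on' with
    | add p q hp hq => simp [hp, hq]
    | monomial n a => simp
  exact e E

end Polynomial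

namespace Polynomial
open scoped Polynomial
variable {K : Type*} [Field K]

lemma asing_mem_adjoin [IsAlgClosed K] [CharZero K] (g : Fin 3 → K[X]) (c : Fin 3) (hgc : g c ≠ 0)
    (S : Finset K)
    (ncz : ∀ z, ∃ i, (g i).eval z ≠ 0)
    (inj : ∀ z w, z ∉ S → w ∉ S →
      (∀ i j, (g i).eval z * (g j).eval w = (g j).eval z * (g i).eval w) → z = w)
    (L : IntermediateField K (RatFunc K))
    (hL : ∀ i, algebraMap K[X] (RatFunc K) (g i) / algebraMap K[X] (RatFunc K) (g c) ∈ L) :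
    (RatFunc.X : RatFunc K) ∈ L := by
  have : Infinite K := IsAlgClosed.instInfinite
  have hinj : Function.Injective (algebraMap K[X] (RatFunc K)) := RatFunc.algebraMap_injective K
  have hgc' : algebraMap K[X] (RatFunc K) (g c) ≠ 0 := (map_ne_zero_iff _ hinj).2 hgc
  let x : Fin 3 → L := fun i => ⟨_, hL i⟩
  have hx : ∀ i, algebraMap L (RatFunc K) (x i) =
      algebraMap K[X] (RatFunc K) (g i) / algebraMap K[X] (RatFunc K) (g c) := fun i => rfl
  let Q' : Fin 3 → L[X] := fun i =>
    (g i).map (algebraMap K L) - C (x i) * (g c).map (algebraMap K L)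
  have hroot : ∀ i, aeval (RatFunc.X : RatFunc K) (Q' i) = 0 := by
    intro i
    have e : ∀ q : K[X], aeval (RatFunc.X : RatFunc K) (q.map (algebraMap K L)) =
        algebraMap K[X] (RatFunc K) q := by
      intro q
      rw [aeval_map_algebraMap, RatFunc.aeval_X_left_eq_algebraMap]
    simp only [Q', map_sub, map_mul, e, aeval_C, hx]
    field_simp
    ring
  obtain ⟨i0, hi0⟩ : ∃ i, Q' i ≠ 0 := by
    by_contra hcon
    push Not at hcon
    obtain ⟨z, hz⟩ := asing_exists_eval_ne hgc
    refine asing_not_const g c S inj (fun i => (g i).eval z / (g c).eval z) fun i => ?_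
    have h1 := congrArg (eval (algebraMap K L z)) (hcon i)
    simp only [Q', eval_sub, eval_mul, eval_map_apply, eval_C, eval_zero] at h1
    have h2 := congrArg (algebraMap L (RatFunc K)) h1
    simp only [map_sub, map_mul, hx, map_zero, ← IsScalarTower.algebraMap_apply K L (RatFunc K)] at h2
    have e : ∀ a : K, algebraMap K (RatFunc K) a = algebraMap K[X] (RatFunc K) (C a) := fun a =>
      by rw [RatFunc.algebraMap_C, RatFunc.algebraMap_eq_C]
    rw [e, e, div_mul_eq_mul_div, sub_eq_zero, eq_div_iff hgc', ← map_mul, ← map_mul] at h2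
    have h3 := hinj h2
    have h4 : C ((g c).eval z) ≠ 0 := by simpa using hz
    apply mul_left_cancel₀ h4
    rw [← mul_assoc, ← C_mul, mul_div_cancel₀ _ hz]
    linear_combination -h3
  have halg : IsAlgebraic L (RatFunc.X : RatFunc K) := ⟨Q' i0, hi0, hroot i0⟩
  have hintg : IsIntegral L (RatFunc.X : RatFunc K) := halg.isIntegral
  by_contra hX
  have hsep : (minpoly L (RatFunc.X : RatFunc K)).Separable := (minpoly.irreducible hintg).separable
  let M := (minpoly L (RatFunc.X : RatFunc K)).map (algebraMap L (RatFunc K))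
  obtain ⟨ν, hν⟩ : (X - C (RatFunc.X : RatFunc K)) ∣ M := by
    rw [dvd_iff_isRoot, IsRoot, eval_map_algebraMap, minpoly.aeval]
  have hM0 : M ≠ 0 := (Polynomial.map_ne_zero (minpoly.ne_zero hintg))
  have hν0 : ν ≠ 0 := by rintro rfl; exact hM0 (by rw [hν, mul_zero])
  refine asing_spec_contra g c hgc S ncz inj ν ?_ ?_ ?_
  · intro h0
    have h1 : M.natDegree = 1 := by
      rw [hν, natDegree_mul (X_sub_C_ne_zero _) hν0, natDegree_X_sub_C, h0]
    rw [natDegree_map] at h1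
    obtain ⟨y, hy⟩ := minpoly.natDegree_eq_one_iff.1 h1
    exact hX (hy ▸ y.2)
  · intro h0
    have h1 := hsep.aeval_derivative_ne_zero (minpoly.aeval L (RatFunc.X : RatFunc K))
    apply h1
    rw [← eval_map_algebraMap, ← derivative_map]
    change eval _ (derivative M) = 0
    rw [hν, derivative_mul]
    simp [h0]
  · intro i
    have h1 : minpoly L (RatFunc.X : RatFunc K) ∣ Q' i := minpoly.dvd _ _ (hroot i)
    have h2 : ν ∣ (Q' i).map (algebraMap L (RatFunc K)) :=
      (Dvd.intro_left _ hν.symm).trans (Polynomial.map_dvd _ h1)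
    refine h2.trans ⟨C (algebraMap K[X] (RatFunc K) (g c)), ?_⟩
    have e : ∀ q : K[X], (q.map C).map (algebraMap K[X] (RatFunc K)) =
        q.map (algebraMap K (RatFunc K)) := by
      intro q
      rw [Polynomial.map_map]
      congr 1
    have e2 : ∀ q : K[X], (q.map (algebraMap K L)).map (algebraMap L (RatFunc K)) =
        q.map (algebraMap K (RatFunc K)) := by
      intro q
      rw [Polynomial.map_map]
      congr 1
    simp only [Q', Polynomial.map_sub, Polynomial.map_mul, e, e2, map_C, hx]
    rw [sub_mul, mul_right_comm, ← C_mul, div_mul_cancel₀ _ hgc']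
    ring

end Polynomial

namespace ASing
section Bir
variable {K : Type*} [Field K]

lemma projMap_mk {n : ℕ} {f : Fin 3 → MvPolynomial (Fin 2) K} (hf : IsProperParam n f)
    (v : Fin 2 → K) (hv : v ≠ 0) :
    projMap f (Projectivization.mk K v hv) =
      Projectivization.mk K (evalVec f v) (hf.no_common_zero v hv) := by
  have h : evalVec f (Projectivization.mk K v hv).rep ≠ 0 :=
    hf.no_common_zero _ (Projectivization.rep_nonzero _)
  unfold projMap
  rw [dif_pos h, Projectivization.mk_eq_mk_iff']
  obtain ⟨a, ha⟩ := Projectivization.exists_smul_eq_mk_rep K v hv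
  refine ⟨(a : K) ^ n, ?_⟩
  rw [← ha]
  funext u
  have := eval_smul_homog (hf.homog u) (a : K) v
  simp only [evalVec, Pi.smul_apply, smul_eq_mul]
  rw [← this]
  rfl

lemma zvec_ne (z : K) : (![z, 1] : Fin 2 → K) ≠ 0 := fun h => one_ne_zero (congrFun h 1)

lemma aff_inj {n : ℕ} {f : Fin 3 → MvPolynomial (Fin 2) K} (hf : IsProperParam n f) :
    ∃ S : Finset K, ∀ z w, z ∉ S → w ∉ S →
      (∀ i j, eval ![z, 1] (f i) * eval ![w, 1] (f j) = eval ![z, 1] (f j) * eval ![w, 1] (f i)) →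
      z = w := by
  obtain ⟨S, hS, hinj⟩ := hf.gen_injective
  let φ : K → Projectivization K (Fin 2 → K) := fun z => Projectivization.mk K ![z, 1] (zvec_ne z)
  have hφ : Function.Injective φ := by
    intro z w h
    obtain ⟨a, ha⟩ := (Projectivization.mk_eq_mk_iff' K _ _ _ _).1 h
    have h1 := congrFun ha 1
    have h0 := congrFun ha 0
    simp at h1 h0
    rw [h1, one_mul] at h0
    exact h0.symm
  have hfin : (φ ⁻¹' S).Finite := hS.preimage hφ.injOn
  refine ⟨hfin.toFinset, fun z w hz hw h => ?_⟩
  have hz' : φ z ∈ Sᶜ := by simpa using hz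
  have hw' : φ w ∈ Sᶜ := by simpa using hw
  refine hφ (hinj hz' hw' ?_)
  change projMap f (Projectivization.mk K _ _) = projMap f (Projectivization.mk K _ _)
  rw [projMap_mk hf, projMap_mk hf, Projectivization.mk_eq_mk_iff']
  obtain ⟨j, hj⟩ : ∃ j, eval ![w, 1] (f j) ≠ 0 := by
    by_contra hcon
    push Not at hcon
    exact hf.no_common_zero _ (zvec_ne w) (funext hcon)
  refine ⟨eval ![z, 1] (f j) / eval ![w, 1] (f j), ?_⟩
  funext i
  simp only [evalVec, Pi.smul_apply, smul_eq_mul]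
  have := h i j
  field_simp
  linear_combination -this

lemma eval_dehom (z : K) (H : MvPolynomial (Fin 2) K) :
    Polynomial.eval z (aeval ![(Polynomial.X : Polynomial K), 1] H) = eval ![z, 1] H := by
  induction H using MvPolynomial.induction_on with
  | C a => simp
  | add p q hp hq => simp [hp, hq]
  | mul_X p i hp =>
    rw [map_mul, Polynomial.eval_mul, hp, map_mul, aeval_X, eval_X]
    fin_cases i <;> simp

lemma eq_zero_of_dehom [Infinite K] {H : MvPolynomial (Fin 2) K} {d : ℕ} (hH : H.IsHomogeneous d)
    (h : aeval ![(Polynomial.X : Polynomial K), 1] H = 0) : H = 0 := by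
  have e : ∀ z : K, eval ![z, 1] H = 0 := by
    intro z
    rw [← eval_dehom, h, Polynomial.eval_zero]
  have : H * X 1 = 0 := by
    apply MvPolynomial.funext
    intro v
    by_cases hv : v 1 = 0
    · simp [hv]
    · have hvv : v = v 1 • ![v 0 / v 1, 1] := by
        funext i; fin_cases i
        · simp; field_simp
        · simp
      rw [hvv, map_mul, eval_smul_homog hH, e]; simp
  exact (mul_eq_zero.1 this).resolve_right (X_ne_zero 1)

lemma bir [IsAlgClosed K] [CharZero K] {n : ℕ} {f : Fin 3 → MvPolynomial (Fin 2) K}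
    (hf : IsProperParam n f) :
    ∃ (d : ℕ) (A B : MvPolynomial (Fin 3) K), A.IsHomogeneous d ∧ B.IsHomogeneous d ∧
      X 1 * aeval f A = X 0 * aeval f B ∧ aeval f B ≠ 0 := by
  have : Infinite K := IsAlgClosed.instInfinite
  obtain ⟨g, hgf⟩ : ∃ g : Fin 3 → Polynomial K,
      g = fun i => aeval ![(Polynomial.X : Polynomial K), 1] (f i) := ⟨_, rfl⟩
  have hg : ∀ (z : K) (i), Polynomial.eval z (g i) = eval ![z, 1] (f i) := by
    intro z i
    rw [hgf]; exact eval_dehom z _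
  obtain ⟨S, hS⟩ := aff_inj hf
  have ncz : ∀ z, ∃ i, (g i).eval z ≠ 0 := by
    intro z
    by_contra hcon
    push Not at hcon
    exact hf.no_common_zero _ (zvec_ne z) (funext fun i => (hg z i).symm.trans (hcon i))
  obtain ⟨c, hc⟩ := ncz 0
  have hgc : g c ≠ 0 := fun h => hc (by rw [h]; exact Polynomial.eval_zero)
  let w : Fin 3 → RatFunc K := fun j => algebraMap (Polynomial K) (RatFunc K) (g j)
  have hinj : Function.Injective (algebraMap (Polynomial K) (RatFunc K)) :=
    RatFunc.algebraMap_injective K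
  have hwc : w c ≠ 0 := (map_ne_zero_iff _ hinj).2 hgc
  let x : Fin 2 → RatFunc K := fun i => w (chartEmb c i) / w c
  have hmem := Polynomial.asing_mem_adjoin g c hgc S ncz
    (fun z w hz hw h => hS z w hz hw (by simpa only [hg] using h))
    (IntermediateField.adjoin K (Set.range x)) (by
      intro j
      rcases chart_cases c j with rfl | ⟨i, rfl⟩
      · rw [div_self hwc]; exact one_mem _
      · exact IntermediateField.subset_adjoin _ _ ⟨i, rfl⟩)
  obtain ⟨r, s, hrs⟩ := (IntermediateField.mem_adjoin_range_iff K x _).1 hmem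
  have hs0 : aeval x s ≠ 0 := by
    intro h; rw [h, div_zero] at hrs; exact RatFunc.X_ne_zero hrs
  rw [eq_div_iff hs0] at hrs
  obtain ⟨d1, R, hR, hR'⟩ := exists_homogenize c r
  obtain ⟨d2, T, hT, hT'⟩ := exists_homogenize c s
  have hA : (R * X c ^ d2).IsHomogeneous (d1 + d2) :=
    hR.mul (by simpa using (isHomogeneous_X K c).pow d2)
  have hB : (T * X c ^ d1).IsHomogeneous (d1 + d2) := by
    rw [add_comm]
    exact hT.mul (by simpa using (isHomogeneous_X K c).pow d1)
  have hw : ∀ i, w (chartEmb c i) = w c * x i := fun i => (mul_div_cancel₀ _ hwc).symm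
  have eA : aeval w (R * X c ^ d2) = w c ^ (d1 + d2) * aeval x r := by
    rw [dehom_aeval c w x hw hA, map_mul (aeval (dehomMap (K := K) c)), hR']
    simp [dehomMap_self]
  have eB : aeval w (T * X c ^ d1) = w c ^ (d1 + d2) * aeval x s := by
    rw [dehom_aeval c w x hw hB, map_mul (aeval (dehomMap (K := K) c)), hT']
    simp [dehomMap_self]
  have ew : ∀ h : MvPolynomial (Fin 3) K, aeval w h =
      algebraMap (Polynomial K) (RatFunc K) (aeval ![(Polynomial.X : Polynomial K), 1] (aeval f h)) := by
    intro h
    rw [aeval_aeval]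
    have : (fun j => aeval ![(Polynomial.X : Polynomial K), 1] (f j)) = g := hgf.symm
    rw [this]
    exact aeval_algebraMap_apply _ _ _
  obtain ⟨A, hAe⟩ : ∃ A, A = R * X c ^ d2 := ⟨_, rfl⟩
  obtain ⟨B, hBe⟩ : ∃ B, B = T * X c ^ d1 := ⟨_, rfl⟩
  rw [← hAe] at hA eA
  rw [← hBe] at hB eB
  refine ⟨d1 + d2, _, _, hA, hB, ?_, ?_⟩
  · have h1 := ((isHomogeneous_X K (1 : Fin 2)).mul (hA.aeval f hf.homog)).sub
      ((isHomogeneous_X K (0 : Fin 2)).mul (hB.aeval f hf.homog))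
    rw [← sub_eq_zero]
    refine eq_zero_of_dehom h1 (hinj ?_)
    rw [map_sub, map_mul, map_mul, map_sub, map_mul, map_mul, ← ew, ← ew, eA, eB, ← hrs]
    have e1 : aeval ![(Polynomial.X : Polynomial K), 1] (X 1 : MvPolynomial (Fin 2) K) = 1 := by
      simp
    have e0 : aeval ![(Polynomial.X : Polynomial K), 1] (X 0 : MvPolynomial (Fin 2) K) =
      Polynomial.X := by simp
    rw [e1, e0, RatFunc.algebraMap_X, map_one, map_zero]
    ring
  · intro h
    have := ew B
    rw [h, eB] at this
    simp [hwc, hs0] at this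

end Bir
end ASing

namespace ASing
section Ker
variable {K : Type*} [Field K]

lemma exists_form_zero [IsAlgClosed K] {G : MvPolynomial (Fin 2) K} {n : ℕ} (hn : n ≠ 0)
    (hG : G.IsHomogeneous n) : ∃ v : Fin 2 → K, v ≠ 0 ∧ eval v G = 0 := by
  have : Infinite K := IsAlgClosed.instInfinite
  by_cases h : ∃ z, (aeval ![(Polynomial.X : Polynomial K), 1] G).IsRoot z
  · obtain ⟨z, hz⟩ := h
    exact ⟨_, zvec_ne z, by rw [← eval_dehom]; exact hz⟩
  · obtain ⟨k, hk⟩ : ∃ k, aeval ![(Polynomial.X : Polynomial K), 1] G = Polynomial.C k := by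
      by_contra hcon
      apply h
      apply IsAlgClosed.exists_root
      intro hd
      exact hcon ⟨_, Polynomial.eq_C_of_degree_eq_zero hd⟩
    have h1 : G - C k * X 1 ^ n = 0 := by
      refine eq_zero_of_dehom (d := n) (hG.sub ?_) ?_
      · simpa using (isHomogeneous_C (Fin 2) k).mul ((isHomogeneous_X K (1 : Fin 2)).pow n)
      · rw [map_sub, hk]; simp
    refine ⟨![1, 0], fun h => one_ne_zero (congrFun h 0), ?_⟩
    rw [sub_eq_zero.1 h1]
    simp [hn]

lemma sub_dvd_aux (c : Fin 3) (F : MvPolynomial (Fin 3) K) :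
    X c ∣ F - aeval (fun j => if j = c then 0 else X j : Fin 3 → MvPolynomial (Fin 3) K) F := by
  rw [← Ideal.mem_span_singleton, ← Ideal.Quotient.eq]
  set I := Ideal.span {(X c : MvPolynomial (Fin 3) K)}
  have h1 : ((Ideal.Quotient.mkₐ K I).comp
      (aeval (fun j => if j = c then 0 else X j : Fin 3 → MvPolynomial (Fin 3) K))) =
      Ideal.Quotient.mkₐ K I := by
    apply MvPolynomial.algHom_ext
    intro j
    by_cases hj : j = c
    · subst hj
      simp
      symm
      rw [Ideal.Quotient.eq_zero_iff_mem]
      exact Ideal.mem_span_singleton_self _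
    · simp [hj]
  exact (congrArg (fun φ => φ F) h1).symm

lemma fc_ne_zero [IsAlgClosed K] {n : ℕ} (hn : 3 ≤ n) {f : Fin 3 → MvPolynomial (Fin 2) K}
    (hf : IsProperParam n f)
    {F : MvPolynomial (Fin 3) K} (hFirr : Irreducible F) (hFhom : F.IsHomogeneous n)
    (hFf : MvPolynomial.aeval f F = 0) (c : Fin 3) : f c ≠ 0 := by
  have : Infinite K := IsAlgClosed.instInfinite
  intro hc
  have hv0 : ∀ v : Fin 3 → K, v c = 0 → eval v F = 0 := by
    intro v hvc
    obtain ⟨u, hu, hu0⟩ := exists_form_zero (n := n) (by omega)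
      (G := C (v (chartEmb c 1)) * f (chartEmb c 0) - C (v (chartEmb c 0)) * f (chartEmb c 1))
      (((by simpa using (isHomogeneous_C (Fin 2) _).mul (hf.homog _)) :
        IsHomogeneous _ n).sub (by simpa using (isHomogeneous_C (Fin 2) _).mul (hf.homog _)))
    simp only [map_sub, map_mul, eval_C] at hu0
    have hFu : eval (evalVec f u) F = 0 := by
      have : eval u (aeval f F) = 0 := by rw [hFf, map_zero]
      rw [← aeval_eq_eval, aeval_aeval] at this
      simp only [aeval_eq_eval] at this
      exact this
    obtain ⟨j, hj⟩ : ∃ j, evalVec f u j ≠ 0 := by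
      by_contra hcon
      push Not at hcon
      exact hf.no_common_zero u hu (funext hcon)
    have hvu : v = (v j / evalVec f u j) • evalVec f u := by
      funext i
      simp only [Pi.smul_apply, smul_eq_mul]
      rw [div_mul_eq_mul_div, eq_div_iff hj]
      simp only [evalVec] at hj ⊢
      rcases chart_cases c i with rfl | ⟨i, rfl⟩
      · rw [hvc, hc]; simp
      rcases chart_cases c j with rfl | ⟨j, rfl⟩
      · exact absurd (by rw [hc]; simp) hj
      fin_cases i <;> fin_cases j <;> simp <;> first | linear_combination hu0 | linear_combination -hu0
    rw [hvu, eval_smul_homog hFhom, hFu, mul_zero]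
  have h1 : aeval (fun j => if j = c then 0 else X j : Fin 3 → MvPolynomial (Fin 3) K) F = 0 := by
    apply MvPolynomial.funext
    intro v
    rw [map_zero, ← hv0 (fun j => if j = c then 0 else v j) (by simp)]
    have : ((aeval v : MvPolynomial (Fin 3) K →ₐ[K] K).comp
      (aeval (fun j => if j = c then 0 else X j : Fin 3 → MvPolynomial (Fin 3) K))) =
      aeval (fun j => if j = c then 0 else v j) := by
      apply MvPolynomial.algHom_ext
      intro j
      by_cases hj : j = c <;> simp [hj]
    have h2 := congrArg (fun φ => φ F) this
    simpa [aeval_eq_eval] using h2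
  have h2 := sub_dvd_aux c F
  rw [h1, sub_zero] at h2
  obtain ⟨u, hu⟩ := h2
  have hXu : ¬ IsUnit (X c : MvPolynomial (Fin 3) K) := (MvPolynomial.X_prime (i := c)).not_isUnit
  have huu := (hFirr.isUnit_or_isUnit hu).resolve_left hXu
  obtain ⟨k, -, hk⟩ := (MvPolynomial.isUnit_iff_eq_C_of_isReduced).1 huu
  have : F.IsHomogeneous 1 := by
    rw [hu, hk, mul_comm]
    exact isHomogeneous_C_mul_X _ _
  have := this.inj_right hFhom hFirr.ne_zero
  omega

lemma dehom_eq [Infinite K] (c : Fin 3) {h h' : MvPolynomial (Fin 3) K} {d d' : ℕ}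
    (hh : h.IsHomogeneous d) (hh' : h'.IsHomogeneous d')
    (e : aeval (dehomMap (K := K) c) h = aeval (dehomMap (K := K) c) h') :
    X c ^ d' * h = X c ^ d * h' := by
  have hX : (X c : MvPolynomial (Fin 3) K) ≠ 0 := X_ne_zero c
  apply mul_left_cancel₀ hX
  apply MvPolynomial.funext
  intro v
  by_cases hv : v c = 0
  · simp [hv]
  have hw : ∀ i, v (chartEmb c i) = v c * (v (chartEmb c i) / v c) := fun i =>
    (mul_div_cancel₀ _ hv).symm
  have h1 := dehom_aeval c v _ hw hh
  have h2 := dehom_aeval c v _ hw hh'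
  rw [← e] at h2
  rw [aeval_eq_eval] at h1 h2
  simp only [map_mul, map_pow, eval_X]
  have h1' : eval v h = _ := h1
  have h2' : eval v h' = _ := h2
  rw [h1', h2']
  ring

lemma prime_eq_of_lt {G : MvPolynomial (Fin 2) K} (hG : Prime G) {q m : Ideal (MvPolynomial (Fin 2) K)}
    (hq : q.IsPrime) (hm : m.IsPrime) (hGq : G ∈ q) (hqm : q < m) : q = Ideal.span {G} := by
  by_contra hne
  have hGp : (Ideal.span {G}).IsPrime := (Ideal.span_singleton_prime hG.ne_zero).2 hG
  have h1 : (⊥ : Ideal (MvPolynomial (Fin 2) K)) < Ideal.span {G} := by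
    rw [bot_lt_iff_ne_bot, Ne, Ideal.span_singleton_eq_bot]; exact hG.ne_zero
  have h2 : Ideal.span {G} < q :=
    lt_of_le_of_ne ((Ideal.span_singleton_le_iff_mem _).2 hGq) (Ne.symm hne)
  have hb : (⊥ : Ideal (MvPolynomial (Fin 2) K)).IsPrime := Ideal.isPrime_bot
  let s : LTSeries (PrimeSpectrum (MvPolynomial (Fin 2) K)) :=
    LTSeries.mk 3 ![⟨⊥, hb⟩, ⟨_, hGp⟩, ⟨q, hq⟩, ⟨m, hm⟩] (by
      rw [Fin.strictMono_iff_lt_succ]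
      intro i
      fin_cases i
      · exact h1
      · exact h2
      · exact hqm)
  have h3 : ((3 : ℕ) : WithBot ℕ∞) ≤ ringKrullDim (MvPolynomial (Fin 2) K) :=
    Order.LTSeries.length_le_krullDim s
  rw [MvPolynomial.ringKrullDim_of_isNoetherianRing, ringKrullDim_eq_zero_of_field] at h3
  have h4 : ((3 : ℕ) : WithBot ℕ∞) ≤ ((2 : ℕ) : WithBot ℕ∞) := by simpa using h3
  have := WithBot.coe_le_coe.1 h4
  have := ENat.natCast_le_natCast.1 this
  omega

end Ker
end ASing

namespace ASing
section Ker2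
variable {K : Type*} [Field K]

lemma dehom_prime [Infinite K] {n : ℕ} {F : MvPolynomial (Fin 3) K} (hFirr : Irreducible F)
    (hFhom : F.IsHomogeneous n) (c : Fin 3) (hXc : ¬ F ∣ X c)
    (hnu : ¬ IsUnit (aeval (dehomMap (K := K) c) F)) : Prime (aeval (dehomMap (K := K) c) F) := by
  have hX : (X c : MvPolynomial (Fin 3) K) ≠ 0 := X_ne_zero c
  refine ⟨?_, hnu, ?_⟩
  · intro h
    have := dehom_eq c hFhom (isHomogeneous_zero (Fin 3) K 0) (by rw [h, map_zero])
    simp only [pow_zero, one_mul, mul_zero] at this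
    exact hFirr.ne_zero this
  · intro g h ⟨k, hk⟩
    obtain ⟨d1, G, hG, rfl⟩ := exists_homogenize c g
    obtain ⟨d2, H, hH, rfl⟩ := exists_homogenize c h
    obtain ⟨d3, M, hM, rfl⟩ := exists_homogenize c k
    have := dehom_eq c (hG.mul hH) (hFhom.mul hM) (by rw [map_mul, map_mul, hk])
    have hd : F ∣ X c ^ (n + d3) * (G * H) := by
      rw [this]
      exact ((dvd_mul_right F M).mul_left _)
    have hFp := hFirr.prime
    rcases hFp.dvd_or_dvd hd with h1 | h1
    · exact absurd (hFp.dvd_of_dvd_pow h1) hXc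
    · rcases hFp.dvd_or_dvd h1 with h2 | h2
      · left; exact map_dvd _ h2
      · right; exact map_dvd _ h2

/-- A homogeneous polynomial vanishes on the curve iff its dehomogenization is a multiple of that
of the implicit equation. -/
lemma dehom_dvd_iff [IsAlgClosed K] {n : ℕ} (hn : 3 ≤ n) {f : Fin 3 → MvPolynomial (Fin 2) K}
    (hf : IsProperParam n f)
    {F : MvPolynomial (Fin 3) K} (hFirr : Irreducible F) (hFhom : F.IsHomogeneous n)
    (hFf : MvPolynomial.aeval f F = 0) (c : Fin 3)
    (hnu : ¬ IsUnit (aeval (dehomMap (K := K) c) F)) :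
    Prime (aeval (dehomMap (K := K) c) F) ∧
    ∀ (h : MvPolynomial (Fin 3) K) (d : ℕ), h.IsHomogeneous d →
      (aeval (dehomMap (K := K) c) F ∣ aeval (dehomMap (K := K) c) h ↔ aeval f h = 0) := by
  have : Infinite K := IsAlgClosed.instInfinite
  have hfc : f c ≠ 0 := fc_ne_zero hn hf hFirr hFhom hFf c
  have hprime : Prime (aeval (dehomMap (K := K) c) F) := by
    refine dehom_prime hFirr hFhom c ?_ hnu
    rintro ⟨u, hu⟩
    apply hfc
    have := congrArg (aeval f) hu
    rwa [aeval_X, map_mul, hFf, zero_mul] at this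
  refine ⟨hprime, ?_⟩
  let Fr := FractionRing (MvPolynomial (Fin 2) K)
  have hinj : Function.Injective (algebraMap (MvPolynomial (Fin 2) K) Fr) :=
    IsFractionRing.injective _ _
  let w : Fin 3 → Fr := fun j => algebraMap _ Fr (f j)
  have hwc : w c ≠ 0 := (map_ne_zero_iff _ hinj).2 hfc
  let x : Fin 2 → Fr := fun i => w (chartEmb c i) / w c
  have hw : ∀ i, w (chartEmb c i) = w c * x i := fun i => (mul_div_cancel₀ _ hwc).symm
  have hx : ∀ (h : MvPolynomial (Fin 3) K) (d : ℕ), h.IsHomogeneous d →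
      (aeval x (aeval (dehomMap (K := K) c) h) = 0 ↔ aeval f h = 0) := by
    intro h d hh
    have h1 := dehom_aeval c w x hw hh
    have h2 : aeval w h = algebraMap _ Fr (aeval f h) := aeval_algebraMap_apply _ _ _
    rw [h2] at h1
    rw [← map_eq_zero_iff _ hinj, h1]
    simp [hwc]
  let q : Ideal (MvPolynomial (Fin 2) K) := RingHom.ker (aeval x : MvPolynomial (Fin 2) K →ₐ[K] Fr)
  have hq : q.IsPrime := RingHom.ker_isPrime _
  obtain ⟨v, hv⟩ : ∃ v, eval v (f c) ≠ 0 := by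
    by_contra hcon
    push Not at hcon
    exact hfc (MvPolynomial.funext (by simpa using hcon))
  let b : Fin 2 → K := fun i => eval v (f (chartEmb c i)) / eval v (f c)
  have hle : q ≤ mI b := by
    intro g hg
    obtain ⟨d, G, hG, rfl⟩ := exists_homogenize c g
    have h1 : aeval f G = 0 := (hx G d hG).1 hg
    have h2 := dehom_aeval c (fun j => eval v (f j)) b
      (fun i => (mul_div_cancel₀ _ hv).symm) hG
    have h3 : aeval v (aeval f G) = 0 := by rw [h1, map_zero]
    rw [aeval_aeval] at h3
    simp only [aeval_eq_eval] at h3 h2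
    rw [mem_mI]
    have h4 : eval v (f c) ^ d * eval b (aeval (dehomMap (K := K) c) G) = 0 := h2.symm.trans h3
    exact (mul_eq_zero.1 h4).resolve_left (pow_ne_zero _ hv)
  have hne : q ≠ mI b := by
    intro he
    obtain ⟨u, hu, hu0⟩ := exists_form_zero (n := n) (by omega) (hf.homog c)
    apply hf.no_common_zero u hu
    funext j
    rcases chart_cases c j with rfl | ⟨i, rfl⟩
    · exact hu0
    · have h1 : (X i - C (b i) : MvPolynomial (Fin 2) K) ∈ q := by
        rw [he, mem_mI]; simp
      have h2 : aeval x (X i - C (b i) : MvPolynomial (Fin 2) K) = 0 := h1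
      rw [map_sub, aeval_X, algHom_C, sub_eq_zero, div_eq_iff hwc] at h2
      have h3 : f (chartEmb c i) = C (b i) * f c := by
        apply hinj
        rw [map_mul]
        exact h2
      change eval u (f (chartEmb c i)) = 0
      rw [h3, map_mul, hu0, mul_zero]
  have hFq : aeval (dehomMap (K := K) c) F ∈ q := (hx F n hFhom).2 hFf
  have hqe := prime_eq_of_lt hprime hq (kerEvalMaximal b).isPrime hFq (lt_of_le_of_ne hle hne)
  intro h d hh
  rw [← hx h d hh, ← Ideal.mem_span_singleton, ← hqe]
  rfl

end Ker2
end ASing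

namespace ASing
section Lift
variable {K : Type*} [Field K]

lemma primitive_pair (N : ℕ) : ∀ α β : PowerSeries K, ¬ zz K ^ N ∣ β →
    ∃ (k : ℕ) (σ : Fin 2 → PowerSeries K), α = zz K ^ k * σ 0 ∧ β = zz K ^ k * σ 1 ∧
      (fun i => PowerSeries.constantCoeff (σ i)) ≠ 0 := by
  induction N with
  | zero => intro α β h; simp at h
  | succ N ih =>
    intro α β h
    by_cases h0 : PowerSeries.constantCoeff α = 0 ∧ PowerSeries.constantCoeff β = 0
    · obtain ⟨α', rfl⟩ := PowerSeries.X_dvd_iff.2 h0.1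
      obtain ⟨β', rfl⟩ := PowerSeries.X_dvd_iff.2 h0.2
      have hb : ¬ zz K ^ N ∣ β' := fun hd => h (by
        rw [pow_succ']; exact mul_dvd_mul_left _ hd)
      obtain ⟨k, σ, h1, h2, h3⟩ := ih α' β' hb
      refine ⟨k + 1, σ, ?_, ?_, h3⟩
      · rw [h1, pow_succ']; ring
      · rw [h2, pow_succ']; ring
    · refine ⟨0, ![α, β], by simp, by simp, fun h' => h0 ⟨?_, ?_⟩⟩
      · simpa using congrFun h' 0
      · simpa using congrFun h' 1

lemma aeval_ln_inj {q r : Fin 2 → K} (hqr : q 1 * r 0 - q 0 * r 1 ≠ 0)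
    {H : MvPolynomial (Fin 2) K} {d : ℕ} (hH : H.IsHomogeneous d)
    (h : aeval (ln q r) H = 0) : H = 0 := by
  by_contra hne
  have hq : q ≠ 0 := by rintro rfl; simp at hqr
  have hu : ¬ IsUnit (linFormOf q) := by
    intro hu
    have := hu.map (eval q)
    rw [eval_linFormOf] at this
    apply this.ne_zero
    ring
  have hfin : FiniteMultiplicity (linFormOf q) H := FiniteMultiplicity.of_not_isUnit hu hne
  obtain ⟨t, ht⟩ := hfin
  exact ht ((pow_dvd_iff hqr _ hH).2 (by rw [h]; exact dvd_zero _))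

variable [IsAlgClosed K] {n : ℕ} {f : Fin 3 → MvPolynomial (Fin 2) K}

lemma lift_sigma (hn : 3 ≤ n) (hf : IsProperParam n f)
    {F : MvPolynomial (Fin 3) K} (hFirr : Irreducible F) (hFhom : F.IsHomogeneous n)
    (hFf : MvPolynomial.aeval f F = 0) (c : Fin 3) {a : Fin 2 → K}
    {d : ℕ} {A B : MvPolynomial (Fin 3) K} (hA : A.IsHomogeneous d) (hB : B.IsHomogeneous d)
    (hAB : X 1 * aeval f A = X 0 * aeval f B) (hB0 : aeval f B ≠ 0)
    {ψ : MvPolynomial (Fin 2) K →ₐ[K] PowerSeries K} (hc : Cent a ψ) (hi : Imm a ψ)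
    (hψ : ψ (aeval (dehomMap (K := K) c) F) = 0) :
    ∃ (k : ℕ) (σ : Fin 2 → PowerSeries K), ψ (aeval (dehomMap (K := K) c) A) = zz K ^ k * σ 0 ∧
      ψ (aeval (dehomMap (K := K) c) B) = zz K ^ k * σ 1 ∧
      (fun i => PowerSeries.constantCoeff (σ i)) ≠ 0 ∧
      ∀ i, aeval σ (f (chartEmb c i)) = aeval σ (f c) * ψ (X i) := by
  have hnu : ¬ IsUnit (aeval (dehomMap (K := K) c) F) := by
    intro h
    have := h.map ψ
    rw [hψ] at this
    exact not_isUnit_zero this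
  obtain ⟨hprime, hdvd⟩ := dehom_dvd_iff hn hf hFirr hFhom hFf c hnu
  have hker : RingHom.ker ψ = Ideal.span {aeval (dehomMap (K := K) c) F} := by
    refine prime_eq_of_lt hprime (RingHom.ker_isPrime _) (kerEvalMaximal a).isPrime hψ
      (lt_of_le_of_ne ?_ ?_)
    · intro g hg
      rw [← hc.dvd_iff]
      have : ψ g = 0 := hg
      rw [this]; exact dvd_zero _
    · intro he
      obtain ⟨g, hg, hg1⟩ := hi
      have hg' : g ∈ RingHom.ker ψ := by rw [he]; exact hg
      have : ψ g = 0 := hg'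
      rw [this] at hg1
      simp at hg1
  have hzero : ∀ (h : MvPolynomial (Fin 3) K) (e : ℕ), h.IsHomogeneous e →
      (ψ (aeval (dehomMap (K := K) c) h) = 0 ↔ aeval f h = 0) := by
    intro h e hh
    rw [← hdvd h e hh, ← Ideal.mem_span_singleton, ← hker]
    rfl
  have hβ : ψ (aeval (dehomMap (K := K) c) B) ≠ 0 := fun h => hB0 ((hzero B d hB).1 h)
  obtain ⟨N, hN⟩ : ∃ N, ¬ zz K ^ N ∣ ψ (aeval (dehomMap (K := K) c) B) := by
    have hX : ¬ IsUnit (zz K) := PowerSeries.X_prime.not_isUnit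
    obtain ⟨t, ht⟩ := FiniteMultiplicity.of_not_isUnit hX hβ
    exact ⟨_, ht⟩
  obtain ⟨k, σ, h1, h2, h3⟩ := primitive_pair N (ψ (aeval (dehomMap (K := K) c) A)) _ hN
  refine ⟨k, σ, h1, h2, h3, fun i => ?_⟩
  -- common factor
  obtain ⟨u, hu⟩ : (X 0 : MvPolynomial (Fin 2) K) ∣ aeval f A := by
    have hp : Prime (X 0 : MvPolynomial (Fin 2) K) := MvPolynomial.X_prime
    refine (hp.dvd_or_dvd ⟨_, hAB⟩).resolve_left ?_
    rw [MvPolynomial.X_dvd_X]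
    simp
  have hu' : aeval f B = X 1 * u := by
    apply mul_left_cancel₀ (X_ne_zero (0 : Fin 2) : (X 0 : MvPolynomial (Fin 2) K) ≠ 0)
    rw [← hAB, hu]; ring
  have hAf : (fun j => aeval f ((![A, B] : Fin 2 → MvPolynomial (Fin 3) K) j)) =
      fun j => u * X j := by
    funext j
    fin_cases j
    · exact hu.trans (mul_comm _ _)
    · exact hu'.trans (mul_comm _ _)
  have hfAB : ∀ j, aeval f (aeval ![A, B] (f j)) = u ^ n * f j := by
    intro j
    rw [← AlgHom.comp_apply, comp_aeval, hAf, aeval_mul_homog (hf.homog j)]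
    simp
  have hABh : ∀ j, (aeval ![A, B] (f j)).IsHomogeneous (d * n) := by
    intro j
    refine (hf.homog j).aeval _ ?_
    intro l
    fin_cases l
    · exact hA
    · exact hB
  have hN0 := (hzero (aeval ![A, B] (f (chartEmb c i)) * X c - aeval ![A, B] (f c) * X (chartEmb c i))
    (d * n + 1) (((hABh _).mul (isHomogeneous_X _ _)).sub ((hABh _).mul (isHomogeneous_X _ _)))).2 (by
      rw [map_sub, map_mul, map_mul, hfAB, hfAB, aeval_X, aeval_X]; ring)
  have hσ : (fun j => ψ (aeval (dehomMap (K := K) c) ((![A, B] : Fin 2 → MvPolynomial (Fin 3) K) j))) =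
      fun j => zz K ^ k * σ j := by
    funext j
    fin_cases j
    · exact h1
    · exact h2
  have hψf : ∀ j, ψ (aeval (dehomMap (K := K) c) (aeval ![A, B] (f j))) =
      (zz K ^ k) ^ n * aeval σ (f j) := by
    intro j
    rw [← aeval_mul_homog (hf.homog j), ← hσ, ← AlgHom.comp_apply, ← AlgHom.comp_apply, comp_aeval]
    rfl
  rw [map_sub, map_sub, map_mul, map_mul, map_mul, map_mul, hψf, hψf, aeval_X, aeval_X,
    dehomMap_self, dehomMap_emb, map_one, mul_one] at hN0
  have hz : (zz K ^ k) ^ n ≠ 0 := pow_ne_zero _ (pow_ne_zero _ PowerSeries.X_ne_zero)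
  apply mul_left_cancel₀ hz
  linear_combination hN0

end Lift
end ASing

namespace ASing
section Lift2
variable {K : Type*} [Field K]

lemma lift_reparam {n : ℕ} {f : Fin 3 → MvPolynomial (Fin 2) K} (hf : ∀ u, (f u).IsHomogeneous n)
    (c : Fin 3) (σ : Fin 2 → PowerSeries K) (q : Fin 2 → K)
    (hσ : ∀ i, PowerSeries.constantCoeff (σ i) = q i)
    {ψ : MvPolynomial (Fin 2) K →ₐ[K] PowerSeries K}
    (h4 : ∀ i, aeval σ (f (chartEmb c i)) = aeval σ (f c) * ψ (X i))
    (hfc : eval q (f c) ≠ 0) (r : Fin 2 → K) (hqr : q 1 * r 0 - q 0 * r 1 ≠ 0) :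
    ∃ (τ : PowerSeries K) (h : PowerSeries.constantCoeff τ = 0),
      ψ = (subT τ h).comp (br f c (ln q r)) := by
  let D := q 1 * r 0 - q 0 * r 1
  let u : PowerSeries K := PowerSeries.C D⁻¹ * (σ 1 * PowerSeries.C (r 0) - σ 0 * PowerSeries.C (r 1))
  let w : PowerSeries K := PowerSeries.C D⁻¹ * (PowerSeries.C (q 1) * σ 0 - PowerSeries.C (q 0) * σ 1)
  have hu : PowerSeries.constantCoeff u = 1 := by
    simp only [u, map_mul, map_sub, PowerSeries.constantCoeff_C, hσ]
    exact inv_mul_cancel₀ hqr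
  have hw : PowerSeries.constantCoeff w = 0 := by
    simp only [w, map_mul, map_sub, PowerSeries.constantCoeff_C, hσ]
    ring
  have huu : u * u⁻¹ = 1 := PowerSeries.mul_inv_cancel _ (by rw [hu]; exact one_ne_zero)
  have hD : PowerSeries.C D⁻¹ * (PowerSeries.C (q 1) * PowerSeries.C (r 0) -
      PowerSeries.C (q 0) * PowerSeries.C (r 1)) = 1 := by
    rw [← map_mul, ← map_mul, ← map_sub, ← map_mul, inv_mul_cancel₀ hqr, map_one]
  have hsol : ∀ i, σ i = u * PowerSeries.C (q i) + w * PowerSeries.C (r i) := by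
    intro i
    fin_cases i
    · simp only [u, w, Fin.zero_eta]
      linear_combination (-σ 0) * hD
    · simp only [u, w, Fin.mk_one]
      linear_combination (-σ 1) * hD
  have hτ : PowerSeries.constantCoeff (w * u⁻¹) = 0 := by rw [map_mul, hw, zero_mul]
  refine ⟨w * u⁻¹, hτ, ?_⟩
  have hσ' : σ = fun i => u * subT _ hτ (ln q r i) := by
    funext i
    have hC : ∀ x : K, subT _ hτ (PowerSeries.C x) = PowerSeries.C x := fun x => (subT _ hτ).commutes x
    rw [hsol i]
    simp only [ln, map_add, map_mul, subT_X, hC]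
    linear_combination (-(w * PowerSeries.C (r i))) * huu
  have hae : ∀ j, aeval σ (f j) = u ^ n * subT _ hτ (aeval (ln q r) (f j)) := by
    intro j
    conv_lhs => rw [hσ']
    rw [aeval_mul_homog (hf j), ← AlgHom.comp_apply, comp_aeval]
  have hne : aeval σ (f c) ≠ 0 := by
    intro h
    have := aeval_const σ (f c)
    rw [h] at this
    simp only [hσ] at this
    exact hfc (by rw [← this]; simp)
  have hne' : PowerSeries.constantCoeff (aeval (ln q r) (f c)) ≠ 0 := by
    rw [aeval_ln_const]; exact hfc
  apply MvPolynomial.algHom_ext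
  intro i
  apply mul_left_cancel₀ hne
  rw [← h4 i, hae, hae, AlgHom.comp_apply, mul_assoc (u ^ n), ← map_mul (subT _ hτ)]
  congr 2
  rw [br, aeval_X, ← mul_assoc, PowerSeries.mul_inv_cancel _ hne', one_mul]

variable [IsAlgClosed K] {n : ℕ} {f : Fin 3 → MvPolynomial (Fin 2) K}

lemma branch_lift (hn : 3 ≤ n) (hf : IsProperParam n f)
    {F : MvPolynomial (Fin 3) K} (hFirr : Irreducible F) (hFhom : F.IsHomogeneous n)
    (hFf : MvPolynomial.aeval f F = 0) {c : Fin 3} {p : Fin 3 → K} (hpc : p c ≠ 0)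
    {d : ℕ} {A B : MvPolynomial (Fin 3) K} (hA : A.IsHomogeneous d) (hB : B.IsHomogeneous d)
    (hAB : X 1 * aeval f A = X 0 * aeval f B) (hB0 : aeval f B ≠ 0)
    {ψ : MvPolynomial (Fin 2) K →ₐ[K] PowerSeries K} (hc : Cent (affOf p c) ψ)
    (hi : Imm (affOf p c) ψ)
    (hψ : ψ (aeval (dehomMap (K := K) c) F) = 0) :
    ∃ q : Fin 2 → K, q ≠ 0 ∧ (∃ lam : K, lam ≠ 0 ∧ evalVec f q = lam • p) ∧
      (∀ r : Fin 2 → K, q 1 * r 0 - q 0 * r 1 ≠ 0 →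
        ∀ g t, zz K ^ t ∣ ψ g ↔ zz K ^ t ∣ br f c (ln q r) g) ∧
      (∀ (v r : Fin 2 → K) (lam : K), v 1 * r 0 - v 0 * r 1 ≠ 0 → lam ≠ 0 →
        evalVec f v = lam • p → ∀ χ : PowerSeries K →ₐ[K] PowerSeries K,
        br f c (ln v r) = χ.comp ψ → q 1 * v 0 - q 0 * v 1 = 0) := by
  obtain ⟨k, σ, h1, h2, h3, h4⟩ := lift_sigma hn hf hFirr hFhom hFf c hA hB hAB hB0 hc hi hψ
  obtain ⟨q, hq⟩ : ∃ q : Fin 2 → K, q = fun i => PowerSeries.constantCoeff (σ i) := ⟨_, rfl⟩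
  have hσ : ∀ i, PowerSeries.constantCoeff (σ i) = q i := fun i => (congrFun hq i).symm
  rw [← hq] at h3
  have hev : ∀ i, eval q (f (chartEmb c i)) = eval q (f c) * affOf p c i := by
    intro i
    have := congrArg PowerSeries.constantCoeff (h4 i)
    rw [map_mul, aeval_const, aeval_const, hc, ← hq, eval_X] at this
    exact this
  have hfc : eval q (f c) ≠ 0 := by
    intro h0
    apply hf.no_common_zero q h3
    funext j
    rcases chart_cases c j with rfl | ⟨i, rfl⟩
    · exact h0
    · change eval q (f (chartEmb c i)) = 0
      rw [hev, h0, zero_mul]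
  have hpre : evalVec f q = (eval q (f c) / p c) • p := by
    funext j
    simp only [Pi.smul_apply, smul_eq_mul]
    rcases chart_cases c j with rfl | ⟨i, rfl⟩
    · rw [div_mul_cancel₀ _ hpc]; rfl
    · change eval q (f (chartEmb c i)) = _
      rw [hev, affOf]; ring
  have hlam : eval q (f c) / p c ≠ 0 := div_ne_zero hfc hpc
  refine ⟨q, h3, ⟨_, hlam, hpre⟩, ?_, ?_⟩
  · intro r hqr g t
    obtain ⟨τ, hτ, he⟩ := lift_reparam hf.homog c σ q hσ h4 hfc r hqr
    have hbc : Cent (affOf p c) (br f c (ln q r)) :=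
      br_cent f c _ q (ln_const q r) p _ hlam hpre hpc
    have hτ2 : ¬ zz K ^ 2 ∣ τ := by
      intro h
      obtain ⟨x, hx, hx1⟩ := hi
      rw [coeff_one_ne_zero_iff ((hc.dvd_iff x).2 hx)] at hx1
      apply hx1
      obtain ⟨e, he'⟩ := (hbc.dvd_iff x).2 hx
      rw [he, AlgHom.comp_apply, he', map_mul, subT_X]
      exact h.mul_right _
    rw [he, AlgHom.comp_apply, subT_dvd_iff τ hτ hτ2]
  · intro v r lam hvr hl hv χ hχ
    have hvc : PowerSeries.constantCoeff (aeval (ln v r) (f c)) ≠ 0 := by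
      rw [aeval_ln_const]
      have := congrFun hv c
      simp only [evalVec, Pi.smul_apply, smul_eq_mul] at this
      rw [this]
      exact mul_ne_zero hl hpc
    have hvc' : aeval (ln v r) (f c) ≠ 0 := by
      intro h; rw [h] at hvc; simp at hvc
    have hχz : χ (zz K) ≠ 0 := by
      intro h0
      obtain ⟨u, hu, hu0⟩ := exists_form_zero (n := n) (by omega) (hf.homog c)
      apply hf.no_common_zero u hu
      funext j
      rcases chart_cases c j with rfl | ⟨i, rfl⟩
      · exact hu0
      have hm : (X i - C (affOf p c i) : MvPolynomial (Fin 2) K) ∈ mI (affOf p c) := by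
        rw [mem_mI]; simp
      obtain ⟨e, he⟩ := (hc.dvd_iff _).2 hm
      have hb : br f c (ln v r) (X i - C (affOf p c i)) = 0 := by
        rw [hχ, AlgHom.comp_apply, he, map_mul, h0, zero_mul]
      have hh : (X (chartEmb c i) - C (affOf p c i) * X c : MvPolynomial (Fin 3) K).IsHomogeneous 1 :=
        (isHomogeneous_X _ _).sub (isHomogeneous_C_mul_X _ _)
      have hb2 := br_dehom f c (ln v r) hvc hh
      have hde : aeval (dehomMap (K := K) c) (X (chartEmb c i) - C (affOf p c i) * X c) =
          X i - C (affOf p c i) := by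
        rw [map_sub, map_mul, aeval_X, aeval_X, dehomMap_self, dehomMap_emb, mul_one, algHom_C]
        rfl
      rw [hde, hb, mul_zero] at hb2
      have hb3 := aeval_ln_inj hvr (hh.aeval f hf.homog) hb2
      have hb4 : f (chartEmb c i) = C (affOf p c i) * f c := by
        rw [map_sub, map_mul, aeval_X, aeval_X, algHom_C, sub_eq_zero] at hb3
        exact hb3
      change eval u (f (chartEmb c i)) = 0
      rw [hb4, map_mul, hu0, mul_zero]
    have e1 := br_dehom f c (ln v r) hvc hA
    have e2 := br_dehom f c (ln v r) hvc hB
    have e3 := congrArg (aeval (ln v r)) hAB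
    rw [map_mul, map_mul, aeval_X, aeval_X, e1, e2, hχ, AlgHom.comp_apply, AlgHom.comp_apply,
      h1, h2, map_mul, map_mul, map_pow] at e3
    have e4 : ln v r 1 * χ (σ 0) = ln v r 0 * χ (σ 1) := by
      apply mul_left_cancel₀ (mul_ne_zero (pow_ne_zero d hvc') (pow_ne_zero k hχz))
      linear_combination e3
    have e5 := congrArg PowerSeries.constantCoeff e4
    rw [map_mul, map_mul, algHom_local, algHom_local, ln_const, ln_const, hσ, hσ] at e5
    linear_combination -e5

end Lift2
end ASing

namespace ASing
section Fwd
variable {K : Type*} [Field K]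

lemma dvd_of_no_zero [IsAlgClosed K] {ι : Type*} (H : ι → MvPolynomial (Fin 2) K)
    (hH : ∀ v : Fin 2 → K, (∀ i, eval v (H i) = 0) → v = 0) {D L : MvPolynomial (Fin 2) K}
    (hD : ∀ i, D ∣ L * H i) : D ∣ L := by
  have hrad : ∀ k : Fin 2, ∃ N : ℕ, (X k : MvPolynomial (Fin 2) K) ^ N ∈ Ideal.span (Set.range H) := by
    intro k
    have : (X k : MvPolynomial (Fin 2) K) ∈ (Ideal.span (Set.range H)).radical := by
      rw [← MvPolynomial.vanishingIdeal_zeroLocus_eq_radical (K := K), mem_vanishingIdeal_iff]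
      intro v hv
      have hv0 : v = 0 := by
        apply hH
        intro i
        have := mem_zeroLocus_iff.1 hv (H i) (Ideal.subset_span ⟨i, rfl⟩)
        simpa [aeval_eq_eval] using this
      simp [hv0]
    exact this
  have hI : ∀ x ∈ Ideal.span (Set.range H), D ∣ L * x := by
    intro x hx
    induction hx using Submodule.span_induction with
    | mem x hx => obtain ⟨i, rfl⟩ := hx; exact hD i
    | zero => simp
    | add x y _ _ hx hy => rw [mul_add]; exact dvd_add hx hy
    | smul a x _ hx =>
      rw [smul_eq_mul, mul_left_comm]
      exact Dvd.dvd.mul_left hx _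
  obtain ⟨a, ha⟩ := hrad 0
  obtain ⟨b, hb⟩ := hrad 1
  obtain ⟨E, hE⟩ := hI _ ha
  obtain ⟨E', hE'⟩ := hI _ hb
  have hX0 : (X 0 : MvPolynomial (Fin 2) K) ^ a ≠ 0 := pow_ne_zero _ (X_ne_zero _)
  by_cases hD0 : D = 0
  · rw [hD0, zero_mul] at hE
    rcases mul_eq_zero.1 hE with h | h
    · rw [h]; exact dvd_zero _
    · exact absurd h hX0
  have hrel : IsRelPrime ((X 0 : MvPolynomial (Fin 2) K) ^ a) ((X 1 : MvPolynomial (Fin 2) K) ^ b) := by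
    apply IsRelPrime.pow
    rw [(X_prime (i := (0 : Fin 2)) (R := K)).irreducible.isRelPrime_iff_not_dvd]
    intro h
    have := (X_dvd_X (R := K)).1 h
    simp at this
  have hd : (X 0 : MvPolynomial (Fin 2) K) ^ a ∣ E := by
    refine hrel.dvd_of_dvd_mul_right (y := E) ?_
    refine ⟨E', ?_⟩
    apply mul_left_cancel₀ hD0
    linear_combination X 0 ^ a * hE' - X 1 ^ b * hE
  obtain ⟨E₁, rfl⟩ := hd
  refine ⟨E₁, ?_⟩
  apply mul_right_cancel₀ hX0
  rw [hE]; ring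

variable {n : ℕ} {f : Fin 3 → MvPolynomial (Fin 2) K} {p : Fin 3 → K}

lemma pre_const {q r : Fin 2 → K} (hq : ∃ lam : K, lam ≠ 0 ∧ evalVec f q = lam • p)
    {c : Fin 3} (hpc : p c ≠ 0) :
    PowerSeries.constantCoeff (aeval (ln q r) (f c)) ≠ 0 := by
  obtain ⟨lam, hl, hp⟩ := hq
  rw [aeval_ln_const]
  have := congrFun hp c
  simp only [evalVec, Pi.smul_apply, smul_eq_mul] at this
  rw [this]
  exact mul_ne_zero hl hpc

lemma pre_dvd (hf : ∀ u, (f u).IsHomogeneous n) {q r : Fin 2 → K}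
    (hqr : q 1 * r 0 - q 0 * r 1 ≠ 0)
    (hq : ∃ lam : K, lam ≠ 0 ∧ evalVec f q = lam • p) {c : Fin 3} (hpc : p c ≠ 0) (t : ℕ) {d : ℕ}
    {H : MvPolynomial (Fin 3) K} (hH : H.IsHomogeneous d) :
    zz K ^ t ∣ br f c (ln q r) (aeval (dehomMap c) H) ↔ linFormOf q ^ t ∣ aeval f H := by
  rw [br_dvd f c _ (pre_const hq hpc) hH, pow_dvd_iff hqr t (hH.aeval f hf)]

lemma exists_indep {q : Fin 2 → K} (hq : q ≠ 0) : ∃ r : Fin 2 → K, q 1 * r 0 - q 0 * r 1 ≠ 0 := by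
  by_contra hcon
  push Not at hcon
  apply hq
  have h1 := hcon ![1, 0]
  have h2 := hcon ![0, 1]
  simp at h1 h2
  funext i
  fin_cases i
  · exact h2
  · exact h1

lemma imm_transfer {a : Fin 2 → K} {ψ φ : MvPolynomial (Fin 2) K →ₐ[K] PowerSeries K}
    (hc : Cent a ψ) (hc' : Cent a φ) (hi : Imm a ψ) (h : ∀ g t, zz K ^ t ∣ ψ g ↔ zz K ^ t ∣ φ g) :
    Imm a φ := by
  obtain ⟨g, hg, h1⟩ := hi
  refine ⟨g, hg, ?_⟩
  rw [coeff_one_ne_zero_iff ((hc.dvd_iff g).2 hg)] at h1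
  rw [coeff_one_ne_zero_iff ((hc'.dvd_iff g).2 hg), ← h]
  exact h1

lemma crossDiff_homog (hf : ∀ u, (f u).IsHomogeneous n) (p : Fin 3 → K) (i j : Fin 3) :
    (crossDiff f p i j).IsHomogeneous n := by
  have := (lin_homog p i j).aeval f hf
  rw [← crossDiff_eq, mul_one] at this
  exact this

lemma crossDiff_zero {q : Fin 2 → K} (hq : ∃ lam : K, lam ≠ 0 ∧ evalVec f q = lam • p)
    (i j : Fin 3) : eval q (crossDiff f p i j) = 0 := by
  obtain ⟨lam, hl, hp⟩ := hq
  have hp' : ∀ u, eval q (f u) = lam * p u := fun u => congrFun hp u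
  simp only [crossDiff, map_sub, map_mul, eval_C, hp']
  ring

lemma gcd_cross [IsAlgClosed K] (hf : IsProperParam n f) (hp : p ≠ 0) {q r : Fin 2 → K}
    (htp : TwoPre n f p q r)
    (h₁ : HImm f p q) (h₂ : HImm f p r)
    (honly : ∀ v : Fin 2 → K, v ≠ 0 → (∃ lam : K, lam ≠ 0 ∧ evalVec f v = lam • p) →
      q 1 * v 0 - q 0 * v 1 = 0 ∨ r 1 * v 0 - r 0 * v 1 = 0) :
    IsGcdOfCross f p (linFormOf q * linFormOf r) := by
  have hq : q ≠ 0 := by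
    rintro rfl
    exact htp.indep (by simp)
  have hr : r ≠ 0 := by
    rintro rfl
    exact htp.indep (by simp)
  have hdiv : ∀ i j, linFormOf q * linFormOf r ∣ crossDiff f p i j := by
    intro i j
    have hh := crossDiff_homog hf.homog p i j
    have := (mul_pow_dvd htp.indep 1 hh).2 ⟨by
      rw [pow_one]; exact linFormOf_dvd hq hh (crossDiff_zero htp.pre₁ i j), by
      rw [pow_one]; exact linFormOf_dvd hr hh (crossDiff_zero htp.pre₂ i j)⟩
    rwa [pow_one] at this
  refine ⟨fun i j _ => hdiv i j, ?_⟩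
  intro D hD
  have hDall := cross_all hD
  have hH : ∀ ij : Fin 3 × Fin 3, ∃ H₁ : MvPolynomial (Fin 2) K,
      crossDiff f p ij.1 ij.2 = linFormOf q * linFormOf r * H₁ ∧ ∃ e, H₁.IsHomogeneous e := by
    intro ij
    obtain ⟨e, H₁, h, h'⟩ := homog_dvd ((linFormOf_homog q).mul (linFormOf_homog r))
      (crossDiff_homog hf.homog p ij.1 ij.2) (hdiv ij.1 ij.2)
    exact ⟨H₁, h, e, h'⟩
  choose H hH1 e hH2 using hH
  apply dvd_of_no_zero H
  · intro v hv
    by_contra hv0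
    have hpre : ∃ lam : K, lam ≠ 0 ∧ evalVec f v = lam • p := by
      apply pre_of_cross hp (hf.no_common_zero v hv0)
      intro i j
      rw [hH1 (i, j), map_mul, hv, mul_zero]
    have key : ∀ q' : Fin 2 → K, q' ≠ 0 → linFormOf q' ∣ linFormOf q * linFormOf r →
        q' 1 * v 0 - q' 0 * v 1 = 0 → ¬ HImm f p q' := by
      rintro q' hq' hd hdet ⟨i, j, hij⟩
      apply hij
      obtain ⟨d, rfl⟩ := exists_smul_of_det hq' hdet
      have hd0 : d ≠ 0 := by rintro rfl; simp at hv0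
      have h0 : eval q' (H (i, j)) = 0 := by
        have := hv (i, j)
        rw [eval_smul_homog (hH2 (i, j))] at this
        exact (mul_eq_zero.1 this).resolve_left (pow_ne_zero _ hd0)
      have := linFormOf_dvd hq' (hH2 (i, j)) h0
      rw [hH1 (i, j), pow_two]
      exact mul_dvd_mul hd this
    rcases honly v hv0 hpre with h | h
    · exact key q hq (dvd_mul_right _ _) h h₁
    · exact key r hr (dvd_mul_left _ _) h h₂
  · intro ij
    rw [← hH1]
    exact hDall _ _

theorem forward [IsAlgClosed K] [CharZero K] (hn : 3 ≤ n)
    (hf : IsProperParam n f)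
    (F : MvPolynomial (Fin 3) K) (hFirr : Irreducible F) (hFhom : F.IsHomogeneous n)
    (hFf : MvPolynomial.aeval f F = 0) (hp : p ≠ 0)
    (m : ℕ) (hm : 1 ≤ m) (hs : IsAsSing F p (2 * m - 1)) :
    ∃ L₁ L₂ : MvPolynomial (Fin 2) K,
        L₁.IsHomogeneous 1 ∧ L₂.IsHomogeneous 1 ∧ L₁ ≠ 0 ∧ L₂ ≠ 0 ∧
        (∀ d : K, L₂ ≠ MvPolynomial.C d * L₁) ∧
        IsGcdOfCross f p (L₁ * L₂) ∧
        CurvilinearOfLength (JIdeal f ((L₁ * L₂) ^ m)) p m ∧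
        (∀ t : ℕ, m < t → ¬ CurvilinearOfLength (JIdeal f ((L₁ * L₂) ^ t)) p t) := by
  obtain ⟨c, hpc⟩ : ∃ c, p c ≠ 0 := by
    by_contra hcon
    push Not at hcon
    exact hp (funext hcon)
  have hs' := hs c hpc
  have hmm : 2 * m - 1 + 1 = 2 * m := by omega
  rw [hmm] at hs'
  obtain ⟨e, he⟩ := hs'
  obtain ⟨e'⟩ := Q_equiv (K := K) m hm
  obtain ⟨ψ₁, ψ₂, c₁, c₂, i₁, i₂, z₁, z₂, hcm, hncm, hfac⟩ :=
    forward_extract (affOf p c) (aeval (dehomMap (K := K) c) F) m hm (e.trans e'.toRingEquiv) (by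
      intro x
      rw [toComp_apply, ← algebraMap_eq_toLoc, RingEquiv.trans_apply, he x]
      exact e'.commutes x)
  obtain ⟨d, A, B, hA, hB, hAB, hB0⟩ := bir hf
  obtain ⟨q, hq, hqpre, hqd, hqv⟩ := branch_lift hn hf hFirr hFhom hFf hpc hA hB hAB hB0 c₁ i₁ z₁
  obtain ⟨r, hr, hrpre, hrd, hrv⟩ := branch_lift hn hf hFirr hFhom hFf hpc hA hB hAB hB0 c₂ i₂ z₂
  have hqr : q 1 * r 0 - q 0 * r 1 ≠ 0 := by
    intro h0
    apply hncm
    obtain ⟨d, rfl⟩ := exists_smul_of_det hq h0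
    have hd0 : d ≠ 0 := by rintro rfl; simp at hr
    obtain ⟨w, hw⟩ := exists_indep hq
    have hw' : (d • q) 1 * w 0 - (d • q) 0 * w 1 ≠ 0 := by
      have : (d • q) 1 * w 0 - (d • q) 0 * w 1 = d * (q 1 * w 0 - q 0 * w 1) := by
        simp only [Pi.smul_apply, smul_eq_mul]; ring
      rw [this]
      exact mul_ne_zero hd0 hw
    intro g
    rw [hqd w hw, hrd w hw']
    obtain ⟨k, H, hH, rfl⟩ := exists_homogenize c g
    rw [pre_dvd hf.homog hw hqpre hpc _ hH, pre_dvd hf.homog hw' hrpre hpc _ hH,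
      linFormOf_smul, mul_pow]
    have hu : IsUnit (C d : MvPolynomial (Fin 2) K) := (isUnit_iff_ne_zero.2 hd0).map C
    exact (hu.pow (m + 1)).mul_left_dvd.symm
  have htp : TwoPre n f p q r := ⟨hf.homog, hqr, hqpre, hrpre⟩
  have hcon : ∀ t, HC f q r t ↔ Contact ψ₁ ψ₂ t := by
    intro t
    rw [← htp.contact_iff hpc]
    refine forall_congr' fun g => ?_
    rw [hqd r hqr, hrd q htp.symm.indep]
  have hi1 : HImm f p q := (htp.imm_iff hpc).1 (imm_transfer c₁ (htp.cent hpc) i₁ (hqd r hqr))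
  have hi2 : HImm f p r :=
    (htp.symm.imm_iff hpc).1 (imm_transfer c₂ (htp.symm.cent hpc) i₂ (hrd q htp.symm.indep))
  refine ⟨linFormOf q, linFormOf r, linFormOf_homog q, linFormOf_homog r, linFormOf_ne_zero hq,
    linFormOf_ne_zero hr, ?_, ?_, ?_, ?_⟩
  · intro d hd
    have := congrArg (eval q) hd
    rw [map_mul, eval_linFormOf, eval_linFormOf] at this
    apply hqr
    linear_combination -this
  · refine gcd_cross hf hp htp hi1 hi2 ?_
    intro v hv hpre
    obtain ⟨w, hw⟩ := exists_indep hv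
    have hz : br f c (ln v w) (aeval (dehomMap (K := K) c) F) = 0 := by
      have := (br_dvd f c _ (pre_const (r := w) hpre hpc) hFhom 0).2 (by rw [hFf, map_zero])
      exact zero_dvd_iff.1 this
    obtain ⟨lam, hl, hvp⟩ := hpre
    obtain ⟨χ, h | h⟩ := hfac _ (br_cent f c _ v (ln_const v w) p lam hl hvp hpc) hz
    · exact Or.inl (hqv v w lam hw hl hvp χ h)
    · exact Or.inr (hrv v w lam hw hl hvp χ h)
  · exact (htp.curv hi1 hi2 hp m).2 ((hcon m).2 hcm)
  · intro t ht hcurv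
    apply hncm
    exact Contact.mono c₁ c₂ i₁ i₂ (show m + 1 ≤ t from ht) ((hcon t).1 ((htp.curv hi1 hi2 hp t).1 hcurv))

end Fwd
end ASing

/-- Let `P` be a double point of `C` and `m ≥ 1`. Then `P` is an `A_{2m-1}` singularity iff
`G_P = L₁·L₂` with `L₁, L₂` non-proportional linear forms and `m` is the largest `t ≥ 1` such
that the local ring at `P` of the ideal `J_t` (generated by the homogeneous `h` with
`(L₁L₂)^t ∣ h(f₀,f₁,f₂)`) is isomorphic as a `K`-algebra to `K[u]/(u^t)`. -/
theorem statement_15 {K : Type*} [Field K] [IsAlgClosed K] [CharZero K]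
    (n : ℕ) (hn : 3 ≤ n) (f : Fin 3 → MvPolynomial (Fin 2) K)
    (hf : IsProperParam n f)
    (F : MvPolynomial (Fin 3) K) (hFirr : Irreducible F) (hFhom : F.IsHomogeneous n)
    (hFf : MvPolynomial.aeval f F = 0)
    (p : Fin 3 → K) (hp : p ≠ 0) (hmult : multAt F p = 2)
    (m : ℕ) (hm : 1 ≤ m) :
    IsAsSing F p (2 * m - 1) ↔
      ∃ L₁ L₂ : MvPolynomial (Fin 2) K,
        L₁.IsHomogeneous 1 ∧ L₂.IsHomogeneous 1 ∧ L₁ ≠ 0 ∧ L₂ ≠ 0 ∧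
        (∀ d : K, L₂ ≠ MvPolynomial.C d * L₁) ∧
        IsGcdOfCross f p (L₁ * L₂) ∧
        CurvilinearOfLength (JIdeal f ((L₁ * L₂) ^ m)) p m ∧
        (∀ t : ℕ, m < t → ¬ CurvilinearOfLength (JIdeal f ((L₁ * L₂) ^ t)) p t) := by
  constructor
  · intro hs
    exact ASing.forward hn hf F hFirr hFhom hFf hp m hm hs
  · rintro ⟨L₁, L₂, h1, h2, h10, h20, hprop, hgcd, hcm, hncm⟩
    exact ASing.backward n f hf F hFhom hFf p hp hmult m hm L₁ L₂ h1 h2 h10 h20 hprop hgcd hcm hncm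

end
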